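/- Let G be a finite group with trivial soluble radical, and let x ∈ G be an element of order 3 with C_G(x) = ⟨x⟩. Then |Sol_G(x)| ∈ {24, 78}. -/

import Mathlib

def Sol {G : Type*} [Group G] (x : G) : Set G :=
  {y | IsSolvable ↥(Subgroup.closure {x, y})}

namespace FT

universe u

/-- self-centralizing element of order three -/
structure SC {G : Type u} [Group G] (x : G) : Prop where
  ord : orderOf x = 3
  cent : ∀ y, y * x = x * y → y = 1 ∨ y = x ∨ y = x⁻¹

/-- three-torsion free -/
def Fr {G : Type u} [Group G] (M : Subgroup G) : Prop := ∀ m ∈ M, m ^ 3 = 1 → m = 1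

/-- three-torsion-free subgroup normalized by `x` -/
structure XI {G : Type u} [Group G] (x : G) (M : Subgroup G) : Prop where
  inv : ∀ m ∈ M, x * m * x⁻¹ ∈ M
  fr : Fr M

section
variable {G : Type u} [Group G]

lemma SC.cube {x : G} (h : SC x) : x ^ 3 = 1 := by rw [← h.ord]; exact pow_orderOf_eq_one x

lemma SC.xxx {x : G} (h : SC x) : x * x * x = 1 := by
  have := h.cube; rwa [pow_succ, pow_two] at this

lemma SC.sq {x : G} (h : SC x) : x * x = x⁻¹ := eq_inv_of_mul_eq_one_left h.xxx

lemma SC.isq {x : G} (h : SC x) : x⁻¹ * x⁻¹ = x := by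
  rw [← mul_inv_rev, h.sq, inv_inv]

lemma SC.ne_one {x : G} (h : SC x) : x ≠ 1 := by
  rintro rfl; have := h.ord; simp at this

lemma SC.ne_inv {x : G} (h : SC x) : x ≠ x⁻¹ := by
  intro h1
  have h2 := h.isq
  rw [← h1, h.sq] at h2
  have h3 := h.xxx
  rw [h.sq] at h3
  have h4 : x * x = 1 := by nth_rewrite 2 [h1]; simp
  rw [h.sq] at h4
  exact h.ne_one (inv_eq_one.mp h4)

lemma SC.inv {x : G} (h : SC x) : SC x⁻¹ := by
  refine ⟨by rw [orderOf_inv]; exact h.ord, fun y hy => ?_⟩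
  rw [inv_inv]
  have : y * x = x * y := by
    have := congrArg (fun z => x * z * x) hy
    simp only [mul_assoc, inv_mul_cancel, mul_one, mul_inv_cancel_left] at this
    exact this.symm
  rcases h.cent y this with h | h | h <;> tauto

lemma SC.conj {x : G} (h : SC x) (g : G) : SC (g * x * g⁻¹) := by
  refine ⟨by rw [← h.ord]; exact orderOf_injective (MulAut.conj g).toMonoidHom (MulAut.conj g).injective x, fun y hy => ?_⟩
  have : (g⁻¹ * y * g) * x = x * (g⁻¹ * y * g) := by
    have := congrArg (fun z => g⁻¹ * z * g) hy
    simpa [mul_assoc] using this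
  rcases h.cent _ this with h | h | h
  · left; rw [mul_assoc, inv_mul_eq_one] at h; 
    have := congrArg (fun z => z * g⁻¹) h; simpa using this.symm
  · right; left; rw [← h]; group
  · right; right; rw [mul_inv_rev, mul_inv_rev, ← h]; group

lemma SC.cent_cube {x : G} (h : SC x) {y : G} (hy : y * x = x * y) : y ^ 3 = 1 := by
  rcases h.cent y hy with rfl | rfl | rfl
  · simp
  · exact h.cube
  · rw [inv_pow, h.cube, inv_one]

lemma XI.inv' {x : G} (h : SC x) {M : Subgroup G} (hM : XI x M) : XI x⁻¹ M := by
  refine ⟨fun m hm => ?_, hM.fr⟩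
  have := hM.inv _ (hM.inv m hm)
  rw [← h.sq]
  simpa [mul_assoc] using this

lemma XI.iinv {x : G} (h : SC x) {M : Subgroup G} (hM : XI x M) {m : G} (hm : m ∈ M) : x⁻¹ * m * x ∈ M := by
  simpa using (hM.inv' h).inv m hm

lemma Fr.not_mem {x : G} (h : SC x) {M : Subgroup G} (hM : Fr M) : x ∉ M := fun hx =>
  h.ne_one (hM x hx h.cube)

/-- Lemma F -/
lemma lemF [Finite G] {x : G} (h : SC x) {M : Subgroup G} (hM : XI x M) {m : G} (hm : m ∈ M) :
    ∃ w ∈ M, m * x = w * x * w⁻¹ := by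
  let f : M → M := fun w => ⟨w * (x * w⁻¹ * x⁻¹), M.mul_mem w.2 (hM.inv _ (M.inv_mem w.2))⟩
  have hf : Function.Injective f := by
    intro w v hwv
    have e : (w : G) * (x * w⁻¹ * x⁻¹) = v * (x * v⁻¹ * x⁻¹) := congrArg Subtype.val hwv
    have : ((v : G)⁻¹ * w) * x = x * ((v:G)⁻¹ * w) := by
      have := congrArg (fun z => (v:G)⁻¹ * z * x * w) e
      simpa [mul_assoc] using this
    have h1 := hM.fr _ (M.mul_mem (M.inv_mem v.2) w.2) (h.cent_cube this)
    rw [inv_mul_eq_one] at h1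
    exact Subtype.ext h1.symm
  obtain ⟨w, hw⟩ := (Finite.injective_iff_surjective.mp hf) ⟨m, hm⟩
  refine ⟨w, w.2, ?_⟩
  have : (w : G) * (x * (w:G)⁻¹ * x⁻¹) = m := congrArg Subtype.val hw
  rw [← this]; group

lemma XI.smul [Finite G] {x : G} (h : SC x) {M : Subgroup G} (hM : XI x M) {m : G} (hm : m ∈ M) : SC (m * x) ∧ XI (m * x) M := by
  obtain ⟨w, hw, e⟩ := lemF h hM hm
  refine ⟨by rw [e]; exact h.conj w, fun n hn => ?_, hM.fr⟩
  have := M.mul_mem (M.mul_mem hm (hM.inv n hn)) (M.inv_mem hm)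
  simpa [mul_assoc] using this

lemma XI.prod1 [Finite G] {x : G} (h : SC x) {M : Subgroup G} (hM : XI x M) {m : G} (hm : m ∈ M) :
    m * (x * m * x⁻¹) * (x⁻¹ * m * x) = 1 := by
  have h1 := (hM.smul h hm).1.xxx
  have : m * (x * m * x⁻¹) * (x⁻¹ * m * x) = m * (x * m) * (x⁻¹ * x⁻¹) * m * x := by group
  rw [this, h.isq, ← h1]; group

lemma XI.comm1 [Finite G] {x : G} (h : SC x) {M : Subgroup G} (hM : XI x M) {m : G} (hm : m ∈ M) :
    Commute m (x * m * x⁻¹) := by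
  have h1 := hM.prod1 h hm
  have h2 := (hM.inv' h).prod1 h.inv hm
  rw [inv_inv] at h2
  have h3 : (x * m * x⁻¹) * (x⁻¹ * m * x) = (x⁻¹ * m * x) * (x * m * x⁻¹) := by
    rw [mul_assoc] at h1 h2
    have := h1.trans h2.symm
    exact mul_left_cancel this
  have h4 := congrArg (fun z => x⁻¹ * z * x) h3
  have e : x⁻¹ * x⁻¹ = x := h.isq
  have e2 : x * x = x⁻¹ := h.sq
  have h5 : x⁻¹ * (x * m * x⁻¹ * (x⁻¹ * m * x)) * x = m * ((x⁻¹ * x⁻¹) * m * (x * x)) := by group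
  have h6 : x⁻¹ * (x⁻¹ * m * x * (x * m * x⁻¹)) * x = ((x⁻¹ * x⁻¹) * m * (x * x)) * m := by group
  rw [e, e2] at h5 h6
  simp only [h5, h6] at h4
  exact h4

/-- two-Engel property -/
lemma XI.engel [Finite G] {x : G} (h : SC x) {M : Subgroup G} (hM : XI x M) {m n : G} (hm : m ∈ M) (hn : n ∈ M) :
    Commute m (n * m * n⁻¹) := by
  have a1 := hM.smul h hn
  have a2 := (hM.inv' h).smul h.inv hn
  have b1 := a1.2.comm1 a1.1 hm
  have b2 := a2.2.comm1 a2.1 hm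
  have c := hM.prod1 h hm
  have : n * m * n⁻¹ = ((n * x * m * (n * x)⁻¹) * (n * x⁻¹ * m * (n * x⁻¹)⁻¹))⁻¹ := by
    rw [eq_inv_iff_mul_eq_one]
    have : n * m * n⁻¹ * (n * x * m * (n * x)⁻¹ * (n * x⁻¹ * m * (n * x⁻¹)⁻¹)) = n * (m * (x * m * x⁻¹) * (x⁻¹ * m * x)) * n⁻¹ := by group
    rw [this, c]; group
  rw [this]
  exact (b1.mul_right b2).inv_right

/-- coprime order elements commute -/
lemma XI.coprime_comm [Finite G] {x : G} (h : SC x) {M : Subgroup G} (hM : XI x M) {m n : G} (hm : m ∈ M) (hn : n ∈ M)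
    {j k : ℕ} (hj : m ^ j = 1) (hk : n ^ k = 1) (hjk : Nat.Coprime j k) : m * n = n * m := by
  have e1 : (m * (n * m * n⁻¹)⁻¹) ^ j = 1 := by
    rw [((hM.engel h hm hn).inv_right).mul_pow, inv_pow, conj_pow, hj]; simp
  have e2 : ((m * n * m⁻¹) * n⁻¹) ^ k = 1 := by
    rw [((hM.engel h hn hm).symm.inv_right).mul_pow, inv_pow, conj_pow, hk]; simp
  have e3 : m * (n * m * n⁻¹)⁻¹ = (m * n * m⁻¹) * n⁻¹ := by group
  rw [e3] at e1
  have := pow_gcd_eq_one.mpr ⟨e1, e2⟩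
  rw [hjk, pow_one] at this
  have := congrArg (fun z => z * n * m) this
  simpa [mul_assoc] using this

lemma Fr.of_le {M N : Subgroup G} (h : N ≤ M) (hM : Fr M) : Fr N := fun m hm => hM m (h hm)

lemma fr_iff [Finite G] {M : Subgroup G} : Fr M ↔ ¬ 3 ∣ Nat.card M := by
  constructor
  · intro h hd
    have : Fact (Nat.Prime 3) := ⟨Nat.prime_three⟩
    obtain ⟨y, hy⟩ := exists_prime_orderOf_dvd_card' 3 hd
    have h1 : y ^ 3 = 1 := by rw [← hy]; exact pow_orderOf_eq_one y
    have := h y y.2 (by exact_mod_cast congrArg Subtype.val h1)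
    have : y = 1 := Subtype.ext this
    rw [this] at hy; simp at hy
  · intro h m hm h1
    by_contra hne
    have : Fact (Nat.Prime 3) := ⟨Nat.prime_three⟩
    have := orderOf_eq_prime h1 hne
    exact h (this ▸ Subgroup.orderOf_dvd_natCard M hm)

lemma Fr.mem_of_cube [Finite G] {M N : Subgroup G} (hM : Fr M) {m : G} (hm : m ∈ M) (h : m ^ 3 ∈ N) : m ∈ N := by
  have h3 : ¬ 3 ∣ orderOf m := fun hd => fr_iff.mp hM (hd.trans (Subgroup.orderOf_dvd_natCard M hm))
  have hc : Nat.Coprime (orderOf m) 3 := ((Nat.Prime.coprime_iff_not_dvd Nat.prime_three).mpr h3).symm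
  obtain ⟨k, hk⟩ := exists_pow_eq_self_of_coprime hc.symm
  rw [← hk]; exact N.pow_mem h k

end
end FT

namespace FT
universe u
section
variable {G : Type u} [Group G]

lemma XI.card_mod [Finite G] {x : G} (h : SC x) {M : Subgroup G} (hM : XI x M) : Nat.card M % 3 = 1 := by
  classical
  have : Fintype M := Fintype.ofFinite _
  have : Fact (Nat.Prime 3) := ⟨Nat.prime_three⟩
  let f : Function.End M := fun m => ⟨x * m * x⁻¹, hM.inv m m.2⟩
  have hf : f ^ 3 ^ 1 = 1 := by
    funext m
    apply Subtype.ext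
    have e : (f ^ 3 ^ 1) m = f (f (f m)) := rfl
    rw [e]
    show x * (x * (x * (m : G) * x⁻¹) * x⁻¹) * x⁻¹ = m
    have : x * (x * (x * (m : G) * x⁻¹) * x⁻¹) * x⁻¹ = (x * x * x) * m * (x * x * x)⁻¹ := by group
    rw [this, h.xxx]; simp
  have := Equiv.Perm.card_fixedPoints_modEq (α := M) (p := 3) (n := 1) hf
  have h1 : Fintype.card (Function.fixedPoints f) = 1 := by
    rw [Fintype.card_eq_one_iff]
    refine ⟨⟨1, ?_⟩, ?_⟩
    · apply Subtype.ext; show x * 1 * x⁻¹ = 1; simp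
    · rintro ⟨m, hm⟩
      apply Subtype.ext
      have : x * (m : G) * x⁻¹ = m := congrArg Subtype.val hm
      have h2 : (m : G) * x = x * m := by
        rw [mul_inv_eq_iff_eq_mul] at this; exact this.symm
      exact Subtype.ext (hM.fr m m.2 (h.cent_cube h2))
  rw [h1] at this
  rw [Nat.card_eq_fintype_card]
  exact this

lemma XI.nilp [Finite G] {x : G} (h : SC x) {M : Subgroup G} (hM : XI x M) : Group.IsNilpotent M := by
  refine ((Group.isNilpotent_of_finite_tfae (G := M)).out 0 3).mpr ?_
  intro p hp P
  refine ⟨fun m hm n => ?_⟩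
  let A : Subgroup M := Subgroup.normalClosure {m}
  have hA : IsPGroup p A := by
    obtain ⟨k, hk⟩ := P.isPGroup'.exists_pow_pow_eq_one ⟨m, hm⟩
    have hk' : m ^ p ^ k = 1 := congrArg Subtype.val hk
    rw [isPGroup_iff_pow_pow_eq_one]
    have hc : ∀ a ∈ Group.conjugatesOfSet {m}, ∀ b ∈ Group.conjugatesOfSet {m}, a * b = b * a := by
      intro a ha b hb
      rw [Group.mem_conjugatesOfSet_iff] at ha hb
      obtain ⟨_, e1, ha⟩ := ha
      obtain ⟨_, e2, hb⟩ := hb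
      rw [Set.mem_singleton_iff.mp e1] at ha
      rw [Set.mem_singleton_iff.mp e2] at hb
      obtain ⟨s, rfl⟩ := isConj_iff.mp ha
      obtain ⟨t, rfl⟩ := isConj_iff.mp hb
      have := hM.engel h m.2 (s⁻¹ * t).2
      have h2 : m * ((s⁻¹ * t) * m * (s⁻¹ * t)⁻¹) = ((s⁻¹ * t) * m * (s⁻¹ * t)⁻¹) * m := Subtype.ext this
      have := congrArg (fun z => s * z * s⁻¹) h2
      simpa [mul_assoc] using this
    have key : ∀ a ∈ A, a ^ p ^ k = 1 := by
      intro a ha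
      have hcomm := Subgroup.isMulCommutative_closure hc
      have : ∀ a b : Subgroup.closure (Group.conjugatesOfSet {m}), a * b = b * a := fun a b => hcomm.is_comm.comm a b
      refine Subgroup.closure_induction (p := fun a ha => a ^ p ^ k = 1) ?_ ?_ ?_ ?_ ha
      · intro a ha
        rw [Group.mem_conjugatesOfSet_iff] at ha
        obtain ⟨_, e1, ha⟩ := ha
        rw [Set.mem_singleton_iff.mp e1] at ha
        obtain ⟨s, rfl⟩ := isConj_iff.mp ha
        rw [conj_pow, hk']; simp
      · simp
      · intro a b ha hb h1 h2
        have : Commute a b := congrArg Subtype.val (this ⟨a, ha⟩ ⟨b, hb⟩)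
        rw [this.mul_pow, h1, h2, one_mul]
      · intro a _ h1; rw [inv_pow, h1, inv_one]
    intro a
    exact ⟨k, Subtype.ext (key a a.2)⟩
  have := hA.le_sylow_of_normal P
  exact this (Subgroup.normalClosure_normal.conj_mem m (Subgroup.subset_normalClosure (Set.mem_singleton m)) n)

lemma XI.solv [Finite G] {x : G} (h : SC x) {M : Subgroup G} (hM : XI x M) : Group.IsSolvable M :=
  have := hM.nilp h
  inferInstance

/-- all elements of order three -/
lemma SC.conj_of_cube [Finite G] {x : G} (h : SC x) {y : G} (hy : y ^ 3 = 1) (hy1 : y ≠ 1) :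
    ∃ g, y = g * x * g⁻¹ ∨ y = g * x⁻¹ * g⁻¹ := by
  have : Fact (Nat.Prime 3) := ⟨Nat.prime_three⟩
  have px : IsPGroup 3 (Subgroup.zpowers x) := by
    apply IsPGroup.of_card (n := 1); rw [Nat.card_zpowers, h.ord]; rfl
  have py : IsPGroup 3 (Subgroup.zpowers y) := by
    apply IsPGroup.of_card (n := 1); rw [Nat.card_zpowers, orderOf_eq_prime hy hy1]; rfl
  obtain ⟨S, hS⟩ := px.exists_le_sylow
  obtain ⟨T, hT⟩ := py.exists_le_sylow
  have xS : x ∈ S := hS (Subgroup.mem_zpowers x)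
  have yT : y ∈ T := hT (Subgroup.mem_zpowers y)
  have hSx : ∀ s ∈ S, s = 1 ∨ s = x ∨ s = x⁻¹ := by
    have : Nontrivial S := ⟨⟨x, xS⟩, 1, fun e => h.ne_one (congrArg Subtype.val e)⟩
    have := S.isPGroup'.center_nontrivial
    obtain ⟨⟨z, hz⟩, hz1⟩ := exists_ne (1 : Subgroup.center S)
    rw [Subgroup.mem_center_iff] at hz
    have hzx := h.cent z (congrArg Subtype.val (hz ⟨x, xS⟩)).symm
    intro s hs
    apply h.cent
    have hzs : s * z = z * s := congrArg Subtype.val (hz ⟨s, hs⟩)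
    rcases hzx with e | e | e
    · exact absurd (Subtype.ext (Subtype.ext e)) hz1
    · rw [e] at hzs; exact hzs
    · rw [e] at hzs
      have := congrArg (fun w => x * w * x) hzs
      simp only [mul_assoc, inv_mul_cancel, mul_one, mul_inv_cancel_left] at this
      exact this.symm
  obtain ⟨g, rfl⟩ := MulAction.exists_smul_eq G S T
  change y ∈ (g • S).toSubgroup at yT
  rw [Sylow.coe_subgroup_smul, Subgroup.mem_pointwise_smul_iff_inv_smul_mem] at yT
  refine ⟨g, ?_⟩
  rcases hSx _ yT with h | h | h
  · exfalso; apply hy1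
    have h' : g⁻¹ * y * g = 1 := by simpa using h
    have := congrArg (fun z => g * z * g⁻¹) h'
    simpa [mul_assoc] using this
  · left; rw [← h]; simp [mul_assoc]
  · right; rw [← h]; simp [mul_assoc]

lemma SC.sc_of_cube [Finite G] {x : G} (h : SC x) {y : G} (hy : y ^ 3 = 1) (hy1 : y ≠ 1) : SC y := by
  obtain ⟨g, rfl | rfl⟩ := h.conj_of_cube hy hy1
  · exact h.conj g
  · exact h.inv.conj g

lemma SC.mem_normal [Finite G] {x : G} (h : SC x) {N : Subgroup G} (hN : N.Normal) (hf : ¬ Fr N) : x ∈ N := by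
  simp only [Fr, not_forall] at hf
  obtain ⟨y, hy, h3, h1⟩ := hf
  obtain ⟨g, rfl | rfl⟩ := h.conj_of_cube h3 h1
  · have := hN.conj_mem _ hy g⁻¹; simpa [mul_assoc] using this
  · have := N.inv_mem (hN.conj_mem _ hy g⁻¹); simpa [mul_assoc] using this

lemma SC.not_nine [Finite G] {x : G} (h : SC x) : ¬ 9 ∣ Nat.card G := by
  have : Fact (Nat.Prime 3) := ⟨Nat.prime_three⟩
  intro h9
  obtain ⟨S, hS⟩ := Sylow.exists_subgroup_card_pow_prime 3 (n := 2) (by simpa using h9)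
  have pS : IsPGroup 3 S := IsPGroup.of_card hS
  have : Nontrivial S := by rw [← Finite.one_lt_card_iff_nontrivial, hS]; norm_num
  have := pS.center_nontrivial
  have h3 : 3 ∣ Nat.card (Subgroup.center S) := by
    rcases (pS.to_subgroup (Subgroup.center S)).card_eq_or_dvd with h | h
    · rw [← Finite.one_lt_card_iff_nontrivial] at this; omega
    · exact h
  obtain ⟨z, hz⟩ := exists_prime_orderOf_dvd_card' 3 h3
  have hz3 : ((z : S) : G) ^ 3 = 1 := by
    have : z ^ 3 = 1 := by rw [← hz]; exact pow_orderOf_eq_one z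
    exact congrArg (fun w : Subgroup.center S => ((w : S) : G)) this
  have hz1 : ((z : S) : G) ≠ 1 := by
    intro e
    have : z = 1 := Subtype.ext (Subtype.ext e)
    rw [this] at hz; simp at hz
  have hsc := h.sc_of_cube hz3 hz1
  have hle : S ≤ Subgroup.zpowers ((z : S) : G) := by
    intro s hs
    have := Subgroup.mem_center_iff.mp z.2 ⟨s, hs⟩
    rcases hsc.cent s (congrArg Subtype.val this) with h | h | h <;> rw [h]
    · exact one_mem _
    · exact Subgroup.mem_zpowers _
    · exact inv_mem (Subgroup.mem_zpowers _)
  have := Subgroup.card_le_of_le hle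
  rw [hS, Nat.card_zpowers, hsc.ord] at this
  omega

end
end FT

namespace FT
universe u
section
variable {G : Type u} [Group G]

/-- order exactly three -/
def T3 (y : G) : Prop := y ^ 3 = 1 ∧ y ≠ 1

lemma SC.t3 {x : G} (h : SC x) : T3 x := ⟨h.cube, h.ne_one⟩

lemma T3.conj {y : G} (h : T3 y) (g : G) : T3 (g * y * g⁻¹) := by
  refine ⟨by rw [conj_pow, h.1]; simp, fun e => h.2 ?_⟩
  have := congrArg (fun z => g⁻¹ * z * g) e
  simpa [mul_assoc] using this

lemma T3.inv {y : G} (h : T3 y) : T3 y⁻¹ := ⟨by rw [inv_pow, h.1, inv_one], by simpa using h.2⟩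

/-- the set `U` -/
def U (x : G) : Set G := {u | T3 (x * u) ∧ T3 (x⁻¹ * u)}

lemma XI.mem_U [Finite G] {x : G} (h : SC x) {M : Subgroup G} (hM : XI x M) {m : G} (hm : m ∈ M) : m ∈ U x := by
  have h1 := (hM.smul h (hM.inv m hm)).1.t3
  have h2 := ((hM.inv' h).smul h.inv ((hM.inv' h).inv m hm)).1.t3
  refine ⟨?_, ?_⟩
  · convert h1 using 1; group
  · convert h2 using 1; group

lemma cube_rel {x u : G} (hx : x * x = x⁻¹) (h : (x * u) ^ 3 = 1) :
    u * (x * u * x⁻¹) * (x⁻¹ * u * x) = 1 := by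
  have hi : x⁻¹ * x⁻¹ = x := by rw [← mul_inv_rev, hx, inv_inv]
  have : u * (x * u * x⁻¹) * (x⁻¹ * u * x) = u * (x * u) * (x⁻¹ * x⁻¹) * u * x := by group
  rw [this, hi]
  have h2 : u * (x * u) * x * u * x = x⁻¹ * (x * u) ^ 3 * x := by
    rw [pow_succ, pow_two]; group
  rw [h2, h]; group

lemma U_xi [Finite G] {x : G} (h : SC x) {u : G} (hu : u ∈ U x) :
    XI x (Subgroup.closure {u, x * u * x⁻¹, x⁻¹ * u * x}) := by
  set u1 := x * u * x⁻¹ with hu1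
  set u2 := x⁻¹ * u * x with hu2
  have r1 : u * u1 * u2 = 1 := cube_rel h.sq hu.1.1
  have r2 : u * u2 * u1 = 1 := by
    have := cube_rel h.inv.sq hu.2.1
    rwa [inv_inv] at this
  have c12 : u1 * u2 = u2 * u1 := by
    rw [mul_assoc] at r1 r2
    exact mul_left_cancel (r1.trans r2.symm)
  have e1 : x * u1 * x⁻¹ = u2 := by
    have : x * u1 * x⁻¹ = (x * x) * u * (x⁻¹ * x⁻¹) := by rw [hu1]; group
    rw [this, h.sq, h.isq]
  have e2 : x * u2 * x⁻¹ = u := by rw [hu2]; group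
  have c20 : u2 * u = u * u2 := by
    have := congrArg (fun z => x * z * x⁻¹) c12
    have t1 : x * (u1 * u2) * x⁻¹ = (x * u1 * x⁻¹) * (x * u2 * x⁻¹) := by group
    have t2 : x * (u2 * u1) * x⁻¹ = (x * u2 * x⁻¹) * (x * u1 * x⁻¹) := by group
    simp only [t1, t2, e1, e2] at this; exact this
  have c01 : u * u1 = u1 * u := by
    have := congrArg (fun z => x * z * x⁻¹) c20
    have t1 : x * (u2 * u) * x⁻¹ = (x * u2 * x⁻¹) * (x * u * x⁻¹) := by group
    have t2 : x * (u * u2) * x⁻¹ = (x * u * x⁻¹) * (x * u2 * x⁻¹) := by group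
    simp only [t1, t2, e2] at this; exact this
  set A := Subgroup.closure {u, u1, u2} with hA
  have mu : u ∈ A := Subgroup.subset_closure (by simp)
  have mu1 : u1 ∈ A := Subgroup.subset_closure (by simp)
  have mu2 : u2 ∈ A := Subgroup.subset_closure (by simp)
  have hcomm : IsMulCommutative A := by
    apply Subgroup.isMulCommutative_closure
    rintro a (rfl | rfl | rfl) b (rfl | rfl | rfl) <;> first | rfl | assumption | (symm; assumption)
  have hab : ∀ a ∈ A, ∀ b ∈ A, a * b = b * a := fun a ha b hb =>
    congrArg Subtype.val (hcomm.is_comm.comm (⟨a, ha⟩ : A) ⟨b, hb⟩)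
  refine ⟨?_, ?_⟩
  · intro m hm
    have : A ≤ A.comap (MulAut.conj x).toMonoidHom := by
      conv_lhs => rw [hA]
      rw [Subgroup.closure_le]
      rintro a (rfl | rfl | rfl)
      · exact mu1
      · show x * u1 * x⁻¹ ∈ A
        rw [e1]; exact mu2
      · show x * u2 * x⁻¹ ∈ A
        rw [e2]; exact mu
    exact this hm
  · intro y hy h3
    by_contra hy1
    have hsc := h.sc_of_cube h3 hy1
    have hu3 := hsc.cent_cube (hab u mu y hy)
    by_cases hu0 : u = 1
    · have t1 : u1 = 1 := by rw [hu1, hu0]; simp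
      have t2 : u2 = 1 := by rw [hu2, hu0]; simp
      have : A = ⊥ := by
        rw [hA, t1, t2, hu0]; simp
      rw [this] at hy; exact hy1 (Subgroup.mem_bot.mp hy)
    · have hus := h.sc_of_cube hu3 hu0
      rcases hus.cent u1 c01.symm with e | e | e
      · apply hu0
        have := congrArg (fun z => x⁻¹ * z * x) e
        simpa [hu1, mul_assoc] using this
      · have : u * x = x * u := by
          rw [hu1] at e
          rw [mul_inv_eq_iff_eq_mul] at e; exact e.symm
        rcases h.cent u this with e | e | e
        · exact hu0 e
        · exact hu.2.2 (by rw [e]; simp)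
        · exact hu.1.2 (by rw [e]; simp)
      · have e3 : u2 = u := by
          have t : x * u⁻¹ * x⁻¹ = u1⁻¹ := by rw [hu1]; group
          rw [← e1, e, t, e, inv_inv]
        rw [e, e3] at r1; apply hu0; simpa using r1

/-- conjugation-stability of a subgroup under a subgroup -/
def Stab (L O : Subgroup G) : Prop := ∀ l ∈ L, ∀ o ∈ O, l * o * l⁻¹ ∈ O

lemma mem_sup_stab {L O Y : Subgroup G} (hO : Stab L O) (hY : Y ≤ L) {z : G} (hz : z ∈ Y ⊔ O) :
    ∃ y ∈ Y, ∃ o ∈ O, z = y * o := by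
  have : Y ⊔ O ≤ { carrier := {z | ∃ y ∈ Y, ∃ o ∈ O, z = y * o}
                   mul_mem' := by
                    rintro _ _ ⟨y, hy, o, ho, rfl⟩ ⟨y', hy', o', ho', rfl⟩
                    refine ⟨y * y', Y.mul_mem hy hy', (y'⁻¹ * o * y'⁻¹⁻¹) * o', O.mul_mem (hO _ (hY (Y.inv_mem hy')) _ ho) ho', by group⟩
                   one_mem' := ⟨1, Y.one_mem, 1, O.one_mem, by simp⟩
                   inv_mem' := by
                    rintro _ ⟨y, hy, o, ho, rfl⟩
                    refine ⟨y⁻¹, Y.inv_mem hy, y * o⁻¹ * y⁻¹, hO _ (hY hy) _ (O.inv_mem ho), by group⟩ : Subgroup G } := by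
    rw [sup_le_iff]
    exact ⟨fun y hy => ⟨y, hy, 1, O.one_mem, by simp⟩, fun o ho => ⟨1, Y.one_mem, o, ho, by simp⟩⟩
  exact this hz

lemma fr_sup [Finite G] {L O Y : Subgroup G} (hO : Stab L O) (hY : Y ≤ L) (fO : Fr O) (fY : Fr Y) : Fr (Y ⊔ O) := by
  intro z hz h3
  obtain ⟨y, hy, o, ho, rfl⟩ := mem_sup_stab hO hY hz
  have hyL := hY hy
  have : y ^ 3 ∈ O := by
    have e : y ^ 3 = ((y * o * y⁻¹) * ((y * y) * o * (y * y)⁻¹) * ((y * y * y) * o * (y * y * y)⁻¹))⁻¹ * (y * o) ^ 3 := by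
      simp only [pow_succ, pow_zero, one_mul]; simp [mul_assoc]
    rw [e, h3, mul_one]
    exact O.inv_mem (O.mul_mem (O.mul_mem (hO _ hyL _ ho) (hO _ (L.mul_mem hyL hyL) _ ho)) (hO _ (L.mul_mem (L.mul_mem hyL hyL) hyL) _ ho))
  have hyO := fY.mem_of_cube hy this
  exact fO _ (O.mul_mem hyO ho) h3

lemma xi_sup [Finite G] {x : G} {L O Y : Subgroup G} (hxL : x ∈ L) (hO : Stab L O) (hY : Y ≤ L) (fO : Fr O) (fY : XI x Y) :
    XI x (Y ⊔ O) := by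
  refine ⟨fun z hz => ?_, fr_sup hO hY fO fY.fr⟩
  obtain ⟨y, hy, o, ho, rfl⟩ := mem_sup_stab hO hY hz
  have : x * (y * o) * x⁻¹ = (x * y * x⁻¹) * (x * o * x⁻¹) := by group
  rw [this]
  exact Subgroup.mul_mem_sup (fY.inv y hy) (hO x hxL o ho)

/-- the largest stable three-free subgroup of L -/
structure IsO (L O : Subgroup G) : Prop where
  le : O ≤ L
  stab : Stab L O
  fr : Fr O
  max : ∀ N, N ≤ L → Stab L N → Fr N → N ≤ O

lemma exists_O [Finite G] (L : Subgroup G) : ∃ O, IsO L O := by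
  obtain ⟨O, hO⟩ := Set.Finite.exists_maximal (Set.toFinite {N : Subgroup G | N ≤ L ∧ Stab L N ∧ Fr N})
    ⟨⊥, bot_le, by intro l _ o ho; rw [Subgroup.mem_bot] at *; simp [ho], by intro m hm _; exact hm⟩
  refine ⟨O, hO.prop.1, hO.prop.2.1, hO.prop.2.2, fun N hN sN fN => ?_⟩
  have h1 : N ⊔ O ≤ L ∧ Stab L (N ⊔ O) ∧ Fr (N ⊔ O) := by
    refine ⟨sup_le hN hO.prop.1, ?_, fr_sup hO.prop.2.1 hN hO.prop.2.2 fN⟩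
    intro l hl z hz
    obtain ⟨y, hy, o, ho, rfl⟩ := mem_sup_stab hO.prop.2.1 hN hz
    have : l * (y * o) * l⁻¹ = (l * y * l⁻¹) * (l * o * l⁻¹) := by group
    rw [this]
    exact Subgroup.mul_mem_sup (sN l hl y hy) (hO.prop.2.1 l hl o ho)
  exact le_sup_left.trans (hO.le_of_ge h1 le_sup_right)

/-- centralizer lemma -/
lemma IsO.cent [Finite G] {x : G} (h : SC x) {L O : Subgroup G} (hO : IsO L O) {R : Set G} (hRL : R ⊆ O)
    (hR : ∀ l ∈ L, ∀ r ∈ R, l * r * l⁻¹ ∈ R) {r : G} (hr : r ∈ R) (hr1 : r ≠ 1) {y : G} (hy : y ∈ L)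
    (hc : ∀ r ∈ R, y * r = r * y) : y ∈ O := by
  let C : Subgroup G := L ⊓ Subgroup.centralizer R
  have mem : ∀ z, z ∈ C ↔ z ∈ L ∧ ∀ r ∈ R, z * r = r * z := by
    intro z
    rw [Subgroup.mem_inf, Subgroup.mem_centralizer_iff]
    constructor
    · rintro ⟨a, b⟩; exact ⟨a, fun r hr => (b r hr).symm⟩
    · rintro ⟨a, b⟩; exact ⟨a, fun r hr => (b r hr).symm⟩
  have hs : Stab L C := by
    intro l hl z hz
    rw [mem] at *
    refine ⟨L.mul_mem (L.mul_mem hl hz.1) (L.inv_mem hl), fun r hr => ?_⟩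
    have := hz.2 _ (hR _ (L.inv_mem hl) r hr)
    have := congrArg (fun z => l * z * l⁻¹) this
    simpa [mul_assoc] using this
  refine hO.max C inf_le_left hs ?_ ((mem y).mpr ⟨hy, hc⟩)
  intro z hz h3
  by_contra hz1
  have hsc := h.sc_of_cube h3 hz1
  have := hsc.cent_cube (((mem z).mp hz).2 r hr).symm
  exact hr1 (hO.fr r (hRL hr) this)

end
end FT

namespace FT
universe u
section
variable {G : Type u} [Group G]

/-- trivial soluble radical -/
def TR (Q : Type u) [Group Q] : Prop := ∀ N : Subgroup Q, N.Normal → Group.IsSolvable N → N = ⊥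

lemma exists_abelian [Finite G] : ∀ (n : ℕ) (N : Subgroup G), Nat.card N ≤ n → N.Normal → Group.IsSolvable N → N ≠ ⊥ →
    ∃ A : Subgroup G, A.Normal ∧ A ≠ ⊥ ∧ ∀ a ∈ A, ∀ b ∈ A, a * b = b * a := by
  intro n
  induction n with
  | zero => intro N hN; have := Nat.card_pos (α := N); omega
  | succ n ih =>
    intro N hn hN hs h1
    by_cases hc : ⁅N, N⁆ = ⊥
    · refine ⟨N, hN, h1, fun a ha b hb => ?_⟩
      rw [Subgroup.commutator_eq_bot_iff_le_centralizer] at hc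
      exact (Subgroup.mem_centralizer_iff.mp (hc ha) b hb).symm
    · have hlt : ⁅N, N⁆ < N := by
        have : Nontrivial N := (Subgroup.nontrivial_iff_ne_bot N).mpr h1
        have h2 := Group.IsSolvable.commutator_lt_top_of_nontrivial N
        have h3 : (commutator N).map N.subtype = ⁅N, N⁆ := by
          rw [commutator_def, Subgroup.map_commutator, ← MonoidHom.range_eq_map, N.range_subtype]
        rw [← h3]
        have h4 := (Subgroup.map_subtype_lt_map_subtype).mpr h2
        rwa [← MonoidHom.range_eq_map, N.range_subtype] at h4
      refine ih ⁅N, N⁆ ?_ (Subgroup.commutator_normal N N) ?_ hc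
      · have h5 : Nat.card ↥⁅N, N⁆ < Nat.card N := by
          apply Set.ncard_lt_ncard (s := ((⁅N, N⁆ : Subgroup G) : Set G)) (t := (N : Set G)) hlt
        omega
      · exact Group.isSolvable_of_isSolvable_injective (Subgroup.inclusion_injective hlt.le)

lemma tri [Finite G] {x : G} (h : SC x) {L O : Subgroup G} (hO : IsO L O) (hx : x ∈ L) :
    (∀ y ∈ L, ∃ o ∈ O, y * x * y⁻¹ = o * x ∨ y * x * y⁻¹ = o * x⁻¹) ∨
    ∃ (Q : Type u) (_ : Group Q) (_ : Finite Q) (φ : L →* Q), Function.Surjective φ ∧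
      (∀ l : L, φ l = 1 ↔ (l : G) ∈ O) ∧ SC (φ ⟨x, hx⟩) ∧ TR Q := by
  have nO : (O.subgroupOf L).Normal := ⟨fun n hn g => hO.stab g g.2 n hn⟩
  let φ := QuotientGroup.mk' (O.subgroupOf L)
  have sφ : Function.Surjective φ := QuotientGroup.mk'_surjective _
  have kφ : ∀ l : L, φ l = 1 ↔ (l : G) ∈ O := fun l => by
    rw [← MonoidHom.mem_ker, QuotientGroup.ker_mk']; rfl
  have xiO : XI x O := ⟨fun m hm => hO.stab x hx m hm, hO.fr⟩
  have hsc : SC (φ ⟨x, hx⟩) := by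
    refine ⟨orderOf_eq_prime (p := 3) (hp := ⟨Nat.prime_three⟩) ?_ ?_, ?_⟩
    · rw [← map_pow]
      have : (⟨x, hx⟩ : L) ^ 3 = 1 := Subtype.ext h.cube
      rw [this, map_one]
    · rw [Ne, kφ]; exact hO.fr.not_mem h
    · intro y' hy'
      obtain ⟨y, rfl⟩ := sφ y'
      have : φ (y * ⟨x, hx⟩ * y⁻¹ * ⟨x, hx⟩⁻¹) = 1 := by
        simp only [map_mul, map_inv, hy']; group
      rw [kφ] at this
      obtain ⟨w, hw, e⟩ := lemF h xiO this
      have e' : (y : G) * x * (y : G)⁻¹ = w * x * w⁻¹ := by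
        rw [← e]; simp
      have c : (w⁻¹ * y) * x = x * (w⁻¹ * y) := by
        have := congrArg (fun z => w⁻¹ * z * y) e'
        simpa [mul_assoc] using this
      have hwL := hO.le hw
      have hw1 : φ ⟨w, hwL⟩ = 1 := (kφ _).mpr hw
      have e3 : φ y = φ (⟨w, hwL⟩⁻¹ * y) := by rw [map_mul, map_inv, hw1]; simp
      rw [e3]
      rcases h.cent _ c with c | c | c
      · left
        have : (⟨w, hwL⟩⁻¹ * y : L) = 1 := Subtype.ext c
        rw [this, map_one]
      · right; left
        have : (⟨w, hwL⟩⁻¹ * y : L) = ⟨x, hx⟩ := Subtype.ext c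
        rw [this]
      · right; right
        have : (⟨w, hwL⟩⁻¹ * y : L) = ⟨x, hx⟩⁻¹ := Subtype.ext c
        rw [this, map_inv]
  by_cases hT : TR (L ⧸ O.subgroupOf L)
  · right; exact ⟨_, _, inferInstance, φ, sφ, kφ, hsc, hT⟩
  · left
    simp only [TR, not_forall] at hT
    obtain ⟨N, nN, sN, hN⟩ := hT
    obtain ⟨A, nA, A1, cA⟩ := exists_abelian _ N le_rfl nN sN hN
    have hnf : ¬ Fr A := by
      intro fA
      apply A1
      have : (A.comap φ).map L.subtype ≤ O := by
        apply hO.max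
        · rintro _ ⟨l, _, rfl⟩; exact l.2
        · rintro l hl _ ⟨z, hz, rfl⟩
          refine ⟨⟨l, hl⟩ * z * ⟨l, hl⟩⁻¹, ?_, rfl⟩
          show φ _ ∈ A
          rw [map_mul, map_mul, map_inv]
          exact nA.conj_mem _ hz _
        · rintro _ ⟨z, hz, rfl⟩ h3
          have hz3 : z ^ 3 = 1 := Subtype.ext h3
          have := fA (φ z) hz (by rw [← map_pow, hz3, map_one])
          rw [kφ] at this
          exact hO.fr _ this h3
      rw [eq_bot_iff]
      intro a ha
      obtain ⟨z, rfl⟩ := sφ a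
      exact (kφ z).mpr (this ⟨z, ha, rfl⟩)
    have xA := hsc.mem_normal nA hnf
    intro y hy
    have := nA.conj_mem _ xA (φ ⟨y, hy⟩)
    rcases hsc.cent _ (cA _ this _ xA) with e | e | e
    · exfalso
      apply hsc.ne_one
      have := congrArg (fun z => (φ ⟨y, hy⟩)⁻¹ * z * φ ⟨y, hy⟩) e
      simpa [mul_assoc] using this
    · have : φ (⟨y, hy⟩ * ⟨x, hx⟩ * ⟨y, hy⟩⁻¹ * ⟨x, hx⟩⁻¹) = 1 := by
        simp only [map_mul, map_inv, e]; simp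
      rw [kφ] at this
      refine ⟨_, this, Or.inl ?_⟩; simp
    · have : φ (⟨y, hy⟩ * ⟨x, hx⟩ * ⟨y, hy⟩⁻¹ * ⟨x, hx⟩) = 1 := by
        simp only [map_mul, map_inv, e]; simp
      rw [kφ] at this
      refine ⟨_, this, Or.inr ?_⟩; simp

/-- property (A) -/
def PA (x : G) (L O : Subgroup G) : Prop := ∀ y ∈ L, ∃ o ∈ O, y * x * y⁻¹ = o * x ∨ y * x * y⁻¹ = o * x⁻¹

lemma PA.elim [Finite G] {x : G} (h : SC x) {L O : Subgroup G} (hO : IsO L O) (hx : x ∈ L) (hA : PA x L O) {y : G} (hy : y ∈ L) :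
    ∃ w ∈ O, (w⁻¹ * y = 1 ∨ w⁻¹ * y = x ∨ w⁻¹ * y = x⁻¹) ∨ (w⁻¹ * y) * x * (w⁻¹ * y)⁻¹ = x⁻¹ := by
  have xiO : XI x O := ⟨fun m hm => hO.stab x hx m hm, hO.fr⟩
  obtain ⟨o, ho, e | e⟩ := hA y hy
  · obtain ⟨w, hw, e2⟩ := lemF h xiO ho
    refine ⟨w, hw, Or.inl (h.cent _ ?_)⟩
    rw [e2] at e
    have := congrArg (fun z => w⁻¹ * z * y) e
    simpa [mul_assoc] using this
  · obtain ⟨w, hw, e2⟩ := lemF h.inv (xiO.inv' h) ho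
    refine ⟨w, hw, Or.inr ?_⟩
    rw [e2] at e
    have := congrArg (fun z => w⁻¹ * z * w) e
    simpa [mul_assoc] using this

lemma PA.xi_le [Finite G] {x : G} (h : SC x) {L O : Subgroup G} (hO : IsO L O) (hx : x ∈ L) (hA : PA x L O) {Y : Subgroup G}
    (hY : Y ≤ L) (xY : XI x Y) : Y ≤ O := by
  have xiO : XI x O := ⟨fun m hm => hO.stab x hx m hm, hO.fr⟩
  have key := xi_sup hx hO.stab hY hO.fr xY
  intro y hy
  have hyS : y ∈ Y ⊔ O := Subgroup.mem_sup_left hy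
  obtain ⟨w, hw, e | e⟩ := hA.elim h hO hx (hY hy)
  · have hwS : w⁻¹ * y ∈ Y ⊔ O := Subgroup.mul_mem _ (Subgroup.inv_mem _ (Subgroup.mem_sup_right hw)) hyS
    rcases e with e | e | e
    · rw [inv_mul_eq_one] at e; rwa [← e]
    · rw [e] at hwS; exact absurd hwS (key.fr.not_mem h)
    · rw [e] at hwS; exact absurd hwS (key.fr.not_mem h.inv)
  · have hwS : w⁻¹ * y ∈ Y ⊔ O := Subgroup.mul_mem _ (Subgroup.inv_mem _ (Subgroup.mem_sup_right hw)) hyS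
    have e2 : (w⁻¹ * y) * (x * (w⁻¹ * y)⁻¹ * x⁻¹) = x := by
      have : (w⁻¹ * y) * (x * (w⁻¹ * y)⁻¹ * x⁻¹) = (w⁻¹ * y) * x * (w⁻¹ * y)⁻¹ * x⁻¹ := by group
      rw [this, e, h.isq]
    have : x ∈ Y ⊔ O := by
      rw [← e2]; exact Subgroup.mul_mem _ hwS (key.inv _ (Subgroup.inv_mem _ hwS))
    exact absurd this (key.fr.not_mem h)

end
end FT

namespace FT
universe u
open Matrix

lemma trace_pi_matrix {n : ℕ} (d : Fin n → ℕ) (A B : ∀ i, Matrix (Fin (d i)) (Fin (d i)) ℂ)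
    (T : (∀ i, Matrix (Fin (d i)) (Fin (d i)) ℂ) →ₗ[ℂ] (∀ i, Matrix (Fin (d i)) (Fin (d i)) ℂ))
    (hT : ∀ X i, T X i = A i * X i * B i) :
    LinearMap.trace ℂ _ T = ∑ i, (A i).trace * (B i).trace := by
  classical
  let b := Pi.basis (fun i => Matrix.stdBasis ℂ (Fin (d i)) (Fin (d i)))
  rw [LinearMap.trace_eq_matrix_trace ℂ b, Matrix.trace, Fintype.sum_sigma]
  refine Finset.sum_congr rfl fun i _ => ?_
  rw [Fintype.sum_prod_type, Matrix.trace, Matrix.trace, Finset.sum_mul_sum]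
  refine Finset.sum_congr rfl fun j _ => Finset.sum_congr rfl fun k _ => ?_
  rw [Matrix.diag_apply, LinearMap.toMatrix_apply, Pi.basis_repr, Pi.basis_apply, hT, Pi.single_eq_same,
    Matrix.stdBasis_eq_single]
  have : ((Matrix.stdBasis ℂ (Fin (d i)) (Fin (d i))).repr (A i * Matrix.single j k 1 * B i)) (j, k) = ((A i * Matrix.single j k 1 * B i : Matrix (Fin (d i)) (Fin (d i)) ℂ) j k) := by
    simp [Matrix.stdBasis]
  rw [this]
  simp [Matrix.mul_apply, Matrix.single_apply, Finset.sum_ite_eq, ite_and]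

lemma trace_grp {G : Type u} [Group G] [Fintype G] [DecidableEq G] (p h : G)
    (T : MonoidAlgebra ℂ G →ₗ[ℂ] MonoidAlgebra ℂ G)
    (hT : ∀ u : G, T (MonoidAlgebra.single u 1) = MonoidAlgebra.single (p * u * h) 1) :
    LinearMap.trace ℂ _ T = ((Finset.univ.filter (fun u : G => p * u * h = u)).card : ℂ) := by
  classical
  let b := MonoidAlgebra.basis G ℂ
  rw [LinearMap.trace_eq_matrix_trace ℂ b, Matrix.trace, Finset.card_filter]
  push_cast
  refine Finset.sum_congr rfl fun u _ => ?_
  rw [Matrix.diag_apply, LinearMap.toMatrix_apply]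
  have : b u = MonoidAlgebra.single u 1 := by simp [b]
  rw [this, hT]
  simp [b, MonoidAlgebra.basis, Finsupp.single_apply]

lemma trace_idem {n : ℕ} (E : Matrix (Fin n) (Fin n) ℂ) (hE : E * E = E) : ∃ k : ℕ, E.trace = k ∧ k ≤ n := by
  have h1 : IsIdempotentElem (Matrix.toLin' E) := by
    rw [IsIdempotentElem, Module.End.mul_eq_comp, ← Matrix.toLin'_mul, hE]
  have h2 := (LinearMap.isProj_range_iff_isIdempotentElem _).mpr h1
  have := h2.trace
  rw [Matrix.trace_toLin'_eq] at this
  refine ⟨_, this, ?_⟩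
  simpa using Submodule.finrank_le (LinearMap.range (Matrix.toLin' E))
end FT

namespace FT
universe u
open Matrix

/-- complete list of irreducible matrix representations -/
structure CT (G : Type u) [Group G] [Fintype G] [DecidableEq G] where
  n : ℕ
  d : Fin n → ℕ
  pos : ∀ i, d i ≠ 0
  ρ : ∀ i, G →* Matrix (Fin (d i)) (Fin (d i)) ℂ
  span : ∀ i X, ∃ f : G → ℂ, X = ∑ h, f h • ρ i h
  orth : ∀ p h : G, ∑ i, (ρ i p).trace * (ρ i h).trace = ((Finset.univ.filter (fun u : G => p * u * h = u)).card : ℂ)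

lemma exists_CT (G : Type u) [Group G] [Fintype G] [DecidableEq G] : Nonempty (CT G) := by
  classical
  have : NeZero (Nat.card G : ℂ) := ⟨by exact_mod_cast Nat.card_pos.ne'⟩
  obtain ⟨n, d, hd, ⟨e⟩⟩ := IsSemisimpleRing.exists_algEquiv_pi_matrix_of_isAlgClosed ℂ (MonoidAlgebra ℂ G)
  let ρ : ∀ i, G →* Matrix (Fin (d i)) (Fin (d i)) ℂ := fun i =>
    { toFun := fun g => e (MonoidAlgebra.single g 1) i
      map_one' := by
        have : (MonoidAlgebra.single (1:G) (1:ℂ)) = 1 := rfl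
        rw [this, map_one]; rfl
      map_mul' := fun g h => by
        have : (MonoidAlgebra.single (g*h) (1:ℂ)) = MonoidAlgebra.single g 1 * MonoidAlgebra.single h 1 := by simp [MonoidAlgebra.single_mul_single]
        rw [this, map_mul]; rfl }
  have hρ : ∀ i g, ρ i g = e (MonoidAlgebra.single g 1) i := fun i g => rfl
  refine ⟨⟨n, d, fun i => (hd i).out, ρ, ?_, ?_⟩⟩
  · intro i X
    obtain ⟨a, ha⟩ := e.surjective (Pi.single i X)
    refine ⟨fun h => a.coeff h, ?_⟩
    have h1 : a = ∑ h, a.coeff h • MonoidAlgebra.single h (1:ℂ) := by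
      ext g
      simp
    have h2 := congrArg (fun z => z i) ha
    simp only [Pi.single_eq_same] at h2
    rw [← h2]
    conv_lhs => rw [h1]
    rw [map_sum, Finset.sum_apply]
    refine Finset.sum_congr rfl fun h _ => ?_
    rw [map_smul, Pi.smul_apply, hρ]
  · intro p h
    let T : MonoidAlgebra ℂ G →ₗ[ℂ] MonoidAlgebra ℂ G :=
      (LinearMap.mulLeft ℂ (MonoidAlgebra.single p 1)) ∘ₗ (LinearMap.mulRight ℂ (MonoidAlgebra.single h 1))
    have h1 := trace_grp p h T (fun u => by simp [T, MonoidAlgebra.single_mul_single, mul_assoc])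
    have h2 := trace_pi_matrix d (fun i => ρ i p) (fun i => ρ i h) (e.toLinearEquiv.conj T) (fun X i => by
      simp [T, hρ, LinearEquiv.conj_apply, mul_assoc])
    rw [← h1, ← h2, LinearMap.trace_conj']
end FT

namespace FT
universe u
open Matrix

namespace CT
variable {G : Type u} [Group G] [Fintype G] [DecidableEq G] (R : CT G)

/-- characters -/
noncomputable def χ (i : Fin R.n) (g : G) : ℂ := (R.ρ i g).trace

lemma χ_one (i) : R.χ i 1 = R.d i := by simp [χ]

lemma χ_comm (i) (g h : G) : R.χ i (g * h) = R.χ i (h * g) := by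
  simp only [χ, map_mul]; rw [Matrix.trace_mul_comm]

lemma χ_conj (i) (g h : G) : R.χ i (g * h * g⁻¹) = R.χ i h := by
  rw [χ_comm]; simp

lemma dpos (i) : (R.d i : ℂ) ≠ 0 := by exact_mod_cast R.pos i

lemma scalar_of_comm (i) (M : Matrix (Fin (R.d i)) (Fin (R.d i)) ℂ) (hM : ∀ h, R.ρ i h * M = M * R.ρ i h) :
    M = (M.trace / R.d i) • (1 : Matrix _ _ ℂ) := by
  have h1 : ∀ X, X * M = M * X := by
    intro X
    obtain ⟨f, rfl⟩ := R.span i X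
    rw [Finset.sum_mul, Finset.mul_sum]
    refine Finset.sum_congr rfl fun h _ => ?_
    rw [smul_mul_assoc, mul_smul_comm, hM]
  obtain ⟨c, hc⟩ := Matrix.mem_range_scalar_of_commute_single (M := M) (fun j k _ => h1 _)
  have h2 : M = c • (1 : Matrix _ _ ℂ) := by
    rw [← hc]; ext a b; simp [Matrix.diagonal_apply, Matrix.one_apply]
  have h3 : M.trace = c * R.d i := by rw [h2]; simp
  rw [h3, mul_div_assoc, div_self (R.dpos i), mul_one]; exact h2

lemma scal (i) (c : G) : ∑ v : G, R.ρ i (v * c * v⁻¹) = ((Fintype.card G : ℂ) * R.χ i c / R.d i) • (1 : Matrix _ _ ℂ) := by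
  have h1 := R.scalar_of_comm i (∑ v : G, R.ρ i (v * c * v⁻¹)) (fun h => by
    rw [Finset.mul_sum, Finset.sum_mul]
    refine Fintype.sum_equiv (Equiv.mulLeft h) _ _ fun v => ?_
    rw [← map_mul, ← map_mul]; congr 1; simp [mul_assoc])
  have h2 : (∑ v : G, R.ρ i (v * c * v⁻¹)).trace = (Fintype.card G : ℂ) * R.χ i c := by
    rw [Matrix.trace_sum]
    have : ∀ v : G, (R.ρ i (v * c * v⁻¹)).trace = R.χ i c := fun v => R.χ_conj i v c
    simp_rw [this]; simp
  rw [h2] at h1; exact h1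

lemma scal' (i) (c y : G) : ∑ v : G, R.χ i (v * c * v⁻¹ * y) = (Fintype.card G : ℂ) * R.χ i c / R.d i * R.χ i y := by
  have h := congrArg (fun M => (M * R.ρ i y).trace) (R.scal i c)
  simp only [Finset.sum_mul, Matrix.trace_sum, ← map_mul, smul_mul_assoc, one_mul, Matrix.trace_smul] at h
  exact h

lemma reg (h : G) : ∑ i, (R.d i : ℂ) * R.χ i h = if h = 1 then (Fintype.card G : ℂ) else 0 := by
  have := R.orth 1 h
  simp only [map_one, Matrix.trace_one, Fintype.card_fin, one_mul, mul_eq_left] at this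
  rw [show ∑ i, (R.d i : ℂ) * R.χ i h = _ from this]
  split_ifs with e <;> simp [e]

lemma triple (c d y : G) :
    ((Finset.univ.filter (fun p : G × G => p.1 * c * p.1⁻¹ * (p.2 * d * p.2⁻¹) * y = 1)).card : ℂ)
      = (Fintype.card G : ℂ) * ∑ i, R.χ i c * R.χ i d * R.χ i y / R.d i := by
  have hg : (Fintype.card G : ℂ) ≠ 0 := by exact_mod_cast Fintype.card_ne_zero
  have h1 : ∑ p : G × G, ∑ i, (R.d i : ℂ) * R.χ i (p.1 * c * p.1⁻¹ * (p.2 * d * p.2⁻¹) * y) =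
     (Fintype.card G : ℂ) * ((Finset.univ.filter (fun p : G × G => p.1 * c * p.1⁻¹ * (p.2 * d * p.2⁻¹) * y = 1)).card : ℂ) := by
    simp_rw [R.reg]
    rw [← Finset.sum_filter]; simp [mul_comm]
  have h2 : ∑ p : G × G, ∑ i, (R.d i : ℂ) * R.χ i (p.1 * c * p.1⁻¹ * (p.2 * d * p.2⁻¹) * y) =
     (Fintype.card G : ℂ) * ((Fintype.card G : ℂ) * ∑ i, R.χ i c * R.χ i d * R.χ i y / R.d i) := by
    rw [Finset.sum_comm, Finset.mul_sum, Finset.mul_sum]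
    refine Finset.sum_congr rfl fun i _ => ?_
    rw [← Finset.mul_sum, Fintype.sum_prod_type_right]
    have : ∀ v : G, ∑ u : G, R.χ i (u * c * u⁻¹ * (v * d * v⁻¹) * y) = (Fintype.card G : ℂ) * R.χ i c / R.d i * R.χ i (v * d * v⁻¹ * y) := by
      intro v
      rw [← R.scal']
      simp [mul_assoc]
    simp_rw [this]
    rw [← Finset.mul_sum, R.scal']
    have := R.dpos i
    field_simp
  exact mul_left_cancel₀ hg (h1.symm.trans h2)

lemma triv : ∃ i, R.d i = 1 ∧ ∀ h, R.χ i h = 1 := by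
  have hg : (Fintype.card G : ℂ) ≠ 0 := by exact_mod_cast Fintype.card_ne_zero
  let E : ∀ i, Matrix (Fin (R.d i)) (Fin (R.d i)) ℂ := fun i => ∑ h : G, R.ρ i h
  have hl : ∀ i h, R.ρ i h * E i = E i := fun i h => by
    simp only [E, Finset.mul_sum, ← map_mul]
    exact Fintype.sum_equiv (Equiv.mulLeft h) _ _ fun v => rfl
  have hr : ∀ i h, E i * R.ρ i h = E i := fun i h => by
    simp only [E, Finset.sum_mul, ← map_mul]
    exact Fintype.sum_equiv (Equiv.mulRight h) _ _ fun v => rfl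
  have hs : ∑ i, (R.d i : ℂ) * (E i).trace = Fintype.card G := by
    simp only [E, Matrix.trace_sum, Finset.mul_sum]
    rw [Finset.sum_comm]
    have := R.reg
    simp only [χ] at this
    simp_rw [this]; simp
  have hne : ∃ i, (E i).trace ≠ 0 := by
    by_contra hc
    push Not at hc
    apply hg; rw [← hs]; simp [hc]
  obtain ⟨i, hi⟩ := hne
  have key : ∀ j, (E j).trace ≠ 0 → (∀ h, R.ρ j h = 1) ∧ (E j).trace = Fintype.card G * R.d j := by
    intro j hj
    have h1 := R.scalar_of_comm j (E j) (fun h => by rw [hl, hr])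
    have : ∀ h, R.ρ j h = 1 := by
      intro h
      have h2 := hl j h
      rw [h1, mul_smul_comm, mul_one] at h2
      exact smul_right_injective _ (div_ne_zero hj (R.dpos j)) h2
    refine ⟨this, ?_⟩
    simp only [E, this, Matrix.trace_sum, Matrix.trace_one, Fintype.card_fin]; simp
  have h1 := key i hi
  refine ⟨i, ?_, fun h => ?_⟩
  swap
  all_goals
    have hd : R.d i = 1 := by
      have h3 : ∑ j, (R.d j : ℂ) * (E j).trace = ((∑ j, if (E j).trace = 0 then 0 else Fintype.card G * (R.d j)^2 : ℕ) : ℂ) := by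
        push_cast
        refine Finset.sum_congr rfl fun j _ => ?_
        split_ifs with e
        · simp [e]
        · rw [(key j e).2]; ring
      rw [hs] at h3
      have h4 := Nat.cast_injective h3
      have h5 := Finset.single_le_sum (f := fun j => if (E j).trace = 0 then 0 else Fintype.card G * (R.d j)^2) (fun j _ => Nat.zero_le _) (Finset.mem_univ i)
      simp only [hi, if_false] at h5
      rw [← h4] at h5
      have h6 := R.pos i
      have h7 : 0 < Fintype.card G := Fintype.card_pos
      by_contra h8
      have : 2 ≤ R.d i := by omega
      have h9 : 4 ≤ R.d i ^ 2 := by nlinarith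
      nlinarith
  · rw [χ, h1.1 h]; simp [hd]
  · exact hd
end CT
end FT

namespace FT
universe u
open Matrix

lemma tr_inv2 {n : ℕ} (X : Matrix (Fin n) (Fin n) ℂ) (h : X * X = 1) : ∃ k : ℤ, X.trace = k := by
  obtain ⟨k, hk, -⟩ := trace_idem ((1/2 : ℂ) • (1 + X)) (by
    rw [smul_mul_smul_comm, mul_add, add_mul, add_mul, h, one_mul, mul_one, one_mul, add_comm X 1, ← two_smul ℂ (1 + X), smul_smul]
    norm_num)
  refine ⟨2 * k - n, ?_⟩
  simp only [Matrix.trace_smul, Matrix.trace_add, Matrix.trace_one, Fintype.card_fin, smul_eq_mul] at hk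
  push_cast; rw [← hk]; ring

lemma tr_inv3 {n : ℕ} (X : Matrix (Fin n) (Fin n) ℂ) (h : X * X * X = 1) (h2 : (X * X).trace = X.trace) : ∃ k : ℤ, X.trace = k := by
  obtain ⟨w, hw⟩ : ∃ w : ℂ, w ^ 2 + w + 1 = 0 := by
    obtain ⟨z, hz⟩ := IsAlgClosed.exists_pow_nat_eq (-3 : ℂ) (n := 2) (by norm_num)
    refine ⟨(z - 1) / 2, ?_⟩
    linear_combination hz / 4
  have hw3 : w ^ 3 = 1 := by linear_combination (w - 1) * hw
  have e4 : X * X * (X * X) = X := by rw [← mul_assoc, h, one_mul]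
  have e3 : X * (X * X) = 1 := by rw [← mul_assoc, h]
  obtain ⟨k, hk, -⟩ := trace_idem ((1/3 : ℂ) • (1 + w ^ 2 • X + w • (X * X))) (by
    rw [smul_mul_smul_comm]
    have : (1 + w ^ 2 • X + w • (X * X)) * (1 + w ^ 2 • X + w • (X * X)) = (3:ℂ) • (1 + w ^ 2 • X + w • (X * X)) := by
      simp only [mul_add, add_mul, one_mul, mul_one, smul_mul_assoc, mul_smul_comm, h, e4, e3, smul_add, smul_smul]
      match_scalars <;> first | ring1 | linear_combination 2 * hw3 | linear_combination w * hw3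
    rw [this, smul_smul]; norm_num)
  simp only [Matrix.trace_smul, Matrix.trace_add, Matrix.trace_one, Fintype.card_fin, smul_eq_mul, h2] at hk
  refine ⟨n - 3 * k, ?_⟩
  push_cast; rw [← hk]
  linear_combination X.trace * hw

lemma CT.integral {G : Type u} [Group G] [Fintype G] [DecidableEq G] (R : CT G) (i) (c : G) (k : ℤ)
    (hc : R.χ i c = k) : (R.d i : ℤ) ∣ Fintype.card G * k := by
  have h1 := R.scal i c
  let F : MonoidAlgebra ℤ G →ₐ[ℤ] Matrix (Fin (R.d i)) (Fin (R.d i)) ℂ := MonoidAlgebra.lift ℤ _ G (R.ρ i)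
  have h2 : IsIntegral ℤ (∑ v : G, MonoidAlgebra.single (v * c * v⁻¹) (1:ℤ)) := IsIntegral.of_finite ℤ _
  have h3 := h2.map F
  have h4 : F (∑ v : G, MonoidAlgebra.single (v * c * v⁻¹) (1:ℤ)) = ∑ v : G, R.ρ i (v * c * v⁻¹) := by
    rw [map_sum]; refine Finset.sum_congr rfl fun v _ => ?_
    simp [F]
  rw [h4, h1, ← Algebra.algebraMap_eq_smul_one] at h3
  have : Nonempty (Fin (R.d i)) := ⟨⟨0, Nat.pos_of_ne_zero (R.pos i)⟩⟩
  have h5 : IsIntegral ℤ ((Fintype.card G : ℂ) * R.χ i c / R.d i) := (isIntegral_algebraMap_iff (FaithfulSMul.algebraMap_injective ℂ (Matrix (Fin (R.d i)) (Fin (R.d i)) ℂ))).mp h3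
  have h6 : (Fintype.card G : ℂ) * R.χ i c / R.d i = algebraMap ℚ ℂ ((Fintype.card G : ℚ) * k / R.d i) := by
    rw [hc]; simp
  rw [h6] at h5
  have h7 := (isIntegral_algebraMap_iff (FaithfulSMul.algebraMap_injective ℚ ℂ)).mp h5
  obtain ⟨z, hz⟩ := IsIntegrallyClosed.isIntegral_iff.mp h7
  refine ⟨z, ?_⟩
  have hd : (R.d i : ℚ) ≠ 0 := by exact_mod_cast R.pos i
  have : (Fintype.card G : ℚ) * k = R.d i * z := by
    have hz' : (z:ℚ) = (Fintype.card G : ℚ) * k / R.d i := by simpa using hz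
    rw [hz']; field_simp
  exact_mod_cast this
end FT

namespace FT
universe u
open Matrix

lemma three_sq {n : ℕ} (f : Fin n → ℤ) (d : Fin n → ℕ) (hd : ∀ i, d i ≠ 0) (i0 : Fin n) (h0 : f i0 = 1) (hd0 : d i0 = 1)
    (hs : ∑ i, f i ^ 2 = 3) (hz : ∑ i, (d i : ℤ) * f i = 0) :
    ∃ i1 i2, f i1 = 1 ∧ f i2 = -1 ∧ ∀ F : Fin n → ℂ, ∑ i, (f i : ℂ) * F i = F i0 + F i1 - F i2 := by
  classical
  have hle : ∀ i, f i ^ 2 ≤ 3 := fun i => hs ▸ Finset.single_le_sum (f := fun i => f i ^ 2) (fun j _ => sq_nonneg _) (Finset.mem_univ i)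
  have hv : ∀ i, f i = 0 ∨ f i = 1 ∨ f i = -1 := by
    intro i
    have h1 : f i ≤ 1 := by nlinarith [hle i]
    have h2 : -1 ≤ f i := by nlinarith [hle i]
    omega
  let S := Finset.univ.filter (fun i => f i ≠ 0)
  have hS : S.card = 3 := by
    have : ∑ i, f i ^ 2 = (S.card : ℤ) := by
      rw [Finset.card_filter]; push_cast
      refine Finset.sum_congr rfl fun i _ => ?_
      rcases hv i with h | h | h <;> simp [h]
    rw [hs] at this; exact_mod_cast this.symm
  have hi0 : i0 ∈ S := by simp [S, h0]
  have h2 : (S.erase i0).card = 2 := by rw [Finset.card_erase_of_mem hi0, hS]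
  obtain ⟨i, j, hij, hE⟩ := Finset.card_eq_two.mp h2
  have hi : i ∈ S.erase i0 := by rw [hE]; simp
  have hj : j ∈ S.erase i0 := by rw [hE]; simp
  simp only [S, Finset.mem_erase, Finset.mem_filter, Finset.mem_univ, true_and] at hi hj
  have hSe : S = {i0, i, j} := by rw [← Finset.insert_erase hi0, hE]
  have hsum : ∀ (A : Type) [CommRing A] (F : Fin n → A), ∑ k, (f k : A) * F k = f i0 * F i0 + (f i * F i + f j * F j) := by
    intro A _ F
    have : ∑ k, (f k : A) * F k = ∑ k ∈ S, (f k : A) * F k := by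
      symm; apply Finset.sum_subset (Finset.subset_univ _)
      intro k _ hk
      simp only [S, Finset.mem_filter, Finset.mem_univ, true_and, not_not] at hk
      simp [hk]
    rw [this, hSe, Finset.sum_insert, Finset.sum_pair hij]
    simp [Ne.symm hi.1, Ne.symm hj.1]
  have h3 := hsum ℤ (fun k => (d k : ℤ))
  simp only [Int.cast_id] at h3
  simp_rw [mul_comm (f _) _] at h3
  rw [hz, h0] at h3
  have a0 := hd i0
  have a1 := hd i
  have a2 := hd j
  rcases hv i with e1 | e1 | e1
  · exact absurd e1 hi.2
  · rcases hv j with e2 | e2 | e2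
    · exact absurd e2 hj.2
    · rw [e1, e2] at h3; omega
    · refine ⟨i, j, e1, e2, fun F => ?_⟩
      rw [hsum, h0, e1, e2]; push_cast; ring
  · rcases hv j with e2 | e2 | e2
    · exact absurd e2 hj.2
    · refine ⟨j, i, e2, e1, fun F => ?_⟩
      rw [hsum, h0, e1, e2]; push_cast; ring
    · rw [e1, e2] at h3; omega

/-- number of solutions -/
noncomputable def N3 {G : Type u} [Group G] (c d x : G) : ℕ :=
  Nat.card {p : G × G // p.1 * c * p.1⁻¹ * (p.2 * d * p.2⁻¹) = x}

/-- character data -/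
structure CD {G : Type u} [Group G] (x : G) (a : ℕ) (χ : G → ℂ) : Prop where
  pos : 1 ≤ a
  one : χ 1 = a
  self : χ x = 1
  two : ∀ c, c * c = 1 → ∃ k : ℤ, χ c = k
  dvd : a * (a + 1) ∣ Nat.card G
  ncd : ∀ c d, ¬ T3 c → ¬ T3 d → (N3 c d x : ℂ) * (a * (a + 1)) = Nat.card G * ((a - χ c) * (a - χ d))
  nxd : ∀ d, ¬ T3 d → (N3 x d x : ℂ) * (a * (a + 1)) = Nat.card G * (a ^ 2 + 2 * a + (2 * a + 1) * χ d)
  nxx : N3 x x x * (a * (a + 1)) = Nat.card G * (a * (a + 1) + 1)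
  lin : a = 1 → ∀ g h, χ (g * h) = χ g * χ h

lemma exists_CD {G : Type u} [Group G] [Finite G] {x : G} (h : SC x) {t : G} (ht : t * x * t⁻¹ = x⁻¹) :
    ∃ a χ, CD x a χ := by
  classical
  have : Fintype G := Fintype.ofFinite G
  obtain ⟨R⟩ := exists_CT G
  have hinv : ∀ i, R.χ i x⁻¹ = R.χ i x := fun i => by rw [← ht]; exact R.χ_conj i t x
  have hZval : ∀ i, ∃ k : ℤ, R.χ i x = k := fun i => by
    refine tr_inv3 (R.ρ i x) ?_ ?_
    · rw [← map_mul, ← map_mul, h.xxx, map_one]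
    · rw [← map_mul, h.sq]; exact hinv i
  choose f hf using hZval
  obtain ⟨i0, d0, c0⟩ := R.triv
  have f0 : f i0 = 1 := by
    have := hf i0; rw [c0] at this; exact_mod_cast this.symm
  have hs : ∑ i, f i ^ 2 = 3 := by
    have h1 := R.orth x x
    have h2 : (Finset.univ.filter (fun u : G => x * u * x = u)) = {t, t * x, t * x⁻¹} := by
      ext u
      simp only [Finset.mem_filter, Finset.mem_univ, true_and, Finset.mem_insert, Finset.mem_singleton]
      have htx : t * x = x⁻¹ * t := by rw [← ht]; simp
      have hcomm : x * u * x = u ↔ (t⁻¹ * u) * x = x * (t⁻¹ * u) := by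
        have e1 : x * (t⁻¹ * u) = t⁻¹ * x⁻¹ * u := by
          have : x * t⁻¹ = t⁻¹ * x⁻¹ := by rw [← ht]; simp [mul_assoc]
          rw [← mul_assoc, this]
        rw [e1]
        constructor
        · intro hh
          have : u * x = x⁻¹ * u := by rw [eq_inv_mul_iff_mul_eq, ← mul_assoc]; exact hh
          rw [mul_assoc, this, mul_assoc]
        · intro hh
          have : u * x = x⁻¹ * u := by
            simpa [mul_assoc] using hh
          rw [mul_assoc, this]; simp
      rw [hcomm]
      constructor
      · intro hh
        rcases h.cent _ hh with e | e | e
        · left; rw [inv_mul_eq_one] at e; exact e.symm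
        · right; left; rw [← e]; simp
        · right; right; rw [← e]; simp
      · rintro (rfl | rfl | rfl) <;> simp
    rw [h2] at h1
    have h3 : ({t, t * x, t * x⁻¹} : Finset G).card = 3 := by
      rw [Finset.card_eq_three]
      refine ⟨_, _, _, ?_, ?_, ?_, rfl⟩
      · simp [h.ne_one]
      · simp [h.ne_one]
      · simpa using h.ne_inv
    rw [h3] at h1
    have h4 : ∑ i, R.χ i x * R.χ i x = ((∑ i, f i ^ 2 : ℤ) : ℂ) := by
      push_cast
      refine Finset.sum_congr rfl fun i _ => ?_
      rw [hf i]; ring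
    have h5 : ((∑ i, f i ^ 2 : ℤ) : ℂ) = ((3 : ℕ) : ℂ) := by rw [← h4]; exact h1
    exact_mod_cast h5
  have hz : ∑ i, (R.d i : ℤ) * f i = 0 := by
    have h1 := R.reg x
    rw [if_neg h.ne_one] at h1
    simp_rw [hf] at h1
    exact_mod_cast h1
  obtain ⟨i1, i2, f1, f2, hF⟩ := three_sq f R.d R.pos i0 f0 d0 hs hz
  have hdd : R.d i2 = R.d i1 + 1 := by
    have h1 := hF (fun i => (R.d i : ℂ))
    have h2 : ∑ i, (f i : ℂ) * (R.d i : ℂ) = 0 := by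
      have : ∑ i, f i * (R.d i : ℤ) = 0 := by rw [← hz]; exact Finset.sum_congr rfl fun i _ => mul_comm _ _
      exact_mod_cast this
    rw [h2, d0] at h1
    have h3 : (R.d i2 : ℂ) = ((R.d i1 + 1 : ℕ) : ℂ) := by push_cast; push_cast at h1; linear_combination h1
    exact_mod_cast h3
  have hrel : ∀ c, ¬ T3 c → R.χ i2 c = R.χ i1 c + 1 := by
    intro c hc
    have h1 := R.orth x c
    have h2 : (Finset.univ.filter (fun u : G => x * u * c = u)) = ∅ := by
      rw [Finset.filter_eq_empty_iff]
      intro u _ hu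
      apply hc
      have : c = u⁻¹ * x⁻¹ * u⁻¹⁻¹ := by
        rw [inv_inv]; calc c = u⁻¹ * x⁻¹ * (x * u * c) := by group
          _ = _ := by rw [hu]
      rw [this]; exact h.inv.t3.conj _
    rw [h2] at h1
    have h3 := hF (fun i => R.χ i c)
    have h4 : ∑ i, (f i : ℂ) * R.χ i c = 0 := by
      rw [Finset.card_empty, Nat.cast_zero] at h1
      rw [← h1]; exact Finset.sum_congr rfl fun i _ => by rw [← hf]; rfl
    rw [h4, c0] at h3
    linear_combination h3
  have hN : ∀ c d, (N3 c d x : ℂ) = Nat.card G * (1 + R.χ i1 c * R.χ i1 d / R.d i1 - R.χ i2 c * R.χ i2 d / R.d i2) := by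
    intro c d
    have h1 := R.triple c d x⁻¹
    have h2 : N3 c d x = (Finset.univ.filter (fun p : G × G => p.1 * c * p.1⁻¹ * (p.2 * d * p.2⁻¹) * x⁻¹ = 1)).card := by
      rw [N3, Nat.card_eq_fintype_card, Fintype.card_subtype]
      congr 1; ext p; simp only [Finset.mem_filter, Finset.mem_univ, true_and]
      rw [mul_inv_eq_one]
    rw [h2, h1, Nat.card_eq_fintype_card]
    congr 1
    have h3 := hF (fun i => R.χ i c * R.χ i d / R.d i)
    rw [c0, c0, d0] at h3
    simp only [Nat.cast_one, mul_one, div_one] at h3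
    rw [← h3]
    refine Finset.sum_congr rfl fun i _ => ?_
    rw [hinv, hf]; ring
  have p1 : (R.d i1 : ℂ) ≠ 0 := R.dpos i1
  have p2 : (R.d i1 + 1 : ℂ) ≠ 0 := by exact_mod_cast Nat.succ_ne_zero (R.d i1)
  have x1 : R.χ i1 x = 1 := by rw [hf, f1]; simp
  have x2 : R.χ i2 x = -1 := by rw [hf, f2]; simp
  refine ⟨R.d i1, R.χ i1, ⟨Nat.pos_of_ne_zero (R.pos i1), R.χ_one i1, x1, ?_, ?_, ?_, ?_, ?_, ?_⟩⟩
  · intro c hc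
    exact tr_inv2 _ (by rw [← map_mul, hc, map_one])
  · rw [Nat.card_eq_fintype_card]
    have b1 := R.integral i1 x 1 (by rw [x1]; simp)
    have b2 := R.integral i2 x (-1) (by rw [x2]; simp)
    rw [mul_one] at b1
    rw [mul_neg, mul_one, dvd_neg, hdd] at b2
    apply Nat.Coprime.mul_dvd_of_dvd_of_dvd
    · simp
    · exact_mod_cast b1
    · exact_mod_cast b2
  · intro c d hc hd
    rw [hN, hrel c hc, hrel d hd, hdd]; push_cast
    field_simp; ring
  · intro d hd
    rw [hN, hrel d hd, hdd, x1, x2]; push_cast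
    field_simp; ring
  · have : (N3 x x x : ℂ) * (R.d i1 * (R.d i1 + 1)) = Nat.card G * (R.d i1 * (R.d i1 + 1) + 1) := by
      rw [hN, hdd, x1, x2]; push_cast
      field_simp; ring
    exact_mod_cast this
  · intro e
    have key : ∀ n (e : n = 1) (A B : Matrix (Fin n) (Fin n) ℂ), (A * B).trace = A.trace * B.trace := by
      rintro n rfl A B
      simp [Matrix.trace, Matrix.mul_apply]
    intro g k
    simp only [CT.χ, map_mul]
    exact key _ e _ _

end FT

namespace FT
universe u
variable {G : Type u} [Group G]

lemma SC.sylow [Finite G] {x : G} (h : SC x) : ∃ S : Sylow 3 G, x ∈ S ∧ ∀ s ∈ S, s = 1 ∨ s = x ∨ s = x⁻¹ := by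
  have : Fact (Nat.Prime 3) := ⟨Nat.prime_three⟩
  have px : IsPGroup 3 (Subgroup.zpowers x) := by
    apply IsPGroup.of_card (n := 1); rw [Nat.card_zpowers, h.ord]; rfl
  obtain ⟨S, hS⟩ := px.exists_le_sylow
  have xS : x ∈ S := hS (Subgroup.mem_zpowers x)
  refine ⟨S, xS, ?_⟩
  have : Nontrivial S := ⟨⟨x, xS⟩, 1, fun e => h.ne_one (congrArg Subtype.val e)⟩
  have := S.isPGroup'.center_nontrivial
  obtain ⟨⟨z, hz⟩, hz1⟩ := exists_ne (1 : Subgroup.center S)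
  rw [Subgroup.mem_center_iff] at hz
  have hzx := h.cent z (congrArg Subtype.val (hz ⟨x, xS⟩)).symm
  intro s hs
  apply h.cent
  have hzs : s * z = z * s := congrArg Subtype.val (hz ⟨s, hs⟩)
  rcases hzx with e | e | e
  · exact absurd (Subtype.ext (Subtype.ext e)) hz1
  · rw [e] at hzs; exact hzs
  · rw [e] at hzs
    have := congrArg (fun w => x * w * x) hzs
    simp only [mul_assoc, inv_mul_cancel, mul_one, mul_inv_cancel_left] at this
    exact this.symm

lemma TR.fr [Finite G] (hT : TR G) {x : G} (h : SC x) {N : Subgroup G} (hN : N.Normal) (hf : Fr N) : N = ⊥ :=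
  hT N hN (XI.solv h ⟨fun m hm => hN.conj_mem m hm x, hf⟩)

lemma exists_inv [Finite G] (hT : TR G) {x : G} (h : SC x) : ∃ t : G, t * x * t⁻¹ = x⁻¹ := by
  have : Fact (Nat.Prime 3) := ⟨Nat.prime_three⟩
  obtain ⟨S, xS, hS⟩ := h.sylow
  by_contra hc
  push Not at hc
  have hP : Subgroup.normalizer (S : Set G) ≤ Subgroup.centralizer (S : Set G) := by
    intro g hg
    replace hg := fun y => (Subgroup.mem_normalizer_iff (H := (S : Subgroup G))).mp hg y
    have h1 : g * x * g⁻¹ ∈ S := (hg x).mp xS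
    have h2 : g * x = x * g := by
      rcases hS _ h1 with e | e | e
      · exfalso; apply h.ne_one
        have := congrArg (fun z => g⁻¹ * z * g) e
        simpa [mul_assoc] using this
      · exact mul_inv_eq_iff_eq_mul.mp e
      · exact absurd e (hc g)
    rw [Subgroup.mem_centralizer_iff]
    intro s hs
    rcases hS s hs with rfl | rfl | rfl
    · simp
    · exact h2.symm
    · rw [inv_mul_eq_iff_eq_mul, ← mul_assoc, ← h2]; simp
  have h3 := MonoidHom.not_dvd_card_ker_transferSylow S hP
  have h4 := MonoidHom.ker_transferSylow_isComplement' S hP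
  have h5 := hT.fr h (MonoidHom.normal_ker _) (fr_iff.mpr h3)
  rw [h5] at h4
  have h6 : (S : Subgroup G) = ⊤ := Subgroup.isComplement'_bot_left.mp h4
  have h7 : ∀ g : G, g * x = x * g := by
    intro g
    have : g ∈ (S : Subgroup G) := by rw [h6]; trivial
    rcases hS g this with rfl | rfl | rfl <;> simp
  have h8 := hT (Subgroup.zpowers x) ⟨by
    intro n hn g
    obtain ⟨k, rfl⟩ := Subgroup.mem_zpowers_iff.mp hn
    have : Commute g (x ^ k) := Commute.zpow_right (h7 g) k
    rw [this.eq]; simp⟩ inferInstance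
  exact h.ne_one (Subgroup.zpowers_eq_bot.mp h8)

lemma inv_involution {x : G} (h : SC x) {t : G} (ht : t * x * t⁻¹ = x⁻¹) : t * t = 1 := by
  have hi : t * x⁻¹ * t⁻¹ = x := by
    have := congrArg (fun z => z⁻¹) ht
    simpa [mul_assoc] using this
  have h1 : (t * t) * x = x * (t * t) := by
    have : t * (t * x * t⁻¹) * t⁻¹ = x := by rw [ht, hi]
    have e : (t * t) * x = (t * (t * x * t⁻¹) * t⁻¹) * (t * t) := by group
    rw [e, this]
  rcases h.cent _ h1 with e | e | e
  · exact e
  · exfalso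
    have : t * (t * t) * t⁻¹ = t * t := by group
    rw [e, ht] at this; exact h.ne_inv this.symm
  · exfalso
    have : t * (t * t) * t⁻¹ = t * t := by group
    rw [e, hi] at this; exact h.ne_inv this

lemma inv_ne_one {x : G} (h : SC x) {t : G} (ht : t * x * t⁻¹ = x⁻¹) : t ≠ 1 := by
  rintro rfl; apply h.ne_inv; simpa using ht

lemma inv_not_T3 {x : G} (h : SC x) {t : G} (ht : t * x * t⁻¹ = x⁻¹) : ¬ T3 t := by
  intro hh
  have := inv_involution h ht
  have h3 := hh.1
  rw [pow_succ, pow_two, this, one_mul] at h3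
  exact hh.2 h3

lemma SC.conj_of_t3 [Finite G] {x : G} (h : SC x) {t : G} (ht : t * x * t⁻¹ = x⁻¹) {y : G} (hy : T3 y) : ∃ g, y = g * x * g⁻¹ := by
  obtain ⟨g, rfl | rfl⟩ := h.conj_of_cube hy.1 hy.2
  · exact ⟨g, rfl⟩
  · refine ⟨g * t, ?_⟩; rw [← ht]; group
end FT

namespace FT
universe u
variable {G : Type u} [Group G]

lemma SC.mem_z {x : G} (h : SC x) {y : G} : y ∈ Subgroup.zpowers x ↔ y * x = x * y := by
  constructor
  · intro hy
    obtain ⟨k, rfl⟩ := Subgroup.mem_zpowers_iff.mp hy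
    exact (Commute.zpow_left (Commute.refl x) k).eq
  · intro hy
    rcases h.cent y hy with rfl | rfl | rfl
    · exact one_mem _
    · exact Subgroup.mem_zpowers _
    · exact inv_mem (Subgroup.mem_zpowers _)

lemma SC.z_cases {x : G} (h : SC x) {y : G} (hy : y ∈ Subgroup.zpowers x) : y = 1 ∨ y = x ∨ y = x⁻¹ := h.cent y (h.mem_z.mp hy)

lemma SC.card_z {x : G} (h : SC x) : Nat.card (Subgroup.zpowers x) = 3 := by rw [Nat.card_zpowers, h.ord]

lemma count_T3 [Finite G] {x : G} (h : SC x) {t : G} (ht : t * x * t⁻¹ = x⁻¹) {β : Type u} (P : G → β → Prop) :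
    Nat.card {p : G × β // P (p.1 * x * p.1⁻¹) p.2} = 3 * Nat.card {p : G × β // T3 p.1 ∧ P p.1 p.2} := by
  classical
  choose! s hs using fun y (hy : T3 y) => h.conj_of_t3 ht hy
  have key : ∀ u : G, (s (u * x * u⁻¹))⁻¹ * u ∈ Subgroup.zpowers x := by
    intro u
    rw [h.mem_z]
    have h1 := hs _ (h.t3.conj u)
    have : s (u * x * u⁻¹) * x = u * x * u⁻¹ * s (u * x * u⁻¹) := by
      rw [← mul_inv_eq_iff_eq_mul]; exact h1.symm
    have e2 : x * (s (u * x * u⁻¹))⁻¹ = (s (u * x * u⁻¹))⁻¹ * (u * x * u⁻¹) := by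
      rw [eq_inv_mul_iff_mul_eq, ← mul_assoc, this]; simp [mul_assoc]
    rw [← mul_assoc, e2]; simp [mul_assoc]
  have e : {p : G × β // P (p.1 * x * p.1⁻¹) p.2} ≃ Subgroup.zpowers x × {p : G × β // T3 p.1 ∧ P p.1 p.2} :=
    { toFun := fun p => (⟨_, key p.1.1⟩, ⟨(p.1.1 * x * p.1.1⁻¹, p.1.2), h.t3.conj _, p.2⟩)
      invFun := fun q => ⟨(s q.2.1.1 * q.1, q.2.1.2), by
        have h1 := hs _ q.2.2.1
        have h2 := h.mem_z.mp q.1.2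
        have : s q.2.1.1 * q.1 * x * (s q.2.1.1 * q.1)⁻¹ = q.2.1.1 := by
          rw [mul_assoc (s _) _ x, h2]; refine Eq.trans ?_ h1.symm; group
        simp only [this]; exact q.2.2.2⟩
      left_inv := by
        rintro ⟨⟨u, b⟩, hp⟩
        simp
      right_inv := by
        rintro ⟨⟨z, hz⟩, ⟨⟨k, b⟩, hk, hp⟩⟩
        have h1 := hs _ hk
        have h2 := h.mem_z.mp hz
        have : s k * z * x * (s k * z)⁻¹ = k := by
          rw [mul_assoc (s _) _ x, h2]; refine Eq.trans ?_ h1.symm; group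
        simp only [this]; simp }
  rw [Nat.card_congr e, Nat.card_prod, h.card_z]

lemma N3_xd [Finite G] {x : G} (h : SC x) {t : G} (ht : t * x * t⁻¹ = x⁻¹) (c : G) :
    N3 x c x = 3 * Nat.card {v : G // T3 (x * (v * c * v⁻¹)⁻¹)} := by
  rw [N3, count_T3 h ht (fun k v => k * (v * c * v⁻¹) = x)]
  congr 1
  refine Nat.card_congr
    { toFun := fun p => ⟨p.1.2, by
        obtain ⟨⟨k, v⟩, hk, e⟩ := p
        simp only at hk e
        have : x * (v * c * v⁻¹)⁻¹ = k := by rw [mul_inv_eq_iff_eq_mul]; exact e.symm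
        simp only [this]; exact hk⟩
      invFun := fun v => ⟨(x * (v.1 * c * v.1⁻¹)⁻¹, v.1), v.2, by simp [mul_assoc]⟩
      left_inv := by
        rintro ⟨⟨k, v⟩, hk, hv⟩
        simp only at hv
        simp only [Subtype.mk.injEq, Prod.mk.injEq, and_true]
        rw [← hv]; simp [mul_assoc]
      right_inv := by
        rintro ⟨v, hv⟩
        rfl }

lemma T3_comm {a b : G} (h : T3 (a * b)) : T3 (b * a) := by
  have := h.conj b; convert this using 1; group

lemma N3_xx [Finite G] {x : G} (h : SC x) {t : G} (ht : t * x * t⁻¹ = x⁻¹) :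
    N3 x x x = 9 * Nat.card (U x) := by
  rw [N3, count_T3 h ht (fun k v => k * (v * x * v⁻¹) = x)]
  have e1 : Nat.card {p : G × G // T3 p.1 ∧ p.1 * (p.2 * x * p.2⁻¹) = x} =
      Nat.card {p : G × G // (fun k j => T3 j ∧ j * k = x) (p.1 * x * p.1⁻¹) p.2} :=
    Nat.card_congr ((Equiv.prodComm G G).subtypeEquiv (by rintro ⟨a, b⟩; rfl))
  rw [e1, count_T3 h ht (fun k j => T3 j ∧ j * k = x), ← mul_assoc]
  congr 1
  refine Nat.card_congr
    { toFun := fun p => ⟨x * p.1.1, by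
        obtain ⟨⟨k, j⟩, hk, hj, e⟩ := p
        simp only at hk hj e
        refine ⟨?_, ?_⟩
        · have : x * (x * k) = x⁻¹ * k := by rw [← mul_assoc, h.sq]
          simp only [this]
          apply T3_comm
          have : k * x⁻¹ = j⁻¹ := by rw [← e]; simp
          rw [this]; exact hj.inv
        · simpa using hk⟩
      invFun := fun u => ⟨(x⁻¹ * u.1, x * (x⁻¹ * u.1)⁻¹), u.2.2, by
        have h1 : T3 (x * (x * u.1⁻¹)) := by
          have : x * (x * u.1⁻¹) = (u.1 * x)⁻¹ := by rw [← mul_assoc, h.sq]; simp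
          rw [this]
          exact (T3_comm u.2.1).inv
        have := T3_comm h1
        simpa [mul_assoc] using this, by simp [mul_assoc]⟩
      left_inv := by
        rintro ⟨⟨k, v⟩, hk, hv, e⟩
        simp only at e
        simp [← e, mul_assoc]
      right_inv := by
        rintro ⟨v, hv⟩
        simp }
lemma mem_cent {c k : G} : k ∈ Subgroup.centralizer {c} ↔ k * c = c * k := by
  rw [Subgroup.mem_centralizer_singleton_iff]

lemma conj_eq_iff {c k l : G} : k * c * k⁻¹ = l * c * l⁻¹ ↔ l⁻¹ * k ∈ Subgroup.centralizer {c} := by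
  rw [mem_cent]
  constructor
  · intro h
    have := congrArg (fun z => l⁻¹ * z * k) h
    simpa [mul_assoc] using this
  · intro h
    have := congrArg (fun z => l * z * k⁻¹) h
    simpa [mul_assoc] using this

/-- an element of `⟨x⟩` commuting with `c` outside forces triviality -/
lemma SC.z_comm {x : G} (h : SC x) {q c : G} (hq : q ∈ Subgroup.zpowers x) (hc1 : c ≠ 1) (hc : ¬ T3 c)
    (hqc : q * c = c * q) : q = 1 := by
  have key : c * x ≠ x * c := by
    intro e
    rcases h.cent c e with e | e | e
    · exact hc1 e
    · rw [e] at hc; exact hc h.t3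
    · rw [e] at hc; exact hc h.inv.t3
  rcases h.z_cases hq with e | e | e
  · exact e
  · rw [e] at hqc; exact absurd hqc.symm key
  · rw [e] at hqc; exfalso; apply key
    have := congrArg (fun z => x * z * x) hqc
    simpa [mul_assoc] using this

lemma N3_orbit_inj {x : G} (h : SC x) {c d u v : G} (hc1 : c ≠ 1) (hc : ¬ T3 c)
    (he : u * c * u⁻¹ * (v * d * v⁻¹) = x) :
    ∃ F : Subgroup.zpowers x × Subgroup.centralizer {c} × Subgroup.centralizer {d} → 
      {p : G × G // p.1 * c * p.1⁻¹ * (p.2 * d * p.2⁻¹) = x}, Function.Injective F ∧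
      ∀ p, (F p).1 = (p.1.1 * u * p.2.1.1, p.1.1 * v * p.2.2.1) := by
  refine ⟨fun p => ⟨(p.1.1 * u * p.2.1.1, p.1.1 * v * p.2.2.1), ?_⟩, ?_, fun p => rfl⟩
  · obtain ⟨⟨p, hp⟩, ⟨k, hk⟩, ⟨l, hl⟩⟩ := p
    simp only
    rw [mem_cent] at hk hl
    have e1 : p * u * k * c * (p * u * k)⁻¹ = p * (u * c * u⁻¹) * p⁻¹ := by
      rw [mul_assoc (p * u) k c, hk]; group
    have e2 : p * v * l * d * (p * v * l)⁻¹ = p * (v * d * v⁻¹) * p⁻¹ := by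
      rw [mul_assoc (p * v) l d, hl]; group
    rw [e1, e2]
    have : p * (u * c * u⁻¹) * p⁻¹ * (p * (v * d * v⁻¹) * p⁻¹) = p * (u * c * u⁻¹ * (v * d * v⁻¹)) * p⁻¹ := by group
    rw [this, he, h.mem_z.mp hp]; simp
  · rintro ⟨⟨p, hp⟩, ⟨k, hk⟩, ⟨l, hl⟩⟩ ⟨⟨p', hp'⟩, ⟨k', hk'⟩, ⟨l', hl'⟩⟩ e
    simp only [Subtype.mk.injEq, Prod.mk.injEq] at e
    obtain ⟨e1, e2⟩ := e
    rw [mem_cent] at hk hk'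
    have hq : p'⁻¹ * p = 1 := by
      refine h.z_comm (c := u * c * u⁻¹) (mul_mem (inv_mem hp') hp) ?_ ?_ ?_
      · intro e
        apply hc1
        have := congrArg (fun z => u⁻¹ * z * u) e
        simpa [mul_assoc] using this
      · intro e
        apply hc
        have := e.conj u⁻¹
        simpa [mul_assoc] using this
      · have e3 : p'⁻¹ * p = u * (k' * k⁻¹) * u⁻¹ := by
          have := congrArg (fun z => p'⁻¹ * z * k⁻¹ * u⁻¹) e1
          simpa [mul_assoc] using this
        have e4 : (k' * k⁻¹) * c = c * (k' * k⁻¹) := by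
          have : Commute (k' * k⁻¹) c := Commute.mul_left hk' (Commute.inv_left hk)
          exact this
        rw [e3]
        calc u * (k' * k⁻¹) * u⁻¹ * (u * c * u⁻¹) = u * ((k' * k⁻¹) * c) * u⁻¹ := by group
          _ = _ := by rw [e4]; group
    have hp : p = p' := (inv_mul_eq_one.mp hq).symm
    subst hp
    simp only [mul_right_inj] at e1 e2
    subst e1; subst e2; rfl

lemma N3_ge [Finite G] {x : G} (h : SC x) {c d : G} (hc1 : c ≠ 1) (hc : ¬ T3 c) (hN : N3 c d x ≠ 0) :
    3 * (Nat.card (Subgroup.centralizer {c}) * Nat.card (Subgroup.centralizer {d})) ≤ N3 c d x := by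
  have : Nonempty {p : G × G // p.1 * c * p.1⁻¹ * (p.2 * d * p.2⁻¹) = x} := by
    by_contra hc
    rw [not_nonempty_iff] at hc
    exact hN (Nat.card_of_isEmpty)
  obtain ⟨⟨u, v⟩, he⟩ := this
  obtain ⟨F, hF, -⟩ := N3_orbit_inj h hc1 hc he
  have := Nat.card_le_card_of_injective F hF
  rwa [Nat.card_prod, Nat.card_prod, h.card_z] at this

lemma inv_rel {x t : G} (ht : t * x * t⁻¹ = x⁻¹) : x⁻¹ * t = t * x ∧ x * t = t * x⁻¹ := by
  have h1 : x⁻¹ * t = t * x := by rw [← ht]; simp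
  refine ⟨h1, ?_⟩
  have h2 := congrArg (fun z => x * z * x⁻¹) h1
  simp [mul_assoc] at h2
  rw [h2]

/-- inverters -/
lemma SC.inverter {x : G} (h : SC x) {t s : G} (ht : t * x * t⁻¹ = x⁻¹) (hs : s * x * s⁻¹ = x⁻¹) :
    ∃ p ∈ Subgroup.zpowers x, s = p * t * p⁻¹ := by
  obtain ⟨r1, r2⟩ := inv_rel ht
  obtain ⟨q1, q2⟩ := inv_rel hs
  have h1 : (s * t⁻¹) * x = x * (s * t⁻¹) := by
    have h2 : t⁻¹ * x = x⁻¹ * t⁻¹ := by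
      have := congrArg (fun z => t⁻¹ * z * t⁻¹) r2
      simpa [mul_assoc] using this
    rw [mul_assoc, h2, ← mul_assoc, ← q2, mul_assoc]
  rcases h.cent _ h1 with e | e | e
  · exact ⟨1, one_mem _, by rw [mul_inv_eq_one] at e; simp [e]⟩
  · refine ⟨x⁻¹, inv_mem (Subgroup.mem_zpowers _), ?_⟩
    rw [mul_inv_eq_iff_eq_mul] at e
    rw [e, r1, inv_inv, mul_assoc, h.sq, r2]
  · refine ⟨x, Subgroup.mem_zpowers _, ?_⟩
    rw [mul_inv_eq_iff_eq_mul] at e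
    rw [e, r2, mul_assoc, h.isq, r1]

lemma N3_tt [Finite G] {x : G} (h : SC x) {t : G} (ht : t * x * t⁻¹ = x⁻¹) :
    N3 t t x = 3 * (Nat.card (Subgroup.centralizer {t}) * Nat.card (Subgroup.centralizer {t})) := by
  have t2 := inv_involution h ht
  have ti : t⁻¹ = t := (eq_inv_of_mul_eq_one_left t2).symm
  obtain ⟨r1, r2⟩ := inv_rel ht
  have he : (1:G) * t * 1⁻¹ * (x * t * x⁻¹) = x := by
    rw [r2, inv_one, one_mul, mul_one, mul_assoc t, h.isq, ← mul_assoc, t2, one_mul]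
  obtain ⟨F, hF, hF2⟩ := N3_orbit_inj h (inv_ne_one h ht) (inv_not_T3 h ht) he
  have hinv : ∀ u : G, (u * t * u⁻¹)⁻¹ = u * t * u⁻¹ := by
    intro u; rw [mul_inv_rev, mul_inv_rev, inv_inv, ti, mul_assoc]
  have hs : Function.Surjective F := by
    rintro ⟨⟨u, v⟩, hp⟩
    simp only at hp
    have h1 : (u * t * u⁻¹) * x * (u * t * u⁻¹)⁻¹ = x⁻¹ := by
      rw [← hp, mul_inv_rev (u * t * u⁻¹) (v * t * v⁻¹), hinv v]
      congr 1
      have : u * t * u⁻¹ * (u * t * u⁻¹ * (v * t * v⁻¹)) = u * (t * t) * u⁻¹ * (v * t * v⁻¹) := by group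
      rw [this, t2]; group
    obtain ⟨p, hp1, hp2⟩ := h.inverter ht h1
    have hp3 := h.mem_z.mp (inv_mem hp1)
    have c1 : p⁻¹ * u ∈ Subgroup.centralizer {t} := conj_eq_iff.mp hp2
    have c2 : (p * x)⁻¹ * v ∈ Subgroup.centralizer {t} := by
      apply conj_eq_iff.mp
      rw [hp2] at hp
      rw [← eq_inv_mul_iff_mul_eq, hinv] at hp
      rw [hp, mul_assoc (p * t), hp3]
      have : p * x * t * (p * x)⁻¹ = p * (x * t) * x⁻¹ * p⁻¹ := by group
      have e3 : p * (t * x⁻¹) * x⁻¹ * p⁻¹ = p * t * (x⁻¹ * x⁻¹) * p⁻¹ := by group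
      rw [this, r2, e3, h.isq]; group
    refine ⟨(⟨p, hp1⟩, ⟨_, c1⟩, ⟨_, c2⟩), Subtype.ext ?_⟩
    rw [hF2]; simp [mul_assoc]
  rw [N3, ← Nat.card_congr (Equiv.ofBijective F ⟨hF, hs⟩), Nat.card_prod, Nat.card_prod, h.card_z]
end FT

namespace FT
universe u
variable {G : Type u} [Group G]

/-- arithmetic data -/
structure AD (x : G) (a e : ℕ) : Prop where
  a4 : 4 ≤ a
  amod : a % 3 = 1
  emod : e % 3 ≠ 0
  card : Nat.card G = 3 * (a * (a + 1)) * e ^ 2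
  cU : 3 * Nat.card (U x) = (a ^ 2 + a + 1) * e ^ 2
  bd : ∀ c : G, c ≠ 1 → ¬ T3 c → Nat.card (Subgroup.centralizer {c}) * (2 * a + 1) ≤ 3 * e * (a * (a + 1))
  inv : ∃ s ∈ U x, s ≠ 1 ∧ s * s = 1

lemma sq_dvd_three {d m k : ℕ} (hm : 0 < m) (h : 3 * m ^ 2 = k * d ^ 2) : d ∣ m := by
  have hd : d ≠ 0 := by rintro rfl; simp at h; omega
  obtain ⟨g, d', m', hg, hco, rfl, rfl⟩ := Nat.exists_coprime' (m := d) (n := m) (Nat.gcd_pos_of_pos_right _ hm)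
  have hg2 : 0 < g ^ 2 := by positivity
  have h1 : 3 * m' ^ 2 = k * d' ^ 2 := by
    apply Nat.eq_of_mul_eq_mul_right hg2
    linarith [h, mul_pow m' g 2, mul_pow d' g 2, show 3 * m' ^ 2 * g ^ 2 = 3 * (m' * g) ^ 2 by ring, show k * d' ^ 2 * g ^ 2 = k * (d' * g) ^ 2 by ring]
  have h2 : d' ^ 2 ∣ 3 * m' ^ 2 := ⟨k, by rw [h1]; ring⟩
  have h3 : d' ^ 2 ∣ 3 := (Nat.Coprime.pow 2 2 hco).dvd_of_dvd_mul_right h2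
  have h4 : d' ≤ 1 := by
    have := Nat.le_of_dvd (by norm_num) h3
    nlinarith
  have h5 : d' = 1 := by
    rcases Nat.le_one_iff_eq_zero_or_eq_one.mp h4 with e | e
    · subst e; simp at hd
    · exact e
  subst h5; simp

lemma kern_triv [Finite G] (hT : TR G) {x : G} (h : SC x) {c : G} (hc : ∀ v : G, T3 (x * (v * c * v⁻¹)⁻¹))
    {t : G} (ht : t * x * t⁻¹ = x⁻¹) : c = 1 := by
  let Z : Subgroup G :=
    { carrier := {z | ∀ k : G, T3 k ↔ T3 (k * z)}
      one_mem' := by intro k; simp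
      mul_mem' := by
        intro a b ha hb k
        rw [← mul_assoc, ← hb, ← ha]
      inv_mem' := by
        intro a ha k
        rw [ha (k * a⁻¹)]; simp }
  have hZn : Z.Normal := ⟨by
    intro n hn g k
    have e1 : T3 (k * (g * n * g⁻¹)) ↔ T3 ((g⁻¹ * k * g) * n) := by
      constructor
      · intro hh
        have := hh.conj g⁻¹
        simpa [mul_assoc] using this
      · intro hh
        have := hh.conj g
        simpa [mul_assoc] using this
    have e2 : T3 k ↔ T3 (g⁻¹ * k * g) := by
      constructor
      · intro hh
        have := hh.conj g⁻¹
        simpa [mul_assoc] using this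
      · intro hh
        have := hh.conj g
        simpa [mul_assoc] using this
    rw [e1, e2]; exact hn _⟩
  have hZf : Fr Z := by
    intro m hm h3
    by_contra h1
    have hm3 : T3 m := ⟨h3, h1⟩
    have := (hm m⁻¹).mp hm3.inv
    rw [inv_mul_cancel] at this
    exact this.2 rfl
  have hZ := hT.fr h hZn hZf
  have step : ∀ k : G, T3 k → T3 (k * c⁻¹) := by
    intro k hk
    obtain ⟨g, rfl⟩ := h.conj_of_t3 ht hk
    have := (hc g⁻¹).conj g
    simpa [mul_assoc] using this
  have hcZ : c⁻¹ ∈ Z := by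
    intro k
    refine ⟨step k, fun hk => ?_⟩
    have : ∀ n : ℕ, T3 (k * c⁻¹ * c⁻¹ ^ n) := by
      intro n
      induction n with
      | zero => simpa using hk
      | succ n ih =>
        have := step _ ih
        rwa [mul_assoc, ← pow_succ] at this
    have h2 := this (orderOf c⁻¹ - 1)
    rw [mul_assoc, ← pow_succ', Nat.sub_add_cancel (orderOf_pos _), pow_orderOf_eq_one, mul_one] at h2
    exact h2
  rw [hZ, Subgroup.mem_bot] at hcZ
  exact inv_eq_one.mp hcZ

lemma CD.val [Finite G] (hT : TR G) {x : G} (h : SC x) {t : G} (ht : t * x * t⁻¹ = x⁻¹) {a : ℕ} {χ : G → ℂ} (D : CD x a χ)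
    {c : G} (hc1 : c ≠ 1) (hc : ¬ T3 c) :
    ∃ y : ℝ, χ c = ((a - y : ℝ) : ℂ) ∧ 0 < y ∧ (N3 x c x : ℝ) * (a * (a + 1)) = Nat.card G * (3 * (a * (a + 1)) - (2 * a + 1) * y) := by
  have hg : (0 : ℝ) < Nat.card G := by exact_mod_cast Nat.card_pos
  have ha : (0 : ℝ) < a := by exact_mod_cast D.pos
  have h1 := D.nxd c hc
  let j := Nat.card {v : G // T3 (x * (v * c * v⁻¹)⁻¹)}
  have hj : N3 x c x = 3 * j := N3_xd h ht c
  let y : ℝ := a - ((N3 x c x : ℝ) * (a * (a + 1)) / Nat.card G - (a ^ 2 + 2 * a)) / (2 * a + 1)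
  have e2 : (2 * (a:ℝ) + 1) ≠ 0 := by positivity
  have hy : (N3 x c x : ℝ) * (a * (a + 1)) = Nat.card G * (3 * (a * (a + 1)) - (2 * a + 1) * y) := by
    simp only [y]; field_simp; ring
  refine ⟨y, ?_, ?_, hy⟩
  · have h3 : ((N3 x c x : ℂ)) * (a * (a + 1)) = Nat.card G * (3 * (a * (a + 1)) - (2 * a + 1) * (y : ℂ)) := by
      exact_mod_cast congrArg (fun r : ℝ => (r : ℂ)) hy
    rw [h1] at h3
    have hg' : (Nat.card G : ℂ) ≠ 0 := by exact_mod_cast hg.ne'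
    have h4 := mul_left_cancel₀ hg' h3
    have h5 : (2 * (a : ℂ) + 1) ≠ 0 := by exact_mod_cast (by omega : 2 * a + 1 ≠ 0)
    apply mul_left_cancel₀ h5
    push_cast
    linear_combination h4
  · have hlt : j < Nat.card G := by
      by_contra hge
      apply hc1
      apply kern_triv hT h _ ht
      intro v
      have : Function.Surjective (Subtype.val : {v : G // T3 (x * (v * c * v⁻¹)⁻¹)} → G) := by
        have := Fintype.ofFinite G
        exact ((Nat.bijective_iff_injective_and_card _).mpr ⟨Subtype.val_injective, le_antisymm (Nat.card_le_card_of_injective _ Subtype.val_injective) (not_lt.mp hge)⟩).2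
      obtain ⟨⟨w, hw⟩, rfl⟩ := this v
      exact hw
    have hlt' : (j : ℝ) < Nat.card G := by exact_mod_cast hlt
    rw [hj] at hy
    push_cast at hy
    by_contra hy0
    have : (2 * (a:ℝ) + 1) * y ≤ 0 := mul_nonpos_of_nonneg_of_nonpos (by positivity) (not_lt.mp hy0)
    have h7 : (j : ℝ) * (a * (a + 1)) < Nat.card G * (a * (a + 1)) := by
      apply mul_lt_mul_of_pos_right hlt'; positivity
    have h8 : (Nat.card G : ℝ) * ((2 * (a:ℝ) + 1) * y) ≤ 0 := mul_nonpos_of_nonneg_of_nonpos hg.le this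
    linarith

lemma exists_AD [Finite G] (hT : TR G) {x : G} (h : SC x) : ∃ a e, AD x a e := by
  obtain ⟨t, ht⟩ := exists_inv hT h
  obtain ⟨a, χ, D⟩ := exists_CD h ht
  have t1 := inv_ne_one h ht
  have t3 := inv_not_T3 h ht
  have t2 := inv_involution h ht
  have hg : 0 < Nat.card G := Nat.card_pos
  have hapos := D.pos
  have ha1 : a ≠ 1 := by
    intro ha
    have hm := D.lin ha
    have h1 := D.one
    rw [ha, Nat.cast_one] at h1
    let N : Subgroup G :=
      { carrier := {z | χ z = 1}
        one_mem' := h1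
        mul_mem' := by intro u v hu hv; simp only [Set.mem_setOf_eq] at *; rw [hm, hu, hv, mul_one]
        inv_mem' := by
          intro u hu
          simp only [Set.mem_setOf_eq] at *
          have := hm u u⁻¹
          rw [mul_inv_cancel, h1, hu, one_mul] at this; exact this.symm }
    have hN : N.Normal := ⟨by
      intro n hn g
      change χ (g * n * g⁻¹) = 1
      have hn' : χ n = 1 := hn
      have := hm g g⁻¹
      rw [mul_inv_cancel, h1] at this
      rw [hm, hm, hn', mul_one, this]⟩
    have : Fact (Nat.Prime 3) := ⟨Nat.prime_three⟩
    have hp : IsPGroup 3 N := by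
      rintro ⟨n, hn⟩
      refine ⟨1, Subtype.ext ?_⟩
      change n ^ 3 ^ 1 = 1
      rw [pow_one]
      by_contra hn3
      obtain ⟨y, e1, e2, -⟩ := D.val hT h ht (c := n) (by rintro rfl; simp at hn3) (fun hh => hn3 hh.1)
      have e3 : χ n = 1 := hn
      rw [e3, ha] at e1
      have : (1:ℝ) = 1 - y := by exact_mod_cast e1
      linarith
    have := hp.isNilpotent
    have hb := hT N hN inferInstance
    have hx : x ∈ N := D.self
    rw [hb] at hx
    exact h.ne_one (Subgroup.mem_bot.mp hx)
  set m := Nat.card (Subgroup.centralizer {t}) with hm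
  have hmpos : 0 < m := Nat.card_pos
  obtain ⟨y, ey, ypos, eN⟩ := D.val hT h ht t1 t3
  obtain ⟨α, hα⟩ := D.two t t2
  obtain ⟨d, hd⟩ : ∃ d : ℕ, (d : ℝ) = y := by
    have : ((a - α : ℤ) : ℝ) = y := by
      have : ((α : ℝ) : ℂ) = ((a - y : ℝ) : ℂ) := by rw [← ey, hα]; simp
      have := Complex.ofReal_injective this
      push_cast; linarith
    refine ⟨(a - α : ℤ).toNat, ?_⟩
    rw [← this]
    have h0 : 0 ≤ (a - α : ℤ) := by
      have : (0:ℝ) < ((a - α : ℤ) : ℝ) := by rw [this]; exact ypos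
      have := Int.cast_pos.mp this
      omega
    rw [← Int.cast_natCast, Int.toNat_of_nonneg h0]
  have dpos : 0 < d := by rw [← hd] at ypos; exact_mod_cast ypos
  have e1 : 3 * m ^ 2 * (a * (a + 1)) = Nat.card G * d ^ 2 := by
    have := D.ncd t t t3 t3
    rw [N3_tt h ht, ey, ← hd] at this
    have h2 : ((3 * (m * m) : ℕ) : ℂ) * (a * (a + 1)) = Nat.card G * ((d : ℂ) * d) := by
      rw [this]; push_cast; ring
    have h3 : (3 * (m * m)) * (a * (a + 1)) = Nat.card G * (d * d) := by exact_mod_cast h2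
    nlinarith
  obtain ⟨k, hk⟩ := D.dvd
  have e2 : 3 * m ^ 2 = k * d ^ 2 := by
    have : 0 < a * (a + 1) := by positivity
    apply Nat.eq_of_mul_eq_mul_right this
    rw [e1, hk]; ring
  obtain ⟨e, he⟩ := sq_dvd_three hmpos e2
  have e3 : k = 3 * e ^ 2 := by
    have : 0 < d ^ 2 := by positivity
    apply Nat.eq_of_mul_eq_mul_right this
    rw [← e2, he]; ring
  have epos : 0 < e := by
    rcases Nat.eq_zero_or_pos e with h0 | h0
    · rw [h0] at he; omega
    · exact h0
  have hcard : Nat.card G = 3 * (a * (a + 1)) * e ^ 2 := by rw [hk, e3]; ring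
  have h9 := h.not_nine
  have h3 : ¬ 3 ∣ (a * (a + 1)) * e ^ 2 := by
    intro hdv
    apply h9
    rw [hcard, mul_assoc, show (9:ℕ) = 3 * 3 by norm_num]
    exact Nat.mul_dvd_mul_left 3 hdv
  have hp3 := Nat.prime_three
  have ha3 : a % 3 = 1 := by
    have c1 : ¬ 3 ∣ a := fun hh => h3 ((hh.mul_right _).mul_right _)
    have c2 : ¬ 3 ∣ a + 1 := fun hh => h3 ((hh.mul_left _).mul_right _)
    omega
  have he3 : e % 3 ≠ 0 := by
    intro hh
    exact h3 (((Nat.dvd_of_mod_eq_zero hh).trans (dvd_pow_self e two_ne_zero)).mul_left _)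
  refine ⟨a, e, by omega, ha3, he3, hcard, ?_, ?_, ?_⟩
  · have h5 := D.nxx
    rw [N3_xx h ht, hcard] at h5
    have : 0 < 3 * (a * (a + 1)) := by positivity
    apply Nat.eq_of_mul_eq_mul_right this
    nlinarith
  · intro c hc1 hc3
    obtain ⟨z, ez, zpos, eNz⟩ := D.val hT h ht hc1 hc3
    have h5 := D.ncd c t hc3 t3
    rw [ez, ey, ← hd] at h5
    have h6 : (N3 c t x : ℝ) * (a * (a + 1)) = Nat.card G * (z * d) := by
      have : ((N3 c t x : ℝ) : ℂ) * ((a : ℝ) * ((a : ℝ) + 1)) = ((Nat.card G : ℝ) : ℂ) * (((z : ℝ) : ℂ) * (d : ℝ)) := by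
        push_cast; rw [h5]; push_cast; ring
      exact_mod_cast this
    have hcR : (Nat.card G : ℝ) = 3 * (a * (a + 1)) * e ^ 2 := by exact_mod_cast hcard
    have haR : (0:ℝ) < a := by exact_mod_cast hapos
    have h7 : (N3 c t x : ℝ) = 3 * e * m * z := by
      have hmR : (m : ℝ) = d * e := by exact_mod_cast he
      have : (0:ℝ) < a * (a + 1) := by positivity
      apply mul_right_cancel₀ this.ne'
      rw [h6, hcR, hmR]; ring
    have hmR : (0:ℝ) < m := by exact_mod_cast hmpos
    have heR : (0:ℝ) < e := by exact_mod_cast epos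
    have h8 : N3 c t x ≠ 0 := by
      intro h0
      rw [h0] at h7
      have : (0:ℝ) < 3 * e * m * z := by positivity
      rw [← h7] at this; simp at this
    have h10 := N3_ge h hc1 hc3 h8
    have h11 : (3 * (Nat.card (Subgroup.centralizer {c}) * m) : ℝ) ≤ 3 * e * m * z := by
      rw [← h7]; exact_mod_cast h10
    have h12 : (Nat.card (Subgroup.centralizer {c}) : ℝ) ≤ e * z := by
      have : (0:ℝ) < 3 * m := by positivity
      apply le_of_mul_le_mul_right _ this
      linarith
    have h13 : (2 * (a:ℝ) + 1) * z ≤ 3 * (a * (a + 1)) := by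
      have : (0:ℝ) ≤ (N3 x c x : ℝ) * (a * (a + 1)) := by positivity
      rw [eNz] at this
      have hgR : (0:ℝ) < Nat.card G := by exact_mod_cast hg
      have := nonneg_of_mul_nonneg_right this hgR
      linarith
    have h14 : (Nat.card (Subgroup.centralizer {c}) : ℝ) * (2 * a + 1) ≤ 3 * e * (a * (a + 1)) := by
      have i1 := mul_le_mul_of_nonneg_right h12 (by positivity : (0:ℝ) ≤ 2 * a + 1)
      have i2 := mul_le_mul_of_nonneg_left h13 heR.le
      linarith
    exact_mod_cast h14
  · have hN : N3 x t x ≠ 0 := by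
      intro h0
      rw [h0, ← hd] at eN
      have hgR : (0:ℝ) < Nat.card G := by exact_mod_cast hg
      have h5 : (3 * (a * (a + 1)) - (2 * a + 1) * d : ℝ) = 0 := by
        simp only [Nat.cast_zero, zero_mul] at eN
        rcases mul_eq_zero.mp eN.symm with h6 | h6
        · exact absurd h6 hgR.ne'
        · exact h6
      have h6 : 3 * (a * (a + 1)) = (2 * a + 1) * d := by
        have : (3 * (a * (a + 1)) : ℝ) = (2 * a + 1) * d := by linarith
        exact_mod_cast this
      have h7 : 2 * a + 1 ∣ 3 := by
        have h8 : 2 * a + 1 ∣ (a * (a + 1)) * 3 := ⟨d, by rw [← h6]; ring⟩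
        refine Nat.Coprime.dvd_of_dvd_mul_left ?_ h8
        apply Nat.Coprime.mul_right
        · rw [Nat.coprime_comm]
          simp
        · have : 2 * a + 1 = (a + 1) + a := by ring
          rw [this]; simp
      have := Nat.le_of_dvd (by norm_num) h7
      omega
    have : Nonempty {p : G × G // p.1 * x * p.1⁻¹ * (p.2 * t * p.2⁻¹) = x} := by
      by_contra hc
      rw [not_nonempty_iff] at hc
      exact hN (Nat.card_of_isEmpty)
    obtain ⟨⟨u, v⟩, hp⟩ := this
    simp only at hp
    have s2 : (v * t * v⁻¹) * (v * t * v⁻¹) = 1 := by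
      have : (v * t * v⁻¹) * (v * t * v⁻¹) = v * (t * t) * v⁻¹ := by group
      rw [this, t2]; simp
    refine ⟨v * t * v⁻¹, ⟨?_, ?_⟩, ?_, s2⟩
    · have : x * (v * t * v⁻¹) = u * x * u⁻¹ := by
        conv_lhs => rw [← hp]
        rw [mul_assoc, s2, mul_one]
      rw [this]; exact h.t3.conj u
    · apply T3_comm
      have : v * t * v⁻¹ * x⁻¹ = (u * x * u⁻¹)⁻¹ := by
        rw [mul_inv_eq_iff_eq_mul, eq_inv_mul_iff_mul_eq]; exact hp
      rw [this]; exact (h.t3.conj u).inv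
    · intro e
      have := congrArg (fun z => v⁻¹ * z * v) e
      simp [mul_assoc] at this
      exact t1 this
end FT

namespace FT
universe u
variable {G : Type u} [Group G]

/-- induction hypothesis -/
def IH (n : ℕ) : Prop := ∀ (Q : Type u) [Group Q] [Finite Q] (x : Q), TR Q → SC x → Nat.card Q < n →
  Nat.card Q = 60 ∨ (Nat.card Q = 168 ∧ ∃ u ∈ U x, u ≠ 1 ∧ u ^ 7 = 1)

/-- local data -/
structure LB (x : G) (L O : Subgroup G) : Prop where
  inv : ∃ t ∈ L, t * x * t⁻¹ = x⁻¹
  two : ∀ r ∈ O, ∀ k : ℕ, Odd k → r ^ k = 1 → r = 1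
  Y : ∃ Y, XI x Y ∧ O ≤ Y ∧ Y ≤ L ∧ ¬ Y ≤ O
  card : Nat.card L = 60 * Nat.card O

lemma lift_U [Finite G] {x : G} {L O : Subgroup G} (hO : IsO L O) (hx : x ∈ L)
    {Q : Type u} [Group Q] [Finite Q] (φ : L →* Q) (sφ : Function.Surjective φ) (kφ : ∀ l : L, φ l = 1 ↔ (l : G) ∈ O)
    (hs : SC (φ ⟨x, hx⟩)) {u : Q} (hu : u ∈ U (φ ⟨x, hx⟩)) :
    ∃ Y, XI x Y ∧ O ≤ Y ∧ Y ≤ L ∧ ∃ y : L, (y : G) ∈ Y ∧ φ y = u := by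
  have hM := U_xi hs hu
  set M := Subgroup.closure {u, φ ⟨x, hx⟩ * u * (φ ⟨x, hx⟩)⁻¹, (φ ⟨x, hx⟩)⁻¹ * u * φ ⟨x, hx⟩} with hMd
  have huM : u ∈ M := Subgroup.subset_closure (by simp)
  have mem : ∀ z : L, (z : G) ∈ (M.comap φ).map L.subtype ↔ φ z ∈ M := by
    intro z
    simp
  refine ⟨(M.comap φ).map L.subtype, ⟨?_, ?_⟩, ?_, ?_, ?_⟩
  · rintro m ⟨l, hl, rfl⟩
    have := (mem (⟨x, hx⟩ * l * ⟨x, hx⟩⁻¹)).mpr (by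
      simp only [map_mul, map_inv]
      exact hM.inv _ hl)
    simpa using this
  · rintro m ⟨l, hl, rfl⟩ h3
    have h3' : l ^ 3 = 1 := Subtype.ext (by simpa using h3)
    have : φ l = 1 := hM.fr _ hl (by rw [← map_pow, h3', map_one])
    rw [kφ] at this
    exact hO.fr _ this h3
  · intro o ho
    refine (mem ⟨o, hO.le ho⟩).mpr ?_
    rw [(kφ ⟨o, hO.le ho⟩).mpr ho]; exact M.one_mem
  · rintro m ⟨l, hl, rfl⟩; exact l.2
  · obtain ⟨y, rfl⟩ := sφ u
    exact ⟨y, (mem y).mpr huM, rfl⟩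

lemma lift_prime [Finite G] {x : G} (h : SC x) {L O : Subgroup G} (hO : IsO L O) (hx : x ∈ L)
    {Q : Type u} [Group Q] [Finite Q] (φ : L →* Q) (sφ : Function.Surjective φ) (kφ : ∀ l : L, φ l = 1 ↔ (l : G) ∈ O)
    (hs : SC (φ ⟨x, hx⟩)) {u : Q} (hu : u ∈ U (φ ⟨x, hx⟩)) (hu1 : u ≠ 1) {p : ℕ} (hp : p.Prime) (hup : u ^ p = 1)
    {r : G} (hr : r ∈ O) {k : ℕ} (hk : Nat.Coprime k p) (hrk : r ^ k = 1) : r = 1 := by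
  obtain ⟨Y, hY, hOY, hYL, y, hyY, rfl⟩ := lift_U hO hx φ sφ kφ hs hu
  by_contra hr1
  obtain ⟨a, m, hm, e⟩ := Nat.exists_eq_pow_mul_and_not_dvd (orderOf_pos (y : G)).ne' p hp.ne_one
  have hy1 : ((y : G) ^ m) ^ (p ^ a) = 1 := by
    rw [← pow_mul, mul_comm, ← e]; exact pow_orderOf_eq_one _
  have : (y : G) ^ m ∈ O := by
    refine hO.cent h (R := {r | r ∈ O ∧ r ^ k = 1}) (fun r hr => hr.1) ?_ (r := r) ⟨hr, hrk⟩ hr1 (L.pow_mem y.2 m) ?_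
    · rintro l hl r ⟨hr, hrk⟩
      refine ⟨hO.stab l hl r hr, ?_⟩
      rw [conj_pow, hrk]; simp
    · rintro r ⟨hr, hrk⟩
      exact XI.coprime_comm h hY (Y.pow_mem hyY m) (hOY hr) hy1 hrk (Nat.Coprime.pow_left a hk.symm)
  have h2 : φ (y ^ m) = 1 := (kφ (y ^ m)).mpr (by simpa using this)
  rw [map_pow] at h2
  have : orderOf (φ y) = p := orderOf_eq_prime (hp := ⟨hp⟩) hup hu1
  exact hm (this ▸ orderOf_dvd_of_pow_eq_one h2)

lemma local_B [Finite G] {x : G} (h : SC x) {L O : Subgroup G} (hO : IsO L O) (hx : x ∈ L) (hO1 : O ≠ ⊥)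
    (ih : IH.{u} (Nat.card G)) : PA x L O ∨ LB x L O := by
  have xiO : XI x O := ⟨fun m hm => hO.stab x hx m hm, hO.fr⟩
  obtain hA | ⟨Q, _, _, φ, sφ, kφ, hs, hT⟩ := tri h hO hx
  · exact Or.inl hA
  right
  obtain ⟨a, e, D⟩ := exists_AD hT hs
  obtain ⟨s, hsU, hs1, hss⟩ := D.inv
  have two : ∀ r ∈ O, ∀ k : ℕ, Odd k → r ^ k = 1 → r = 1 := fun r hr k hk hrk =>
    lift_prime h hO hx φ sφ kφ hs hsU hs1 Nat.prime_two (by rw [pow_two]; exact hss) hr (Nat.coprime_two_right.mpr hk) hrk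
  have cL : Nat.card L = Nat.card Q * Nat.card O := by
    have e1 := Subgroup.card_mul_index φ.ker
    rw [Subgroup.index_ker, MonoidHom.range_eq_top.mpr sφ, Subgroup.card_top] at e1
    have e2 : φ.ker = O.subgroupOf L := by
      ext l; rw [MonoidHom.mem_ker, kφ]; rfl
    rw [e2, Nat.card_congr (Subgroup.subgroupOfEquivOfLe hO.le).toEquiv] at e1
    rw [← e1, mul_comm]
  have cO : 1 < Nat.card O := by
    rw [Nat.one_lt_iff_ne_zero_and_ne_one]
    exact ⟨Nat.card_pos.ne', fun e => hO1 (Subgroup.card_eq_one.mp e)⟩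
  have cQ : Nat.card Q < Nat.card G := by
    have h1 : Nat.card L ≤ Nat.card G := Nat.le_of_dvd Nat.card_pos (Subgroup.card_subgroup_dvd_card L)
    have h2 : 0 < Nat.card Q := Nat.card_pos
    nlinarith
  refine ⟨?_, two, ?_, ?_⟩
  · obtain ⟨t, ht⟩ := exists_inv hT hs
    obtain ⟨l, rfl⟩ := sφ t
    have : φ (l * ⟨x, hx⟩ * l⁻¹ * ⟨x, hx⟩) = 1 := by
      simp only [map_mul, map_inv, ht]; simp
    rw [kφ] at this
    obtain ⟨w, hw, e2⟩ := lemF h.inv (xiO.inv' h) this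
    refine ⟨w⁻¹ * l, L.mul_mem (L.inv_mem (hO.le hw)) l.2, ?_⟩
    have e3 : (l : G) * x * (l : G)⁻¹ = w * x⁻¹ * w⁻¹ := by rw [← e2]; simp
    have := congrArg (fun z => w⁻¹ * z * w) e3
    simpa [mul_assoc] using this
  · obtain ⟨Y, hY, hOY, hYL, y, hyY, hy⟩ := lift_U hO hx φ sφ kφ hs hsU
    refine ⟨Y, hY, hOY, hYL, fun hc => hs1 ?_⟩
    rw [← hy, kφ]; exact hc hyY
  · obtain c | ⟨c, u, hu, hu1, hu7⟩ := ih Q _ hT hs cQ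
    · rw [cL, c]
    · exfalso
      apply hO1
      rw [Subgroup.eq_bot_iff_forall]
      intro r hr
      obtain ⟨a, m, hm, e⟩ := Nat.exists_eq_pow_mul_and_not_dvd (orderOf_pos r).ne' 2 (by norm_num)
      have h1 : r ^ (2 ^ a) = 1 := by
        refine two _ (O.pow_mem hr _) m ?_ ?_
        · rw [← Nat.not_even_iff_odd, even_iff_two_dvd]; exact hm
        · rw [← pow_mul, ← e]; exact pow_orderOf_eq_one _
      exact lift_prime h hO hx φ sφ kφ hs hu hu1 (by norm_num) hu7 hr (Nat.Coprime.pow_left a (by norm_num)) h1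

end FT

namespace FT
universe u
variable {G : Type u} [Group G]

/-- maximal invariant subgroups -/
def MX (x : G) (M : Subgroup G) : Prop := XI x M ∧ ∀ N, XI x N → M ≤ N → N ≤ M

/-- stability under one element -/
def Tin (t : G) (M : Subgroup G) : Prop := ∀ m ∈ M, t * m * t⁻¹ ∈ M

lemma Tin.pow {t : G} {M : Subgroup G} (h : Tin t M) (n : ℕ) : Tin (t ^ n) M := by
  induction n with
  | zero => intro m hm; simpa using hm
  | succ n ih =>
    intro m hm
    have := h _ (ih m hm)
    have e : t ^ (n + 1) * m * (t ^ (n + 1))⁻¹ = t * (t ^ n * m * (t ^ n)⁻¹) * t⁻¹ := by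
      rw [pow_succ']; group
    rw [e]; exact this

lemma Tin.inv [Finite G] {t : G} {M : Subgroup G} (h : Tin t M) : Tin t⁻¹ M := by
  have e : t⁻¹ = t ^ (orderOf t - 1) := by
    rw [inv_eq_iff_mul_eq_one, ← pow_succ', Nat.sub_add_cancel (orderOf_pos t)]; exact pow_orderOf_eq_one t
  rw [e]; exact h.pow _

lemma Tin.mul {s t : G} {M : Subgroup G} (h : Tin s M) (h' : Tin t M) : Tin (s * t) M := by
  intro m hm
  have : s * t * m * (s * t)⁻¹ = s * (t * m * t⁻¹) * s⁻¹ := by group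
  rw [this]; exact h _ (h' m hm)

lemma mem_NN [Finite G] {D : Subgroup G} {g : G} : g ∈ Subgroup.normalizer (D : Set G) ↔ Tin g D := by
  constructor
  · intro hg m hm; exact ((Subgroup.mem_normalizer_iff (H := D)).mp hg m).mp hm
  · intro hg
    rw [Subgroup.mem_normalizer_iff]
    intro m
    refine ⟨hg m, fun hm => ?_⟩
    have := hg.inv _ hm
    simpa [mul_assoc] using this

lemma exists_MX [Finite G] {x : G} {N : Subgroup G} (hN : XI x N) : ∃ M, MX x M ∧ N ≤ M := by
  obtain ⟨M, hM, hm⟩ := (Set.toFinite {N : Subgroup G | XI x N}).exists_le_maximal hN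
  exact ⟨M, ⟨hm.prop, fun N hN h => hm.le_of_ge hN h⟩, hM⟩

lemma XI.inverter_not_mem {x : G} (h : SC x) {M : Subgroup G} (hM : XI x M) {t : G} (ht : t * x * t⁻¹ = x⁻¹) : t ∉ M := by
  intro htM
  have e2 : t * (x * t⁻¹ * x⁻¹) = x := by
    have : t * (x * t⁻¹ * x⁻¹) = t * x * t⁻¹ * x⁻¹ := by group
    rw [this, ht, h.isq]
  exact hM.fr.not_mem h (by rw [← e2]; exact M.mul_mem htM (hM.inv _ (M.inv_mem htM)))

lemma XI.tin {x : G} {M : Subgroup G} (hM : XI x M) : Tin x M := hM.inv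

lemma XI.tin_z [Finite G] {x : G} (h : SC x) {M : Subgroup G} (hM : XI x M) {p : G} (hp : p ∈ Subgroup.zpowers x) : Tin p M := by
  rcases h.z_cases hp with rfl | rfl | rfl
  · intro m hm; simpa using hm
  · exact hM.tin
  · exact hM.tin.inv

lemma XI.tin_all [Finite G] {x : G} (h : SC x) {M : Subgroup G} (hM : XI x M) {t s : G} (ht : t * x * t⁻¹ = x⁻¹)
    (hs : s * x * s⁻¹ = x⁻¹) (hT : Tin t M) : Tin s M := by
  obtain ⟨p, hp, rfl⟩ := h.inverter ht hs
  exact ((hM.tin_z h hp).mul hT).mul (hM.tin_z h (Subgroup.inv_mem _ hp))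

lemma six_dvd [Finite G] {x : G} (h : SC x) {X L : Subgroup G} (hX : XI x X) (hXL : X ≤ L) (hxL : x ∈ L) {t : G}
    (htL : t ∈ L) (ht : t * x * t⁻¹ = x⁻¹) (hT : Tin t X) : 6 * Nat.card X ∣ Nat.card L := by
  let K : Subgroup G := Subgroup.normalizer (X : Set G) ⊓ L
  have hXK : X ≤ K := le_inf Subgroup.le_normalizer hXL
  have xK : x ∈ K := ⟨mem_NN.mpr hX.tin, hxL⟩
  have tK : t ∈ K := ⟨mem_NN.mpr hT, htL⟩
  have nO : (X.subgroupOf K).Normal := ⟨fun n hn g => mem_NN.mp g.2.1 n hn⟩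
  have e1 := Subgroup.card_eq_card_quotient_mul_card_subgroup (X.subgroupOf K)
  rw [Nat.card_congr (Subgroup.subgroupOfEquivOfLe hXK).toEquiv] at e1
  have m1 : ∀ k : K, (QuotientGroup.mk' (X.subgroupOf K)) k = 1 ↔ (k : G) ∈ X := fun l => by
    rw [← MonoidHom.mem_ker, QuotientGroup.ker_mk']; rfl
  have o3 : orderOf ((QuotientGroup.mk' (X.subgroupOf K)) ⟨x, xK⟩) = 3 := by
    refine orderOf_eq_prime (p := 3) (hp := ⟨Nat.prime_three⟩) ?_ ?_
    · rw [← map_pow, m1]; simpa [h.cube] using X.one_mem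
    · rw [Ne, m1]; exact hX.fr.not_mem h
  have o2 : orderOf ((QuotientGroup.mk' (X.subgroupOf K)) ⟨t, tK⟩) = 2 := by
    refine orderOf_eq_prime (p := 2) (hp := ⟨Nat.prime_two⟩) ?_ ?_
    · rw [← map_pow, m1]; simpa [pow_two, inv_involution h ht] using X.one_mem
    · rw [Ne, m1]; exact hX.inverter_not_mem h ht
  have d3 := orderOf_dvd_natCard ((QuotientGroup.mk' (X.subgroupOf K)) ⟨x, xK⟩)
  have d2 := orderOf_dvd_natCard ((QuotientGroup.mk' (X.subgroupOf K)) ⟨t, tK⟩)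
  rw [o3] at d3
  rw [o2] at d2
  have d6 : 6 ∣ Nat.card (K ⧸ X.subgroupOf K) := by
    omega
  refine (Nat.mul_dvd_mul_right d6 _).trans ?_
  rw [← e1]
  exact Subgroup.card_dvd_of_le inf_le_right

/-- p-part of an invariant subgroup -/
structure PP (p : ℕ) (M Q : Subgroup G) : Prop where
  mem : ∀ m, m ∈ Q ↔ m ∈ M ∧ ∃ k, m ^ (p ^ k) = 1
  card : Nat.card Q = p ^ (Nat.card M).factorization p

lemma PP.tin {p : ℕ} {M Q : Subgroup G} (h : PP p M Q) {g : G} (hg : Tin g M) : Tin g Q := by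
  intro m hm
  obtain ⟨h1, k, h2⟩ := (h.mem m).mp hm
  refine (h.mem _).mpr ⟨hg m h1, k, ?_⟩
  rw [conj_pow, h2]; simp

lemma PP.le {p : ℕ} {M Q : Subgroup G} (h : PP p M Q) : Q ≤ M := fun m hm => ((h.mem m).mp hm).1

lemma PP.xi {p : ℕ} {M Q : Subgroup G} (h : PP p M Q) {x : G} (hM : XI x M) : XI x Q :=
  ⟨h.tin hM.tin, hM.fr.of_le h.le⟩

lemma exists_PP [Finite G] {x : G} (h : SC x) {M : Subgroup G} (hM : XI x M) {p : ℕ} (hp : p.Prime) :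
    ∃ Q, PP p M Q := by
  haveI := Fact.mk hp
  haveI := hM.nilp h
  obtain ⟨P⟩ : Nonempty (Sylow p M) := inferInstance
  have hn : P.Normal := Sylow.normal_of_normalizerCondition Group.normalizerCondition_of_isNilpotent P
  refine ⟨(P : Subgroup M).map M.subtype, ?_, ?_⟩
  · intro m
    constructor
    · rintro ⟨l, hl, rfl⟩
      refine ⟨l.2, ?_⟩
      obtain ⟨k, hk⟩ := P.isPGroup' ⟨l, hl⟩
      refine ⟨k, ?_⟩
      have := congrArg (fun z : P => ((z : M) : G)) hk
      simpa using this
    · rintro ⟨hm, k, hk⟩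
      have hz : IsPGroup p (Subgroup.zpowers (⟨m, hm⟩ : M)) := by
        rw [IsPGroup.iff_card]
        have h1 : (⟨m, hm⟩ : M) ^ (p ^ k) = 1 := Subtype.ext (by simpa using hk)
        rw [Nat.card_zpowers]
        obtain ⟨j, _, hj⟩ := (Nat.dvd_prime_pow hp).mp (orderOf_dvd_of_pow_eq_one h1)
        exact ⟨j, hj⟩
      obtain ⟨Q, hQ⟩ := hz.exists_le_sylow
      have hu := Sylow.unique_of_normal P hn
      have : Q = P := Subsingleton.elim _ _
      rw [this] at hQ
      exact ⟨⟨m, hm⟩, hQ (Subgroup.mem_zpowers _), rfl⟩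
  · rw [Subgroup.card_map_of_injective M.subtype_injective]
    exact P.card_eq_multiplicity

lemma nilp_norm [Finite G] {x : G} (h : SC x) {M D : Subgroup G} (hM : XI x M) (hD : D ≤ M) (hne : ¬ M ≤ D) :
    ∃ g ∈ M, g ∉ D ∧ g ∈ Subgroup.normalizer (D : Set G) := by
  haveI := hM.nilp h
  have hc := Group.normalizerCondition_of_isNilpotent (G := M) (D.subgroupOf M) (by
    rw [lt_top_iff_ne_top, Ne, Subgroup.subgroupOf_eq_top]; exact hne)
  obtain ⟨g, hg, hg'⟩ := SetLike.exists_of_lt hc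
  refine ⟨g, g.2, hg', mem_NN.mpr ?_⟩
  intro d hd
  have := ((Subgroup.mem_normalizer_iff (H := D.subgroupOf M)).mp hg ⟨d, hD hd⟩).mp hd
  exact this

end FT

namespace FT
universe u
variable {G : Type u} [Group G]

lemma XI.inf_tin {x : G} {M L : Subgroup G} (hM : XI x M) (hx : x ∈ L) : XI x (M ⊓ L) :=
  ⟨fun m hm => ⟨hM.inv m hm.1, L.mul_mem (L.mul_mem hx hm.2) (L.inv_mem hx)⟩, hM.fr.of_le inf_le_left⟩

lemma XI.inf {x : G} {M N : Subgroup G} (hM : XI x M) (hN : XI x N) : XI x (M ⊓ N) :=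
  ⟨fun m hm => ⟨hM.inv m hm.1, hN.inv m hm.2⟩, hM.fr.of_le inf_le_left⟩

lemma IsO.le_of_norm [Finite G] {D O : Subgroup G} (hO : IsO (Subgroup.normalizer (D : Set G)) O) (hD : Fr D) : D ≤ O :=
  hO.max D Subgroup.le_normalizer (fun l hl d hd => mem_NN.mp hl d hd) hD

/-- the arithmetic end of the intersection argument -/
lemma ten_case [Finite G] {x : G} (h : SC x) {X O L : Subgroup G} (hX : XI x X) (hO : XI x O) (hOX : O ≤ X) (hne : ¬ X ≤ O)
    (two : ∀ r ∈ O, ∀ k : ℕ, Odd k → r ^ k = 1 → r = 1) (cL : Nat.card L = 60 * Nat.card O)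
    (h6 : 6 * Nat.card X ∣ Nat.card L) : False := by
  obtain ⟨k, hk⟩ := Subgroup.card_dvd_of_le hOX
  have c1 := hX.card_mod h
  have c2 := hO.card_mod h
  have pO : 0 < Nat.card O := Nat.card_pos
  have k10 : k ∣ 10 := by
    rw [cL, hk] at h6
    have : Nat.card O * 6 * k ∣ Nat.card O * 6 * 10 := by
      convert h6 using 1 <;> ring
    exact Nat.dvd_of_mul_dvd_mul_left (by positivity) this
  have kle := Nat.le_of_dvd (by norm_num) k10
  have k1 : k ≠ 1 := by
    rintro rfl
    apply hne
    have := Subgroup.eq_of_le_of_card_ge hOX (by omega)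
    rw [this]
  have kk : k = 10 := by
    rw [hk, Nat.mul_mod, c2] at c1
    interval_cases k <;> simp_all
  subst kk
  have n5 : ¬ 5 ∣ Nat.card O := by
    intro h5
    haveI : Fact (Nat.Prime 5) := ⟨by norm_num⟩
    obtain ⟨r, hr⟩ := exists_prime_orderOf_dvd_card' 5 h5
    have hr5 : (r : G) ^ 5 = 1 := by
      have := pow_orderOf_eq_one r
      rw [hr] at this
      have := congrArg (fun z : O => (z : G)) this
      simpa using this
    have := two r r.2 5 (by decide) hr5
    have : r = 1 := Subtype.ext this
    rw [this, orderOf_one] at hr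
    omega
  obtain ⟨Q, hQ⟩ := exists_PP h hX (p := 5) (by norm_num)
  have c3 := (hQ.xi hX).card_mod h
  have : (Nat.card X).factorization 5 = 1 := by
    rw [hk, Nat.factorization_mul (by omega) (by norm_num), Finsupp.add_apply, Nat.factorization_eq_zero_of_not_dvd n5]
    have : (10 : ℕ) = 5 * 2 := by norm_num
    rw [this, Nat.factorization_mul (by norm_num) (by norm_num), Finsupp.add_apply, Nat.Prime.factorization_self (by norm_num),
      Nat.factorization_eq_zero_of_not_dvd (by norm_num)]; norm_num
  rw [hQ.card, this] at c3
  norm_num at c3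

lemma tii_TI [Finite G] {x : G} (h : SC x) (ih : IH.{u} (Nat.card G)) {t : G} (ht : t * x * t⁻¹ = x⁻¹)
    {M : Subgroup G} (hM : MX x M) (hT : Tin t M) {N : Subgroup G} (hN : MX x N) (hD : M ⊓ N ≠ ⊥) : N = M := by
  by_contra hne
  obtain ⟨N, ⟨hN, hne, hD⟩, hmax⟩ := Set.exists_max_image {N : Subgroup G | MX x N ∧ N ≠ M ∧ M ⊓ N ≠ ⊥}
    (fun N => Nat.card (M ⊓ N : Subgroup G)) (Set.toFinite _) ⟨N, hN, hne, hD⟩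
  set D := M ⊓ N with hDd
  have xiD : XI x D := hM.1.inf hN.1
  set L := Subgroup.normalizer (D : Set G) with hL
  have xL : x ∈ L := mem_NN.mpr xiD.tin
  have hMD : ¬ M ≤ D := fun hc => hne (le_antisymm (hM.2 N hN.1 (hc.trans inf_le_right)) (hc.trans inf_le_right))
  have hND : ¬ N ≤ D := fun hc => hne (le_antisymm (hc.trans inf_le_left) (hN.2 M hM.1 (hc.trans inf_le_left)))
  obtain ⟨g1, g1M, g1D, g1L⟩ := nilp_norm h hM.1 (inf_le_left : D ≤ M) hMD
  obtain ⟨g2, g2N, g2D, g2L⟩ := nilp_norm h hN.1 (inf_le_right : D ≤ N) hND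
  have hDL : D ≤ L := Subgroup.le_normalizer
  have key : ∀ M', MX x M' → M ⊓ L ≤ M' → M' = M := by
    intro M' hM' hle
    by_contra hne'
    have hDM' : D ≤ M ⊓ M' := le_inf inf_le_left (le_trans (le_inf inf_le_left hDL) hle)
    have hb : M ⊓ M' ≠ ⊥ := fun hc => hD (le_bot_iff.mp (hc ▸ hDM'))
    have := hmax M' ⟨hM', hne', hb⟩
    have e := Subgroup.eq_of_le_of_card_ge hDM' this
    apply g1D
    change g1 ∈ D
    rw [e]; exact ⟨g1M, hle ⟨g1M, g1L⟩⟩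
  obtain ⟨O, hO⟩ := exists_O L
  have xiO : XI x O := ⟨fun m hm => hO.stab x xL m hm, hO.fr⟩
  have hDO : D ≤ O := hO.le_of_norm xiD.fr
  have hO1 : O ≠ ⊥ := fun hc => hD (le_bot_iff.mp (hc ▸ hDO))
  have xX := hM.1.inf_tin xL
  have xX2 := hN.1.inf_tin xL
  obtain hA | hB := local_B h hO xL hO1 ih
  · obtain ⟨M3, hM3, hle⟩ := exists_MX xiO
    have e3 := key M3 hM3 ((hA.xi_le h hO xL inf_le_right xX).trans hle)
    subst e3
    exact g2D ⟨hle (hA.xi_le h hO xL inf_le_right xX2 ⟨g2N, g2L⟩), g2N⟩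
  · obtain ⟨M', hM', hle⟩ := exists_MX (xi_sup xL hO.stab inf_le_right hO.fr xX)
    have e := key M' hM' (le_sup_left.trans hle)
    subst e
    have hOX : O ≤ M' ⊓ L := le_inf (le_sup_right.trans hle) hO.le
    obtain ⟨s, sL, hs⟩ := hB.inv
    have hsX : Tin s (M' ⊓ L) := fun m hm =>
      ⟨hM.1.tin_all h ht hs hT m hm.1, L.mul_mem (L.mul_mem sL hm.2) (L.inv_mem sL)⟩
    refine ten_case h xX xiO hOX ?_ hB.two hB.card (six_dvd h xX inf_le_right xL sL hs hsX)
    intro hXO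
    obtain ⟨M4, hM4, hle4⟩ := exists_MX (xi_sup xL hO.stab inf_le_right hO.fr xX2)
    have e4 := key M4 hM4 (hXO.trans (le_sup_right.trans hle4))
    exact g2D ⟨e4 ▸ (le_sup_left.trans hle4) ⟨g2N, g2L⟩, g2N⟩

/-- data for units not stable under the inverting involution -/
structure TypeI (x : G) (M : Subgroup G) (p : ℕ) (Q : Subgroup G) : Prop where
  pp : PP p M Q
  isO : IsO (Subgroup.normalizer (Q : Set G)) M
  pa : PA x (Subgroup.normalizer (Q : Set G)) M
  full : ¬ p ^ ((Nat.card M).factorization p + 1) ∣ Nat.card G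
  elim : ∀ y ∈ Subgroup.normalizer (Q : Set G), ∃ w ∈ M, w⁻¹ * y = 1 ∨ w⁻¹ * y = x ∨ w⁻¹ * y = x⁻¹

lemma typeI [Finite G] {x : G} (h : SC x) (ih : IH.{u} (Nat.card G)) {t : G} (ht : t * x * t⁻¹ = x⁻¹)
    {M : Subgroup G} (hM : MX x M) (hT : ¬ Tin t M) {p : ℕ} (hp : p.Prime) (hpM : p ∣ Nat.card M) :
    ∃ Q, TypeI x M p Q := by
  obtain ⟨Q, hQ⟩ := exists_PP h hM.1 hp
  have xiQ := hQ.xi hM.1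
  set L := Subgroup.normalizer (Q : Set G) with hL
  have hML : M ≤ L := fun m hm => mem_NN.mpr (hQ.tin (fun a ha => M.mul_mem (M.mul_mem hm ha) (M.inv_mem hm)))
  have xL : x ∈ L := mem_NN.mpr xiQ.tin
  have cQ : 1 < Nat.card Q := by
    rw [hQ.card]
    refine Nat.one_lt_pow ?_ hp.one_lt
    exact (hp.factorization_pos_of_dvd Nat.card_pos.ne' hpM).ne'
  have hQ1 : Q ≠ ⊥ := by rintro rfl; simp at cQ
  obtain ⟨O, hO⟩ := exists_O L
  have xiO : XI x O := ⟨fun m hm => hO.stab x xL m hm, hO.fr⟩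
  have hQO : Q ≤ O := hO.le_of_norm xiQ.fr
  have hO1 : O ≠ ⊥ := fun hc => hQ1 (le_bot_iff.mp (hc ▸ hQO))
  obtain hA | hB := local_B h hO xL hO1 ih
  · have hMO : M ≤ O := hA.xi_le h hO xL hML hM.1
    have e : O = M := le_antisymm (hM.2 O xiO hMO) hMO
    subst e
    have el : ∀ y ∈ L, ∃ w ∈ O, w⁻¹ * y = 1 ∨ w⁻¹ * y = x ∨ w⁻¹ * y = x⁻¹ := by
      intro y hy
      obtain ⟨w, hw, e | e⟩ := hA.elim h hO xL hy
      · exact ⟨w, hw, e⟩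
      · exfalso
        apply hT
        refine hM.1.tin_all h e ht ?_
        exact hO.stab _ (L.mul_mem (L.inv_mem (hO.le hw)) hy)
    refine ⟨Q, hQ, hO, hA, ?_, el⟩
    intro hdv
    haveI := Fact.mk hp
    have h1 := Sylow.prime_pow_dvd_card_normalizer hdv hQ.card
    have h3 : Nat.card L ∣ 3 * Nat.card O := by
      have nO : (O.subgroupOf L).Normal := ⟨fun n hn g => hO.stab g g.2 n hn⟩
      have e1 := Subgroup.card_eq_card_quotient_mul_card_subgroup (O.subgroupOf L)
      rw [Nat.card_congr (Subgroup.subgroupOfEquivOfLe hO.le).toEquiv] at e1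
      rw [e1]
      refine Nat.mul_dvd_mul_right ?_ _
      have m1 : ∀ k : L, (QuotientGroup.mk' (O.subgroupOf L)) k = 1 ↔ (k : G) ∈ O := fun l => by
        rw [← MonoidHom.mem_ker, QuotientGroup.ker_mk']; rfl
      have o3 : orderOf ((QuotientGroup.mk' (O.subgroupOf L)) ⟨x, xL⟩) = 3 := by
        refine orderOf_eq_prime (p := 3) (hp := ⟨Nat.prime_three⟩) ?_ ?_
        · rw [← map_pow, m1]; simp [h.cube]
        · rw [Ne, m1]; exact hO.fr.not_mem h
      rw [← o3, ← Nat.card_zpowers]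
      have : Subgroup.zpowers ((QuotientGroup.mk' (O.subgroupOf L)) ⟨x, xL⟩) = ⊤ := by
        rw [eq_top_iff]
        rintro q -
        obtain ⟨y, rfl⟩ := QuotientGroup.mk'_surjective _ q
        obtain ⟨w, hw, e⟩ := el y y.2
        have ew : (QuotientGroup.mk' (O.subgroupOf L)) ⟨w, hO.le hw⟩ = 1 := (m1 _).mpr hw
        have e5 : ∀ z : L, (w⁻¹ * y : G) = z → (QuotientGroup.mk' (O.subgroupOf L)) y = (QuotientGroup.mk' (O.subgroupOf L)) z := by
          intro z hz
          have : y = ⟨w, hO.le hw⟩ * z := Subtype.ext (by simp [← hz])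
          rw [this, map_mul, ew, one_mul]
        rcases e with e | e | e
        · rw [e5 1 e, map_one]; exact Subgroup.one_mem _
        · rw [e5 ⟨x, xL⟩ e]; exact Subgroup.mem_zpowers _
        · rw [e5 ⟨x, xL⟩⁻¹ e, map_inv]; exact Subgroup.inv_mem _ (Subgroup.mem_zpowers _)
      rw [this, Subgroup.card_top]
    have hp3 : Nat.Coprime p 3 := by
      rw [Nat.coprime_primes hp Nat.prime_three]
      rintro rfl
      exact fr_iff.mp hM.1.fr hpM
    have h4 := Nat.Coprime.dvd_of_dvd_mul_left (Nat.Coprime.pow_left _ hp3) (h1.trans h3)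
    exact Nat.pow_succ_factorization_not_dvd Nat.card_pos.ne' hp h4
  · exfalso
    have hOM : O ≤ M := le_sup_right.trans (hM.2 _ (xi_sup xL hO.stab hML hO.fr hM.1) le_sup_left)
    have two_el : ∀ r ∈ O, ∃ k, r ^ (2 ^ k) = 1 := by
      intro r hr
      obtain ⟨a, m, hm, e⟩ := Nat.exists_eq_pow_mul_and_not_dvd (orderOf_pos r).ne' 2 (by norm_num)
      refine ⟨a, hB.two _ (O.pow_mem hr _) m ?_ ?_⟩
      · rw [← Nat.not_even_iff_odd, even_iff_two_dvd]; exact hm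
      · rw [← pow_mul, ← e]; exact pow_orderOf_eq_one _
    have p2 : p = 2 := by
      by_contra hp2
      have hodd : Odd p := hp.odd_of_ne_two hp2
      apply hQ1
      rw [Subgroup.eq_bot_iff_forall]
      intro q hq
      obtain ⟨_, k, hk⟩ := (hQ.mem q).mp hq
      exact hB.two q (hQO hq) _ (hodd.pow) hk
    subst p2
    have eQO : Q = O := le_antisymm hQO (fun r hr => (hQ.mem r).mpr ⟨hOM hr, two_el r hr⟩)
    obtain ⟨Y, xY, hOY, hYL, hYO⟩ := hB.Y
    by_cases hMQ : M ≤ O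
    · exact hYO ((hM.2 Y xY (hMQ.trans hOY)).trans hMQ)
    · obtain ⟨c, hc, hcO⟩ := SetLike.not_le_iff_exists.mp hMQ
      obtain ⟨a, m, hm, e⟩ := Nat.exists_eq_pow_mul_and_not_dvd (orderOf_pos c).ne' 2 (by norm_num)
      have modd : Odd m := by rw [← Nat.not_even_iff_odd, even_iff_two_dvd]; exact hm
      obtain ⟨r, hr, hr1⟩ : ∃ r ∈ O, r ≠ 1 := by
        by_contra! hc
        exact hO1 ((Subgroup.eq_bot_iff_forall O).mpr hc)
      have h1 : (c ^ (2 ^ a)) ^ m = 1 := by rw [← pow_mul, ← e]; exact pow_orderOf_eq_one _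
      have h2 : c ^ (2 ^ a) ∈ O := by
        refine hO.cent h (R := (O : Set G)) subset_rfl hO.stab hr hr1 (L.pow_mem (hML hc) _) ?_
        intro r hr
        obtain ⟨k, hk⟩ := two_el r hr
        exact XI.coprime_comm h hM.1 (M.pow_mem hc _) (hOM hr) h1 hk (Nat.Coprime.pow_right k (Nat.coprime_two_right.mpr modd))
      have h3 := hB.two _ h2 m modd h1
      exact hcO (eQO ▸ (hQ.mem c).mpr ⟨hc, a, h3⟩)

end FT

namespace FT
universe u
variable {G : Type u} [Group G]

/-- conjugate subgroup -/
def cj (t : G) (M : Subgroup G) : Subgroup G := M.map (MulAut.conj t).toMonoidHom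

lemma mem_cj {t g : G} {M : Subgroup G} : g ∈ cj t M ↔ t⁻¹ * g * t ∈ M := by
  constructor
  · rintro ⟨m, hm, rfl⟩
    have : t⁻¹ * (t * m * t⁻¹) * t = m := by group
    simpa [this] using hm
  · intro hm
    refine ⟨_, hm, ?_⟩
    simp [mul_assoc]

lemma cj_mul {a b : G} {M : Subgroup G} : cj (a * b) M = cj a (cj b M) := by
  ext g; simp only [mem_cj, mul_inv_rev]; simp only [mul_assoc]

lemma cj_tin [Finite G] {a : G} {M : Subgroup G} (h : Tin a M) : cj a M = M := by
  ext g
  rw [mem_cj]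
  constructor
  · intro hg
    have := h _ hg
    simpa [mul_assoc] using this
  · intro hg
    have := h.inv _ hg
    simpa using this

lemma tin_of_cj {a : G} {M : Subgroup G} (h : cj a M = M) : Tin a M := by
  intro m hm
  rw [← h, mem_cj]; simpa [mul_assoc] using hm

lemma card_cj {a : G} {M : Subgroup G} : Nat.card (cj a M) = Nat.card M :=
  Subgroup.card_map_of_injective (MulAut.conj a).injective

lemma cj_mono {a : G} {M N : Subgroup G} (h : M ≤ N) : cj a M ≤ cj a N := Subgroup.map_mono h

lemma cj_one {M : Subgroup G} : cj 1 M = M := by ext g; simp [mem_cj]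

lemma XI.cj {x t : G} (h : SC x) (ht : t * x * t⁻¹ = x⁻¹) {M : Subgroup G} (hM : XI x M) : XI x (cj t M) := by
  obtain ⟨r1, r2⟩ := inv_rel ht
  constructor
  · intro m hm
    rw [mem_cj] at *
    have := hM.iinv h hm
    have a1 : t⁻¹ * x = x⁻¹ * t⁻¹ := by
      rw [inv_mul_eq_iff_eq_mul, ← mul_assoc, ← r2]; simp
    have e : t⁻¹ * (x * m * x⁻¹) * t = (t⁻¹ * x) * m * (x⁻¹ * t) := by group
    have e2 : (x⁻¹ * t⁻¹) * m * (t * x) = x⁻¹ * (t⁻¹ * m * t) * x := by group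
    rw [e, a1, r1, e2]; exact this
  · intro m hm h3
    rw [mem_cj] at hm
    have := hM.fr _ hm (by
      have := conj_pow (a := t⁻¹) (b := m) (i := 3)
      rw [inv_inv] at this
      rw [this, h3]; simp)
    have := congrArg (fun z => t * z * t⁻¹) this
    simpa [mul_assoc] using this

lemma cj_inv_cj {t : G} {M : Subgroup G} : cj t⁻¹ (cj t M) = M := by rw [← cj_mul]; simp [cj_one]

lemma cj_cj_inv {t : G} {M : Subgroup G} : cj t (cj t⁻¹ M) = M := by rw [← cj_mul]; simp [cj_one]

lemma MX.cj {x t : G} (h : SC x) (ht : t * x * t⁻¹ = x⁻¹) {M : Subgroup G} (hM : MX x M) : MX x (cj t M) := by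
  refine ⟨hM.1.cj h ht, fun N hN hle => ?_⟩
  have ti : t⁻¹ = t := inv_eq_of_mul_eq_one_left (inv_involution h ht)
  have h1 := hM.2 (FT.cj t⁻¹ N) (by rw [ti]; exact hN.cj h ht) (by
    have := cj_mono (a := t⁻¹) hle
    rwa [cj_inv_cj] at this)
  have := cj_mono (a := t) h1
  rwa [cj_cj_inv] at this

lemma TypeI.fact_eq [Finite G] {x : G} {M Q : Subgroup G} {p : ℕ} (hp : p.Prime) (T : TypeI x M p Q) :
    (Nat.card M).factorization p = (Nat.card G).factorization p := by
  apply le_antisymm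
  · exact (Nat.factorization_le_iff_dvd Nat.card_pos.ne' Nat.card_pos.ne').mpr (Subgroup.card_subgroup_dvd_card M) p
  · by_contra hlt
    push Not at hlt
    exact T.full ((Nat.pow_dvd_pow p hlt).trans (Nat.ordProj_dvd _ _))

lemma typeI_pair [Finite G] {x : G} (h : SC x) {t : G} (ht : t * x * t⁻¹ = x⁻¹)
    {M N Q R : Subgroup G} (hM : MX x M) (hN : MX x N) {p : ℕ} (hp : p.Prime) (TM : TypeI x M p Q) (TN : TypeI x N p R) :
    N = M ∨ N = cj t M := by
  haveI := Fact.mk hp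
  have cQ := TM.pp.card
  have cR := TN.pp.card
  rw [TM.fact_eq hp] at cQ
  rw [TN.fact_eq hp] at cR
  obtain ⟨g, hg⟩ := MulAction.exists_smul_eq G (Sylow.ofCard Q cQ) (Sylow.ofCard R cR)
  have eR : cj g Q = R := by
    have := congrArg (fun S : Sylow p G => (S : Subgroup G)) hg
    exact this
  have xQ := TM.pp.xi hM.1
  have xR := TN.pp.xi hN.1
  have hgx : g * x * g⁻¹ ∈ Subgroup.normalizer (R : Set G) := by
    rw [mem_NN]
    apply tin_of_cj
    rw [cj_mul, cj_mul, ← eR, cj_inv_cj, cj_tin xQ.tin]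
  have NL : N ≤ Subgroup.normalizer (R : Set G) := TN.isO.le
  have xL : x ∈ Subgroup.normalizer (R : Set G) := mem_NN.mpr xR.tin
  have step : ∀ w ∈ N, cj (w⁻¹ * g) Q = R := by
    intro w hw
    rw [cj_mul, eR]
    exact cj_tin (mem_NN.mp (NL (N.inv_mem hw)))
  obtain ⟨w, hw, e⟩ := TN.elim _ hgx
  rcases e with e | e | e
  · exfalso
    rw [inv_mul_eq_one] at e
    have h3 : w ^ 3 = 1 := by rw [e]; exact (h.conj g).cube
    exact (h.conj g).ne_one (e ▸ hN.1.fr w hw h3)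
  · left
    rw [inv_mul_eq_iff_eq_mul] at e
    obtain ⟨v, hv, e2⟩ := lemF h hN.1 hw
    rw [e2, conj_eq_iff, mem_cent] at e
    have e3 := step v hv
    rw [cj_tin (xQ.tin_z h (h.mem_z.mpr e))] at e3
    subst e3
    have h1 : M ≤ N := TN.pa.xi_le h TN.isO xL TM.isO.le hM.1
    exact le_antisymm (hM.2 N hN.1 h1) h1
  · right
    rw [inv_mul_eq_iff_eq_mul] at e
    obtain ⟨v, hv, e2⟩ := lemF h.inv (hN.1.inv' h) hw
    rw [e2] at e
    have e4 : (v⁻¹ * g) * x * (v⁻¹ * g)⁻¹ = x⁻¹ := by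
      have := congrArg (fun z => v⁻¹ * z * v) e
      simpa [mul_assoc] using this
    have e3 := step v hv
    obtain ⟨q, hq, e5⟩ := h.inverter ht e4
    rw [e5, cj_mul, cj_mul, cj_tin (xQ.tin_z h (Subgroup.inv_mem _ hq)), cj_tin ((xQ.cj h ht).tin_z h hq)] at e3
    have h1 : cj t M ≤ N := by
      refine TN.pa.xi_le h TN.isO xL ?_ (hM.1.cj h ht)
      intro m hm
      rw [mem_cj] at hm
      have h2 := mem_NN.mp (TM.isO.le hm)
      rw [mem_NN]
      apply tin_of_cj
      have h3 := cj_tin h2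
      rw [cj_mul, cj_mul, e3] at h3
      have h4 := congrArg (cj t) h3
      rwa [cj_cj_inv, e3] at h4
    exact le_antisymm ((hM.cj h ht).2 N hN.1 h1) h1

lemma XI.card_le [Finite G] {x : G} (h : SC x) {M : Subgroup G} (hM : XI x M) (hM1 : M ≠ ⊥) {a e : ℕ} (D : AD x a e) :
    Nat.card M * (2 * a + 1) ≤ 3 * e * (a * (a + 1)) := by
  haveI := hM.nilp h
  haveI : Nontrivial M := (Subgroup.nontrivial_iff_ne_bot M).mpr hM1
  have := Group.IsNilpotent.center_ne_bot (G := M)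
  obtain ⟨c, hc, hc1⟩ : ∃ c ∈ Subgroup.center M, c ≠ 1 := by
    by_contra! hc
    exact this ((Subgroup.eq_bot_iff_forall _).mpr hc)
  have hle : M ≤ Subgroup.centralizer {(c : G)} := by
    intro m hm
    rw [mem_cent]
    have := (Subgroup.mem_center_iff.mp hc) ⟨m, hm⟩
    exact congrArg (fun z : M => (z : G)) this
  have hc1' : (c : G) ≠ 1 := fun e => hc1 (Subtype.ext e)
  refine le_trans (Nat.mul_le_mul_right _ (Subgroup.card_le_of_le hle)) (D.bd c hc1' ?_)
  intro h3
  exact hc1' (hM.fr c c.2 h3.1)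

lemma tin_not_U [Finite G] {x : G} (h : SC x) {t : G} (ht : t * x * t⁻¹ = x⁻¹) {M : Subgroup G} (hM : XI x M)
    (hT : Tin t M) {u : G} (hu : u ∈ M) : t * u ∉ U x := by
  intro hU
  have h3 := hU.1.1
  obtain ⟨r1, r2⟩ := inv_rel ht
  have hy : (x * t) * x * (x * t)⁻¹ = x⁻¹ := by
    have : (x * t) * x * (x * t)⁻¹ = x * (t * x * t⁻¹) * x⁻¹ := by group
    rw [this, ht]; simp
  have hyT : Tin (x * t) M := hM.tin.mul hT
  have y2 := inv_involution h hy
  rw [← mul_assoc] at h3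
  generalize x * t = y at *
  apply hM.inverter_not_mem h hy
  have e : (y * u) ^ 3 = ((y * u * y⁻¹) * (y * y) * u * (y * u * y⁻¹)) * y := by
    simp [pow_succ, mul_assoc]
  rw [e, y2, mul_one] at h3
  have e2 := eq_inv_of_mul_eq_one_right h3
  rw [e2]
  exact M.inv_mem (M.mul_mem (M.mul_mem (hyT u hu) hu) (hyT u hu))

lemma card_sq [Finite G] {x : G} (h : SC x) {t : G} (ht : t * x * t⁻¹ = x⁻¹) {M : Subgroup G} (hM : XI x M)
    (hT : Tin t M) : Nat.card M = Nat.card (M ⊓ Subgroup.centralizer {t} : Subgroup G) ^ 2 := by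
  obtain ⟨r1, r2⟩ := inv_rel ht
  have t2 := inv_involution h ht
  have tinv : t⁻¹ = t := inv_eq_of_mul_eq_one_left t2
  set C := M ⊓ Subgroup.centralizer {t} with hC
  have memC : ∀ z, z ∈ C ↔ z ∈ M ∧ z * t = t * z := fun z => by rw [hC, Subgroup.mem_inf, mem_cent]
  apply le_antisymm
  · let I : Set G := {i | ∃ u ∈ M, i = u * t * u⁻¹}
    have h1 : Nat.card M ≤ Nat.card I * Nat.card C := by
      rw [← Nat.card_prod]
      have ch : ∀ i : I, ∃ u ∈ M, (i : G) = u * t * u⁻¹ := fun i => i.2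
      choose σ hσ eσ using ch
      let f : M → I := fun u => ⟨u * t * (u : G)⁻¹, u, u.2, rfl⟩
      have hf : ∀ u : M, (σ (f u))⁻¹ * u ∈ C := by
        intro u
        have := eσ (f u)
        refine (memC _).mpr ⟨M.mul_mem (M.inv_mem (hσ _)) u.2, ?_⟩
        rw [← mem_cent, ← conj_eq_iff]; exact this
      refine Nat.card_le_card_of_injective (fun u : M => (f u, (⟨(σ (f u))⁻¹ * u, hf u⟩ : C))) ?_
      intro u v huv
      simp only [Prod.mk.injEq, Subtype.mk.injEq] at huv
      rw [huv.1] at huv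
      exact Subtype.ext (mul_left_cancel huv.2)
    have h2 : Nat.card I * Nat.card I ≤ Nat.card M := by
      rw [← Nat.card_prod]
      have hm : ∀ p : I × I, x⁻¹ * ((p.1 : G) * (x * p.2 * x⁻¹)) ∈ M := by
        rintro ⟨⟨_, u, hu, rfl⟩, ⟨_, v, hv, rfl⟩⟩
        have tv := hT _ hv
        have tui := hT _ (M.inv_mem hu)
        have e : x⁻¹ * (u * t * u⁻¹ * (x * (v * t * v⁻¹) * x⁻¹)) =
            (x⁻¹ * u * x) * (x⁻¹ * (t * u⁻¹ * t⁻¹) * x) * (x⁻¹ * (t * (x * v * x⁻¹) * t⁻¹) * x) * ((x⁻¹ * t * x * t) * v⁻¹ * x⁻¹) := by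
          simp [mul_assoc]
        have e2 : x⁻¹ * t * x * t = x := by
          have : x⁻¹ * t * x * t = t * (x * x) * t := by rw [r1, mul_assoc t x x]
          rw [this, h.sq, ← r2, mul_assoc, t2, mul_one]
        rw [e, e2]
        refine M.mul_mem (M.mul_mem (M.mul_mem (hM.iinv h hu) (hM.iinv h tui)) (hM.iinv h (hT _ (hM.inv _ hv)))) (hM.inv _ (M.inv_mem hv))
      refine Nat.card_le_card_of_injective (fun p : I × I => (⟨_, hm p⟩ : M)) ?_
      rintro ⟨⟨a, ha⟩, ⟨b, hb⟩⟩ ⟨⟨a', ha'⟩, ⟨b', hb'⟩⟩ hab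
      simp only [Subtype.mk.injEq] at hab
      have hz := mul_left_cancel hab
      have Isq : ∀ i ∈ I, i * i = 1 := by
        rintro _ ⟨u, hu, rfl⟩
        have : u * t * u⁻¹ * (u * t * u⁻¹) = u * (t * t) * u⁻¹ := by group
        rw [this, t2]; simp
      have inv_z : ∀ c ∈ I, ∀ d ∈ I, c * (c * (x * d * x⁻¹)) * c⁻¹ = (c * (x * d * x⁻¹))⁻¹ := by
        intro c hc d hd
        have c2 := Isq c hc
        have d2 : x * d * x⁻¹ * (x * d * x⁻¹) = 1 := by
          have : x * d * x⁻¹ * (x * d * x⁻¹) = x * (d * d) * x⁻¹ := by group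
          rw [this, Isq d hd]; simp
        rw [← mul_assoc c c, c2, one_mul, mul_inv_rev, inv_eq_of_mul_eq_one_left d2]
      have i1 := inv_z a ha b hb
      have i2 := inv_z a' ha' b' hb'
      rw [← hz] at i2
      have mz := hM.inv _ (hm (⟨a, ha⟩, ⟨b, hb⟩))
      simp only at mz
      generalize hzz : a * (x * b * x⁻¹) = z at *
      have ez : (x * (x⁻¹ * z) * x⁻¹) * x = z := by simp [mul_assoc]
      obtain ⟨sz, xz⟩ := hM.smul h mz
      rw [ez] at sz xz
      have IM : ∀ i ∈ I, i * t⁻¹ ∈ M := by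
        rintro _ ⟨u, hu, rfl⟩
        have : u * t * u⁻¹ * t⁻¹ = u * (t * u⁻¹ * t⁻¹) := by group
        rw [this]; exact M.mul_mem hu (hT _ (M.inv_mem hu))
      have mm : a'⁻¹ * a ∈ M := by
        have h1 := hT.inv _ (M.mul_mem (M.inv_mem (IM a' ha')) (IM a ha))
        have : t⁻¹ * ((a' * t⁻¹)⁻¹ * (a * t⁻¹)) * t⁻¹⁻¹ = a'⁻¹ * a := by group
        rwa [this] at h1
      have cc : (a'⁻¹ * a) * z = z * (a'⁻¹ * a) := by
        have e1 : a * z * a⁻¹ = a' * z * a'⁻¹ := i1.trans i2.symm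
        have := congrArg (fun w => a'⁻¹ * w * a) e1
        simpa [mul_assoc] using this
      have e1 : a'⁻¹ * a = 1 := hM.fr _ mm (sz.cent_cube cc)
      rw [inv_mul_eq_one] at e1
      subst e1
      have e2 : b = b' := by
        have := hzz.trans hz
        simpa using this
      subst e2
      rfl
    have p1 : 0 < Nat.card M := Nat.card_pos
    generalize Nat.card M = n at *
    generalize Nat.card C = s at *
    generalize Nat.card I = i at *
    by_contra hlt
    push Not at hlt
    have h3 : n * n ≤ (i * s) * (i * s) := Nat.mul_le_mul h1 h1
    have h4 : (i * i) * (s * s) ≤ n * s ^ 2 := by rw [pow_two]; exact Nat.mul_le_mul_right _ h2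
    nlinarith
  · rw [pow_two, ← Nat.card_prod]
    refine Nat.card_le_card_of_injective (fun p : C × C => (⟨p.1 * (x * p.2 * x⁻¹), M.mul_mem ((memC _).mp p.1.2).1 (hM.inv _ ((memC _).mp p.2.2).1)⟩ : M)) ?_
    rintro ⟨⟨a, ha⟩, ⟨b, hb⟩⟩ ⟨⟨a', ha'⟩, ⟨b', hb'⟩⟩ hab
    simp only [Subtype.mk.injEq] at hab
    have e1 : a'⁻¹ * a = x * (b' * b⁻¹) * x⁻¹ := by
      have := congrArg (fun z => a'⁻¹ * z * (x * b⁻¹ * x⁻¹)) hab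
      simpa [mul_assoc] using this
    have m1 : a'⁻¹ * a ∈ C := C.mul_mem (C.inv_mem ha') ha
    have m2 : b' * b⁻¹ ∈ C := C.mul_mem hb' (C.inv_mem hb)
    have m3 : a'⁻¹ * a = 1 := by
      have c1 := ((memC _).mp m1).2
      have c2 := ((memC _).mp m2).2
      have mM := ((memC _).mp m1).1
      generalize b' * b⁻¹ = z at *
      generalize a'⁻¹ * a = y at *
      have k1 : Commute y t := c1
      have k2 : Commute y (x * t * x⁻¹) := by
        rw [e1]
        have : Commute z t := c2
        exact (Commute.conj_iff x).mpr this
      have e3 : x * t * x⁻¹ = x⁻¹ * t := by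
        rw [mul_assoc, ← r2, ← mul_assoc, h.sq]
      rw [e3] at k2
      have k3 : Commute y x⁻¹ := by
        have := k2.mul_right k1.inv_right
        simpa using this
      have k4 : Commute y x := by simpa using k3.inv_right
      exact hM.fr _ mM (h.cent_cube k4)
    rw [m3] at e1
    rw [inv_mul_eq_one] at m3
    have e2 : b' * b⁻¹ = 1 := by
      have := congrArg (fun z => x⁻¹ * z * x) e1
      simpa [mul_assoc] using this.symm
    rw [mul_inv_eq_one] at e2
    simp [m3, e2]

end FT

namespace FT

lemma sum_le_prod (s : Finset ℕ) (h : ∀ n ∈ s, 2 ≤ n) (hne : s.Nonempty) : ∑ n ∈ s, n ≤ ∏ n ∈ s, n := by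
  induction hne using Finset.Nonempty.cons_induction with
  | singleton a => simp
  | cons a s ha hs ih =>
    rw [Finset.sum_cons, Finset.prod_cons]
    have h1 := ih (fun n hn => h n (Finset.mem_cons_of_mem hn))
    have h2 := h a (Finset.mem_cons_self a s)
    have h3 : 2 ≤ ∏ n ∈ s, n := by
      obtain ⟨b, hb⟩ := hs
      have := Finset.single_le_sum (f := fun n : ℕ => n) (fun _ _ => Nat.zero_le _) hb
      have := h b (Finset.mem_cons_of_mem hb)
      omega
    nlinarith

lemma sum_le_of_prod {s : Finset ℕ} (h : ∀ n ∈ s, 2 ≤ n) {K : ℕ} (hp : ∏ n ∈ s, n ≤ K) : ∑ n ∈ s, n ≤ K := by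
  rcases s.eq_empty_or_nonempty with rfl | hne
  · simp
  · exact (sum_le_prod s h hne).trans hp

lemma bins (s : Finset ℕ) {K : ℕ} (hK : 1 ≤ K) (h : ∀ n ∈ s, 2 ≤ n) (h' : ∀ n ∈ s, n ≤ K) (hp : ∏ n ∈ s, n ≤ K ^ 2) :
    ∑ n ∈ s, n ≤ 3 * K := by
  obtain ⟨T, hT⟩ := Set.Finite.exists_maximal (Set.toFinite {T : Finset ℕ | T ∈ s.powerset ∧ ∏ n ∈ T, n ≤ K})
    ⟨∅, by simp, by simpa using hK⟩
  obtain ⟨hTs, hTK⟩ := hT.prop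
  rw [Finset.mem_powerset] at hTs
  have s1 := sum_le_of_prod (fun n hn => h n (hTs hn)) hTK
  rcases (s \ T).eq_empty_or_nonempty with he | ⟨n, hn⟩
  · have : s = T := Finset.Subset.antisymm (Finset.sdiff_eq_empty_iff_subset.mp he) hTs
    rw [this]; omega
  · rw [Finset.mem_sdiff] at hn
    have h1 : K < n * ∏ n ∈ T, n := by
      by_contra hc
      push Not at hc
      have : (insert n T) ≤ T := hT.le_of_ge ⟨by
        rw [Finset.mem_powerset]; exact Finset.insert_subset hn.1 hTs, by
        rw [Finset.prod_insert hn.2]; exact hc⟩ (Finset.subset_insert n T)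
      exact hn.2 (this (Finset.mem_insert_self n T))
    have hnR : n ∈ s \ T := Finset.mem_sdiff.mpr hn
    have e1 := Finset.sum_sdiff (f := fun n : ℕ => n) hTs
    have e2 := Finset.prod_sdiff (f := fun n : ℕ => n) hTs
    rw [← Finset.add_sum_erase _ _ hnR] at e1
    rw [← Finset.mul_prod_erase _ _ hnR] at e2
    have h2 : ∏ m ∈ (s \ T).erase n, m ≤ K := by
      by_contra hc
      push Not at hc
      have : K ^ 2 < ∏ n ∈ s, n := by
        rw [← e2]
        nlinarith
      omega
    have s2 := sum_le_of_prod (fun m hm => h m (Finset.mem_sdiff.mp (Finset.mem_of_mem_erase hm)).1) h2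
    have := h' n hn.1
    omega

/-- sum over admissible Hall divisors -/
def hallSum (g N : ℕ) : ℕ := ∑ n ∈ (Finset.range (N + 1)).filter (fun n => n % 3 = 1 ∧ n ∣ g ∧ Nat.Coprime n (g / n)), (n - 1)

/-- upper bound used below -/
def bnd (a e : ℕ) : ℕ := 3 * e * (a * (a + 1)) / (2 * a + 1)

/-- hypothesis of the finite check -/
def hyp1 (a e : ℕ) : Prop := 4 ≤ a ∧ a % 3 = 1 ∧ e % 3 ≠ 0 ∧ (2 * a + 1) * e < 110

/-- hypothesis of the finite check -/
def hyp2 (a e S : ℕ) : Prop := S = 1 ∨ (6 * S ^ 2 ∣ 3 * (a * (a + 1)) * e ^ 2 ∧ S ^ 2 ≤ bnd a e)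

/-- hypothesis of the finite check -/
def hyp3 (a e S : ℕ) : Prop := (a ^ 2 + a + 1) * e ^ 2 / 3 ≤ 1 + 2 * hallSum (3 * (a * (a + 1)) * e ^ 2) (bnd a e) +
      (if S = 1 then 0 else (S + 1) * ((bnd a e - 2) / 2))

instance (a e : ℕ) : Decidable (hyp1 a e) := by unfold hyp1; infer_instance
instance (a e S : ℕ) : Decidable (hyp2 a e S) := by unfold hyp2; infer_instance
instance (a e S : ℕ) : Decidable (hyp3 a e S) := by unfold hyp3; infer_instance

lemma fin_check : ∀ a : Fin 55, ∀ e : Fin 13, hyp1 a e → ∀ S : Fin 10, hyp2 a e S → hyp3 a e S →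
    ((a : ℕ) = 4 ∧ (e : ℕ) = 1) ∨ ((a : ℕ) = 7 ∧ (e : ℕ) = 1) := by
  decide +kernel

end FT

namespace FT

lemma bnd_spec (a e : ℕ) : bnd a e * (2 * a + 1) ≤ 3 * e * (a * (a + 1)) := Nat.div_mul_le_self _ _

lemma le_bnd {a e n : ℕ} (h : n * (2 * a + 1) ≤ 3 * e * (a * (a + 1))) : n ≤ bnd a e :=
  (Nat.le_div_iff_mul_le (by positivity)).mpr h

lemma bnd_le (a e : ℕ) : 4 * bnd a e ≤ 3 * ((2 * a + 1) * e) := by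
  have h := bnd_spec a e
  have h1 : 4 * bnd a e * (2 * a + 1) ≤ 3 * ((2 * a + 1) * e) * (2 * a + 1) := by
    have : 3 * ((2 * a + 1) * e) * (2 * a + 1) = 4 * (3 * e * (a * (a + 1))) + 3 * e := by ring
    rw [this]; nlinarith
  exact Nat.le_of_mul_le_mul_right h1 (by positivity)

lemma lt_bnd (a e : ℕ) (ha : 1 ≤ a) : a * (a + 1) * e ^ 2 ≤ (bnd a e + 1) ^ 2 := by
  have h : 3 * e * (a * (a + 1)) < (bnd a e + 1) * (2 * a + 1) := by
    have := Nat.lt_div_mul_add (a := 3 * e * (a * (a + 1))) (b := 2 * a + 1) (by positivity)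
    unfold bnd
    linarith
  generalize bnd a e + 1 = K at *
  have h1 : (3 * e * (a * (a + 1))) ^ 2 ≤ (K * (2 * a + 1)) ^ 2 := Nat.pow_le_pow_left h.le 2
  have h2 : (a * (a + 1) * e ^ 2) * (2 * a + 1) ^ 2 ≤ (3 * e * (a * (a + 1))) ^ 2 := by
    have e1 : (3 * e * (a * (a + 1))) ^ 2 = (a * (a + 1) * e ^ 2) * (9 * (a * (a + 1))) := by ring
    rw [e1]
    apply Nat.mul_le_mul_left
    nlinarith
  rw [mul_pow K] at h1
  exact Nat.le_of_mul_le_mul_right (h2.trans h1) (by positivity)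

lemma numer {a e u : ℕ} (a4 : 4 ≤ a) (amod : a % 3 = 1) (emod : e % 3 ≠ 0) (cU : 3 * u = (a ^ 2 + a + 1) * e ^ 2)
    (s : Finset ℕ) (hs : ∀ n ∈ s, 4 ≤ n ∧ n ≤ bnd a e ∧ n % 3 = 1 ∧ n ∣ 3 * (a * (a + 1)) * e ^ 2 ∧
      Nat.Coprime n (3 * (a * (a + 1)) * e ^ 2 / n)) (cop : (s : Set ℕ).Pairwise (fun m n => Nat.Coprime m n))
    (S σ T : ℕ) (hS : (S = 1 ∧ T = 0) ∨ (2 ≤ S ∧ 6 * S ^ 2 ∣ 3 * (a * (a + 1)) * e ^ 2 ∧ S ^ 2 ≤ bnd a e ∧ T ≤ (S + 1) * σ ∧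
      2 * σ + 2 ≤ bnd a e)) (hu : u ≤ 1 + 2 * ∑ n ∈ s, (n - 1) + T) : (a = 4 ∧ e = 1) ∨ (a = 7 ∧ e = 1) := by
  have hb := bnd_le a e
  have e1 : 1 ≤ e := by
    rcases Nat.eq_zero_or_pos e with rfl | h
    · simp at emod
    · exact h
  by_cases hB : (2 * a + 1) * e < 110
  · have ha : a < 55 := by nlinarith
    have he : e < 13 := by nlinarith
    have hS10 : S < 10 := by
      rcases hS with ⟨rfl, _⟩ | ⟨_, _, h, _⟩
      · norm_num
      · by_contra hc
        push Not at hc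
        nlinarith
    refine fin_check ⟨a, ha⟩ ⟨e, he⟩ ⟨a4, amod, emod, hB⟩ ⟨S, hS10⟩ ?_ ?_
    · rcases hS with ⟨h, _⟩ | ⟨_, h1, h2, _⟩
      · exact Or.inl h
      · exact Or.inr ⟨h1, h2⟩
    · unfold hyp3
      simp only
      rw [← cU, Nat.mul_div_cancel_left _ (by norm_num)]
      have h1 : ∑ n ∈ s, (n - 1) ≤ hallSum (3 * (a * (a + 1)) * e ^ 2) (bnd a e) := by
        unfold hallSum
        apply Finset.sum_le_sum_of_subset
        intro n hn
        obtain ⟨_, h2, h3, h4, h5⟩ := hs n hn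
        rw [Finset.mem_filter, Finset.mem_range]
        exact ⟨by omega, h3, h4, h5⟩
      have h2 : T ≤ if S = 1 then 0 else (S + 1) * ((bnd a e - 2) / 2) := by
        rcases hS with ⟨h, h'⟩ | ⟨h0, h1, h2, h3, h4⟩
        · rw [if_pos h, h']
        · rw [if_neg (by omega)]
          refine h3.trans (Nat.mul_le_mul_left _ ?_)
          omega
      omega
  · exfalso
    push Not at hB
    have h1 : ∑ n ∈ s, n ≤ 3 * (bnd a e + 1) := by
      refine bins s (by omega) (fun n hn => by have := (hs n hn).1; omega) (fun n hn => by have := (hs n hn).2.1; omega) ?_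
      refine le_trans ?_ (lt_bnd a e (by omega))
      have : ∏ n ∈ s, n ∣ a * (a + 1) * e ^ 2 := by
        apply Finset.prod_dvd_of_isRelPrime
        · intro m hm n hn hmn
          exact Nat.coprime_iff_isRelPrime.mp (cop hm hn hmn)
        · intro n hn
          obtain ⟨_, h2, h3, h4, h5⟩ := hs n hn
          have c3 : Nat.Coprime n 3 := by
            rw [Nat.coprime_comm, Nat.Prime.coprime_iff_not_dvd Nat.prime_three]; omega
          rw [mul_assoc] at h4
          exact c3.dvd_of_dvd_mul_left h4
      exact Nat.le_of_dvd (by positivity) this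
    have h2 : ∑ n ∈ s, (n - 1) ≤ ∑ n ∈ s, n := Finset.sum_le_sum (fun n _ => Nat.sub_le n 1)
    have h3 : 36 * T ≤ (bnd a e + 99) * bnd a e := by
      rcases hS with ⟨_, rfl⟩ | ⟨h0, h1, h2, h3, h4⟩
      · simp
      · have k1 : 18 * S ≤ S ^ 2 + 81 := by
          zify; nlinarith [sq_nonneg ((S : ℤ) - 9)]
        have k2 : 2 * T ≤ (S + 1) * bnd a e := by nlinarith
        nlinarith
    have h4 : 3 * ((2 * a + 1) * e) ^ 2 ≤ 36 * u := by
      have : 36 * u = 12 * (3 * u) := by ring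
      rw [this, cU]; nlinarith
    generalize bnd a e = N at *
    generalize (2 * a + 1) * e = B at *
    nlinarith

end FT

namespace FT
universe u
variable {G : Type u} [Group G]

lemma MX.ne_bot [Finite G] {x : G} (h : SC x) {a e : ℕ} (D : AD x a e) {M : Subgroup G} (hM : MX x M) : M ≠ ⊥ := by
  rintro rfl
  obtain ⟨s, hs, h1, _⟩ := D.inv
  have := hM.2 _ (U_xi h hs) bot_le (Subgroup.subset_closure (by simp) : s ∈ _)
  exact h1 (Subgroup.mem_bot.mp this)

lemma XI.facts [Finite G] {x : G} (h : SC x) {a e : ℕ} (D : AD x a e) {M : Subgroup G} (hM : XI x M) (hb : M ≠ ⊥) :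
    4 ≤ Nat.card M ∧ Nat.card M ≤ bnd a e ∧ Nat.card M % 3 = 1 := by
  have h1 := hM.card_mod h
  have h2 := (Subgroup.one_lt_card_iff_ne_bot M).mpr hb
  exact ⟨by omega, le_bnd (hM.card_le h hb D), h1⟩

lemma MX.hall [Finite G] {x : G} (h : SC x) (ih : IH.{u} (Nat.card G)) {t : G} (ht : t * x * t⁻¹ = x⁻¹)
    {M : Subgroup G} (hM : MX x M) (hT : ¬ Tin t M) : Nat.Coprime (Nat.card M) (Nat.card G / Nat.card M) := by
  apply Nat.coprime_of_dvd
  intro p hp h1 h2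
  obtain ⟨Q, T⟩ := typeI h ih ht hM hT hp h1
  apply T.full
  have := Nat.mul_dvd_mul (Nat.ordProj_dvd (Nat.card M) p) h2
  rw [Nat.mul_div_cancel' (Subgroup.card_subgroup_dvd_card M)] at this
  rwa [pow_succ]

lemma MX.share [Finite G] {x : G} (h : SC x) (ih : IH.{u} (Nat.card G)) {t : G} (ht : t * x * t⁻¹ = x⁻¹)
    {M N : Subgroup G} (hM : MX x M) (hT : ¬ Tin t M) (hN : MX x N) (hT' : ¬ Tin t N)
    (hc : ¬ Nat.Coprime (Nat.card M) (Nat.card N)) : N = M ∨ N = FT.cj t M := by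
  obtain ⟨p, hp, h1, h2⟩ := Nat.Prime.not_coprime_iff_dvd.mp hc
  obtain ⟨Q, T⟩ := typeI h ih ht hM hT hp h1
  obtain ⟨R, T'⟩ := typeI h ih ht hN hT' hp h2
  exact typeI_pair h ht hM hN hp T T'

open Classical in
/-- nonidentity elements -/
noncomputable def fs [Fintype G] (M : Subgroup G) : Finset G := Finset.univ.filter (fun g => g ∈ M ∧ g ≠ 1)

lemma mem_fs [Fintype G] {M : Subgroup G} {g : G} : g ∈ fs M ↔ g ∈ M ∧ g ≠ 1 := by
  classical
  simp [fs]

lemma card_fs [Fintype G] (M : Subgroup G) : (fs M).card + 1 = Nat.card M := by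
  classical
  have h1 : insert 1 (fs M) = (Finset.univ.filter (fun g => g ∈ M)) := by
    ext g
    rw [Finset.mem_insert, mem_fs, Finset.mem_filter]
    constructor
    · rintro (rfl | hh)
      · exact ⟨Finset.mem_univ _, M.one_mem⟩
      · exact ⟨Finset.mem_univ _, hh.1⟩
    · rintro ⟨_, hh⟩
      by_cases hg : g = 1
      · exact Or.inl hg
      · exact Or.inr ⟨hh, hg⟩
  have h2 : (1 : G) ∉ fs M := fun hh => (mem_fs.mp hh).2 rfl
  rw [← Finset.card_insert_of_notMem h2, h1, Nat.card_eq_fintype_card]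
  exact (Fintype.card_of_subtype _ (by intro g; simp)).symm

/-- the collected counting data -/
lemma pack [Finite G] {x : G} (h : SC x) (ih : IH.{u} (Nat.card G)) {t : G} (ht : t * x * t⁻¹ = x⁻¹) {a e : ℕ} (D : AD x a e) :
    ∃ (s : Finset ℕ) (S σ T : ℕ), (∀ n ∈ s, 4 ≤ n ∧ n ≤ bnd a e ∧ n % 3 = 1 ∧ n ∣ 3 * (a * (a + 1)) * e ^ 2 ∧
      Nat.Coprime n (3 * (a * (a + 1)) * e ^ 2 / n)) ∧ ((s : Set ℕ).Pairwise (fun m n => Nat.Coprime m n)) ∧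
      ((S = 1 ∧ T = 0) ∨ (2 ≤ S ∧ 6 * S ^ 2 ∣ 3 * (a * (a + 1)) * e ^ 2 ∧ S ^ 2 ≤ bnd a e ∧ T ≤ (S + 1) * σ ∧
      2 * σ + 2 ≤ bnd a e)) ∧ (Nat.card (U x) ≤ 1 + 2 * ∑ n ∈ s, (n - 1) + T) ∧
      (∀ n ∈ s, ∃ M, MX x M ∧ ¬ Tin t M ∧ Nat.card M = n) := by
  classical
  haveI := Fintype.ofFinite G
  haveI : Fintype (Subgroup G) := Fintype.ofFinite _
  let A : Finset (Subgroup G) := Finset.univ.filter (fun M => MX x M ∧ ¬ Tin t M)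
  let B : Finset (Subgroup G) := Finset.univ.filter (fun M => MX x M ∧ Tin t M)
  have mA : ∀ M, M ∈ A ↔ MX x M ∧ ¬ Tin t M := fun M => by simp [A]
  have mB : ∀ M, M ∈ B ↔ MX x M ∧ Tin t M := fun M => by simp [B]
  let c : Subgroup G → ℕ := fun M => Nat.card (M ⊓ Subgroup.centralizer {t} : Subgroup G)
  have cG := D.card
  have fact : ∀ M, MX x M → 4 ≤ Nat.card M ∧ Nat.card M ≤ bnd a e ∧ Nat.card M % 3 = 1 := fun M hM =>
    hM.1.facts h D (hM.ne_bot h D)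
  have csq : ∀ M ∈ B, Nat.card M = c M ^ 2 := fun M hM => card_sq h ht ((mB M).mp hM).1.1 ((mB M).mp hM).2
  have hU : Nat.card (U x) ≤ 1 + ∑ M ∈ A, (Nat.card M - 1) + ∑ M ∈ B, (Nat.card M - 1) := by
    have h1 : (Finset.univ.filter (fun g => g ∈ U x)) ⊆ insert 1 (A.biUnion fs ∪ B.biUnion fs) := by
      intro u hu
      have hu := (Finset.mem_filter.mp hu).2
      by_cases hu1 : u = 1
      · simp [hu1]
      obtain ⟨M, hM, hle⟩ := exists_MX (U_xi h hu)
      have huM : u ∈ fs M := mem_fs.mpr ⟨hle (Subgroup.subset_closure (by simp)), hu1⟩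
      refine Finset.mem_insert_of_mem (Finset.mem_union.mpr ?_)
      by_cases hT : Tin t M
      · exact Or.inr (Finset.mem_biUnion.mpr ⟨M, (mB M).mpr ⟨hM, hT⟩, huM⟩)
      · exact Or.inl (Finset.mem_biUnion.mpr ⟨M, (mA M).mpr ⟨hM, hT⟩, huM⟩)
    have h2 := Finset.card_le_card h1
    have h3 : Nat.card (U x) = (Finset.univ.filter (fun g => g ∈ U x)).card := by
      rw [Nat.card_eq_fintype_card]
      exact (Fintype.card_of_subtype _ (by intro g; simp))
    have h4 := Finset.card_insert_le (1 : G) (A.biUnion fs ∪ B.biUnion fs)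
    have h5 := Finset.card_union_le (A.biUnion fs) (B.biUnion fs)
    have h6 : (A.biUnion fs).card ≤ ∑ M ∈ A, (fs M).card := Finset.card_biUnion_le
    have h7 : (B.biUnion fs).card ≤ ∑ M ∈ B, (fs M).card := Finset.card_biUnion_le
    have h8 : ∀ M : Subgroup G, (fs M).card = Nat.card M - 1 := fun M => by rw [← card_fs M]; rfl
    simp only [h8] at h6 h7
    omega
  have hA : ∑ M ∈ A, (Nat.card M - 1) ≤ 2 * ∑ n ∈ A.image (fun M : Subgroup G => Nat.card M), (n - 1) := by
    rw [Finset.sum_comp (fun n => n - 1) (fun M : Subgroup G => Nat.card M), Finset.mul_sum]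
    apply Finset.sum_le_sum
    intro n hn
    rw [smul_eq_mul]
    apply Nat.mul_le_mul_right
    obtain ⟨M, hM, rfl⟩ := Finset.mem_image.mp hn
    have : A.filter (fun N : Subgroup G => Nat.card N = Nat.card M) ⊆ {M, cj t M} := by
      intro N hN
      obtain ⟨hN, hc⟩ := Finset.mem_filter.mp hN
      rw [mA] at hM hN
      have := MX.share h ih ht hM.1 hM.2 hN.1 hN.2 (by
        rw [hc, Nat.coprime_self]; have := fact M hM.1; omega)
      simpa using this
    exact (Finset.card_le_card this).trans Finset.card_le_two
  have hC : Nat.card (Subgroup.centralizer {t}) ≤ bnd a e := le_bnd (D.bd t (inv_ne_one h ht) (inv_not_T3 h ht))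
  refine ⟨A.image (fun M : Subgroup G => Nat.card M), if B = ∅ then 1 else B.sup c, ∑ M ∈ B, (c M - 1), ∑ M ∈ B, (Nat.card M - 1), ?_, ?_, ?_, ?_, ?_⟩
  · intro n hn
    obtain ⟨M, hM, rfl⟩ := Finset.mem_image.mp hn
    rw [mA] at hM
    obtain ⟨f1, f2, f3⟩ := fact M hM.1
    refine ⟨f1, f2, f3, ?_, ?_⟩
    · rw [← cG]; exact Subgroup.card_subgroup_dvd_card M
    · rw [← cG]; exact hM.1.hall h ih ht hM.2
  · intro m hm n hn hmn
    obtain ⟨M, hM, rfl⟩ := Finset.mem_image.mp (Finset.mem_coe.mp hm)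
    obtain ⟨N, hN, rfl⟩ := Finset.mem_image.mp (Finset.mem_coe.mp hn)
    rw [mA] at hM hN
    by_contra hc
    apply hmn
    rcases MX.share h ih ht hM.1 hM.2 hN.1 hN.2 hc with rfl | rfl
    · rfl
    · exact card_cj.symm
  · by_cases hB : B = ∅
    · left; rw [if_pos hB]; exact ⟨rfl, by rw [hB]; simp⟩
    · right
      rw [if_neg hB]
      have hne := Finset.nonempty_iff_ne_empty.mpr hB
      obtain ⟨M0, hM0, e0⟩ := Finset.exists_mem_eq_sup B hne c
      have hM0' := (mB M0).mp hM0
      have f0 := fact M0 hM0'.1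
      rw [csq M0 hM0] at f0
      refine ⟨?_, ?_, ?_, ?_, ?_⟩
      · rw [e0]; by_contra hlt
        have : c M0 ≤ 1 := by omega
        nlinarith
      · rw [e0, ← csq M0 hM0, ← cG]
        have := six_dvd h hM0'.1.1 le_top (Subgroup.mem_top x) (Subgroup.mem_top t) ht hM0'.2
        rwa [Subgroup.card_top] at this
      · rw [e0]; exact f0.2.1
      · rw [Finset.mul_sum]
        apply Finset.sum_le_sum
        intro M hM
        rw [csq M hM]
        have h1 : c M ≤ B.sup c := Finset.le_sup hM
        have h2 : c M ^ 2 - 1 = (c M + 1) * (c M - 1) := by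
          have := Nat.sq_sub_sq (c M) 1
          simpa using this
        rw [h2]
        exact Nat.mul_le_mul_right _ (by omega)
      · refine le_trans ?_ hC
        let Z : Subgroup G := Subgroup.centralizer {t}
        let E : Finset G := insert 1 (B.biUnion (fun M => fs (M ⊓ Z)))
        have mE : ∀ g ∈ E, ∃ M ∈ B, g ∈ M ⊓ Z := by
          intro g hg
          rcases Finset.mem_insert.mp hg with rfl | hg
          · exact ⟨M0, hM0, Subgroup.one_mem _⟩
          · obtain ⟨M, hM, hg⟩ := Finset.mem_biUnion.mp hg
            exact ⟨M, hM, (mem_fs.mp hg).1⟩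
        have cE : E.card = ∑ M ∈ B, (c M - 1) + 1 := by
          rw [Finset.card_insert_of_notMem, Finset.card_biUnion]
          · congr 1
            apply Finset.sum_congr rfl
            intro M _
            have := card_fs (M ⊓ Z)
            change _ = Nat.card (M ⊓ Z : Subgroup G) - 1
            omega
          · intro M hM N hN hMN
            change Disjoint (fs (M ⊓ Z)) (fs (N ⊓ Z))
            rw [Finset.disjoint_left]
            intro g hg hg'
            rw [mem_fs] at hg hg'
            rw [Finset.mem_coe, mB] at hM hN
            apply hMN
            refine (tii_TI h ih ht hM.1 hM.2 hN.1 ?_).symm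
            intro hb
            have : g ∈ M ⊓ N := ⟨hg.1.1, hg'.1.1⟩
            rw [hb] at this
            exact hg.2 (Subgroup.mem_bot.mp this)
          · intro hh
            obtain ⟨M, hM, hg⟩ := Finset.mem_biUnion.mp hh
            exact (mem_fs.mp hg).2 rfl
        have dj : Disjoint E (E.image (fun g => t * g)) := by
          rw [Finset.disjoint_left]
          intro g hg hg'
          obtain ⟨k, hk, rfl⟩ := Finset.mem_image.mp hg'
          obtain ⟨M, hM, hgM⟩ := mE _ hg
          obtain ⟨N, hN, hkN⟩ := mE _ hk
          rw [mB] at hM hN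
          exact tin_not_U h ht hN.1.1 hN.2 hkN.1 (XI.mem_U h hM.1.1 hgM.1)
        have cE2 : (E.image (fun g => t * g)).card = E.card := Finset.card_image_of_injective _ (mul_right_injective t)
        have sub : E ∪ E.image (fun g => t * g) ⊆ Finset.univ.filter (fun g => g ∈ Z) := by
          intro g hg
          rw [Finset.mem_filter]
          refine ⟨Finset.mem_univ _, ?_⟩
          rcases Finset.mem_union.mp hg with hg | hg
          · obtain ⟨M, hM, hgM⟩ := mE _ hg
            exact hgM.2
          · obtain ⟨k, hk, rfl⟩ := Finset.mem_image.mp hg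
            obtain ⟨M, hM, hgM⟩ := mE _ hk
            exact Z.mul_mem (mem_cent.mpr rfl) hgM.2
        have := Finset.card_le_card sub
        rw [Finset.card_union_of_disjoint dj, cE2, cE] at this
        have cZ : Nat.card Z = (Finset.univ.filter (fun g => g ∈ Z)).card := by
          rw [Nat.card_eq_fintype_card]
          exact (Fintype.card_of_subtype _ (by intro g; simp))
        change _ ≤ Nat.card Z
        omega
  · omega
  · intro n hn
    obtain ⟨M, hM, rfl⟩ := Finset.mem_image.mp hn
    exact ⟨M, ((mA M).mp hM).1, ((mA M).mp hM).2, rfl⟩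

/-- the local form of the main result -/
structure Fin2 (x : G) (a e : ℕ) : Prop where
  ad : AD x a e
  cases : (a = 4 ∧ e = 1) ∨ ((a = 7 ∧ e = 1) ∧ ∀ t, t * x * t⁻¹ = x⁻¹ → ∃ M, MX x M ∧ ¬ Tin t M ∧ Nat.card M = 7)

lemma fin2 [Finite G] (hT : TR G) {x : G} (h : SC x) (ih : IH.{u} (Nat.card G)) : ∃ a e, Fin2 x a e := by
  obtain ⟨a, e, D⟩ := exists_AD hT h
  refine ⟨a, e, D, ?_⟩
  obtain ⟨t0, ht0⟩ := exists_inv hT h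
  have key : (a = 4 ∧ e = 1) ∨ (a = 7 ∧ e = 1) := by
    obtain ⟨s, S, σ, T, p1, p2, p3, p4, p5⟩ := pack h ih ht0 D
    exact numer D.a4 D.amod D.emod D.cU s p1 p2 S σ T p3 p4
  rcases key with k | ⟨rfl, rfl⟩
  · exact Or.inl k
  right
  refine ⟨⟨rfl, rfl⟩, fun t ht => ?_⟩
  obtain ⟨s, S, σ, T, p1, p2, p3, p4, p5⟩ := pack h ih ht D
  have cU := D.cU
  have hb : bnd 7 1 = 11 := by decide
  rw [hb] at p1 p3
  have hT12 : T ≤ 12 := by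
    rcases p3 with ⟨_, rfl⟩ | ⟨q1, q2, q3, q4, q5⟩
    · norm_num
    · have : S ≤ 3 := by nlinarith
      have : S = 2 := by
        interval_cases S
        · rfl
        · norm_num at q2
      subst this
      omega
  have hne : s.Nonempty := by
    rw [Finset.nonempty_iff_ne_empty]
    rintro rfl
    rw [Finset.sum_empty] at p4
    omega
  obtain ⟨n, hn⟩ := hne
  obtain ⟨M, m1, m2, m3⟩ := p5 n hn
  refine ⟨M, m1, m2, ?_⟩
  rw [m3]
  obtain ⟨q1, q2, q3, q4, q5⟩ := p1 n hn
  clear p5 hn m3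
  interval_cases n
  all_goals first | rfl | (exfalso; revert q3; decide) | (exfalso; revert q4; decide) | (exfalso; revert q5; decide)

lemma main_IH (n : ℕ) : IH.{u} n := by
  induction n using Nat.strong_induction_on with
  | _ n ihn =>
    intro Q _ _ x hT h hlt
    have ih := ihn _ hlt
    obtain ⟨a, e, D, hc⟩ := fin2 hT h ih
    rcases hc with ⟨rfl, rfl⟩ | ⟨⟨rfl, rfl⟩, hc⟩
    · left; rw [D.card]; norm_num
    · right
      refine ⟨by rw [D.card]; norm_num, ?_⟩
      obtain ⟨t, ht⟩ := exists_inv hT h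
      obtain ⟨M, m1, m2, m3⟩ := hc t ht
      obtain ⟨⟨u, hu⟩, hu1⟩ := M.ne_bot_iff_exists_ne_one.mp (m1.ne_bot h D)
      replace hu1 : u ≠ 1 := fun e => hu1 (Subtype.ext e)
      refine ⟨u, XI.mem_U h m1.1 hu, hu1, ?_⟩
      have : (⟨u, hu⟩ : M) ^ 7 = 1 := by rw [← m3]; exact pow_card_eq_one'
      simpa using congrArg Subtype.val this

end FT

namespace FT
universe u
variable {G : Type u} [Group G]

lemma solv_ext {A : Subgroup G} (hA : Group.IsSolvable A) {g : G} (hg : g ∈ Subgroup.normalizer (A : Set G)) :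
    Group.IsSolvable (Subgroup.zpowers g ⊔ A : Subgroup G) := by
  have hst : Stab (Subgroup.normalizer (A : Set G)) A := fun l hl o ho =>
    ((Subgroup.mem_normalizer_iff (H := A)).mp hl o).mp ho
  have hz : Subgroup.zpowers g ≤ Subgroup.normalizer (A : Set G) := by simpa using hg
  set L : Subgroup G := Subgroup.zpowers g ⊔ A with hL
  have hLn : L ≤ Subgroup.normalizer (A : Set G) := sup_le hz Subgroup.le_normalizer
  have hAL : A ≤ L := le_sup_right
  haveI nA : (A.subgroupOf L).Normal := ⟨fun n hn l => hst l (hLn l.2) n hn⟩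
  let ψ : Subgroup.zpowers g →* L ⧸ A.subgroupOf L :=
    (QuotientGroup.mk' (A.subgroupOf L)).comp (Subgroup.inclusion (le_sup_left : Subgroup.zpowers g ≤ L))
  have hs : Function.Surjective ψ := by
    intro q
    obtain ⟨⟨l, hl⟩, rfl⟩ := QuotientGroup.mk'_surjective _ q
    obtain ⟨y, hy, o, ho, rfl⟩ := mem_sup_stab hst hz hl
    refine ⟨⟨y, hy⟩, ?_⟩
    change (QuotientGroup.mk _ : L ⧸ A.subgroupOf L) = QuotientGroup.mk _
    rw [QuotientGroup.eq]
    change y⁻¹ * (y * o) ∈ A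
    simpa using ho
  haveI : Group.IsSolvable (Subgroup.zpowers g) := Group.isSolvable_of_comm (fun a b => mul_comm' a b)
  haveI := Group.isSolvable_of_surjective hs
  refine Group.isSolvable_of_ker_le_range (Subgroup.inclusion hAL) (QuotientGroup.mk' (A.subgroupOf L)) ?_
  intro l hl
  rw [QuotientGroup.ker_mk'] at hl
  exact ⟨⟨l, hl⟩, rfl⟩

lemma solv_mono {A B : Subgroup G} (hB : Group.IsSolvable B) (h : A ≤ B) : Group.IsSolvable A :=
  Group.isSolvable_of_isSolvable_injective (Subgroup.inclusion_injective h)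

/-- union of the torsion-free subgroups normalized by `x` and `t` -/
def V (x t : G) : Set G := {u | ∃ M, XI x M ∧ Tin t M ∧ u ∈ M}

lemma V_sub [Finite G] {x t : G} (h : SC x) {u : G} (hu : u ∈ V x t) : u ∈ U x := by
  obtain ⟨M, hM, _, hu⟩ := hu
  exact hM.mem_U h hu

lemma xi_bot (x : G) : XI x (⊥ : Subgroup G) :=
  ⟨fun m hm => by rw [Subgroup.mem_bot] at *; simp [hm], fun m hm _ => hm⟩

lemma U_mul [Finite G] {x : G} (h : SC x) {u q : G} (hu : u ∈ U x) (hq : q ∈ Subgroup.zpowers x) (huq : u * q ∈ U x) : q = 1 := by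
  have nt : ¬ T3 u := by
    intro h3
    exact h3.2 ((U_xi h hu).fr u (Subgroup.subset_closure (by simp)) h3.1)
  rcases h.z_cases hq with e0 | e0 | e0
  · exact e0
  · exfalso
    rw [e0] at huq
    apply nt
    have := huq.2.conj x
    have e : x * (x⁻¹ * (u * x)) * x⁻¹ = u := by group
    rwa [e] at this
  · exfalso
    rw [e0] at huq
    apply nt
    have := huq.1.conj x⁻¹
    have e : x⁻¹ * (x * (u * x⁻¹)) * x⁻¹⁻¹ = u := by group
    rwa [e] at this

lemma z_inverter {x t : G} (h : SC x) (ht : t * x * t⁻¹ = x⁻¹) {p : G} (hp : p ∈ Subgroup.zpowers x) :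
    (t * p) * x * (t * p)⁻¹ = x⁻¹ := by
  have e : p * x * p⁻¹ = x := by rw [h.mem_z.mp hp]; group
  have : (t * p) * x * (t * p)⁻¹ = t * (p * x * p⁻¹) * t⁻¹ := by group
  rw [this, e, ht]

lemma z_swap {x t : G} (h : SC x) (ht : t * x * t⁻¹ = x⁻¹) {p : G} (hp : p ∈ Subgroup.zpowers x) :
    p * t = t * p⁻¹ := by
  obtain ⟨r1, r2⟩ := inv_rel ht
  rcases h.z_cases hp with rfl | rfl | rfl
  · simp
  · exact r2
  · simpa using r1

lemma sol_iff [Finite G] {x t : G} (h : SC x) (ht : t * x * t⁻¹ = x⁻¹) (y : G) :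
    Group.IsSolvable (Subgroup.closure {x, y}) ↔ (∃ u ∈ U x, ∃ p ∈ Subgroup.zpowers x, y = u * p) ∨
      (∃ u ∈ V x t, ∃ p ∈ Subgroup.zpowers x, y = u * (t * p)) := by
  constructor
  · intro hs
    set L := Subgroup.closure {x, y} with hL
    have hx : x ∈ L := Subgroup.subset_closure (by simp)
    have hy : y ∈ L := Subgroup.subset_closure (by simp)
    obtain ⟨O, hO⟩ := exists_O L
    have xiO : XI x O := ⟨fun m hm => hO.stab x hx m hm, hO.fr⟩
    have hA : PA x L O := by
      rcases tri h hO hx with hA | ⟨Q, _, _, φ, sφ, _, sc, tr⟩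
      · exact hA
      · exfalso
        haveI : Group.IsSolvable Q := Group.isSolvable_of_surjective sφ
        have := tr ⊤ inferInstance inferInstance
        apply sc.ne_one
        rw [← Subgroup.mem_bot, ← this]; trivial
    obtain ⟨w, hw, e | e⟩ := hA.elim h hO hx hy
    · left
      refine ⟨w, xiO.mem_U h hw, w⁻¹ * y, ?_, by group⟩
      rw [h.mem_z]
      rcases e with e | e | e <;> rw [e] <;> simp
    · right
      have hn : w⁻¹ * y ∈ L := L.mul_mem (L.inv_mem (hO.le hw)) hy
      have hTn : Tin (w⁻¹ * y) O := fun m hm => hO.stab _ hn m hm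
      obtain ⟨p, hp, e2⟩ := h.inverter ht e
      refine ⟨w, ⟨O, xiO, xiO.tin_all h e ht hTn, hw⟩, p⁻¹ * p⁻¹, Subgroup.mul_mem _ (Subgroup.inv_mem _ hp) (Subgroup.inv_mem _ hp), ?_⟩
      rw [z_swap h ht hp] at e2
      have := congrArg (fun z => w * z) e2
      simpa [mul_assoc] using this
  · have aux : ∀ M : Subgroup G, XI x M → Group.IsSolvable (Subgroup.zpowers x ⊔ M : Subgroup G) := fun M hM =>
      solv_ext (hM.solv h) (mem_NN.mpr hM.tin)
    have xm : ∀ M : Subgroup G, x ∈ Subgroup.zpowers x ⊔ M := fun M =>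
      Subgroup.mem_sup_left (Subgroup.mem_zpowers x)
    rintro (⟨u, hu, p, hp, rfl⟩ | ⟨u, ⟨M, hM, hT, hu⟩, p, hp, rfl⟩)
    · refine solv_mono (aux _ (U_xi h hu)) ?_
      rw [Subgroup.closure_le]
      rintro z (rfl | rfl)
      · exact xm _
      · exact Subgroup.mul_mem _ (Subgroup.mem_sup_right (Subgroup.subset_closure (by simp))) (Subgroup.mem_sup_left hp)
    · have hst : Stab (Subgroup.normalizer (M : Set G)) M := fun l hl o ho =>
        ((Subgroup.mem_normalizer_iff (H := M)).mp hl o).mp ho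
      have hz : Subgroup.zpowers x ≤ Subgroup.normalizer (M : Set G) := by
        have := mem_NN.mpr hM.tin
        simpa using this
      refine solv_mono (solv_ext (aux M hM) (g := t) (mem_NN.mpr ?_)) ?_
      · intro m hm
        obtain ⟨q, hq, o, ho, rfl⟩ := mem_sup_stab hst hz hm
        have e : t * (q * o) * t⁻¹ = (t * q * t⁻¹) * (t * o * t⁻¹) := by group
        rw [e]
        refine Subgroup.mul_mem _ (Subgroup.mem_sup_left ?_) (Subgroup.mem_sup_right (hT o ho))
        have := z_swap h ht (Subgroup.inv_mem _ hq)
        rw [inv_inv] at this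
        rw [← this]
        simpa using hq
      · rw [Subgroup.closure_le]
        rintro z (rfl | rfl)
        · exact Subgroup.mem_sup_right (xm _)
        · refine Subgroup.mul_mem _ (Subgroup.mem_sup_right (Subgroup.mem_sup_right hu)) (Subgroup.mul_mem _
            (Subgroup.mem_sup_left (Subgroup.mem_zpowers t)) (Subgroup.mem_sup_right (Subgroup.mem_sup_left hp)))

lemma sol_card [Finite G] {x t : G} (h : SC x) (ht : t * x * t⁻¹ = x⁻¹) :
    Nat.card {y : G | Group.IsSolvable (Subgroup.closure {x, y})} = 3 * Nat.card (U x) + 3 * Nat.card (V x t) := by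
  let f : (U x × Subgroup.zpowers x) ⊕ (V x t × Subgroup.zpowers x) → {y : G | Group.IsSolvable (Subgroup.closure {x, y})} :=
    Sum.elim (fun z => ⟨z.1 * z.2, (sol_iff h ht _).mpr (Or.inl ⟨_, z.1.2, _, z.2.2, rfl⟩)⟩)
      (fun z => ⟨z.1 * (t * z.2), (sol_iff h ht _).mpr (Or.inr ⟨_, z.1.2, _, z.2.2, rfl⟩)⟩)
  have cross : ∀ u ∈ U x, ∀ p ∈ Subgroup.zpowers x, ∀ v ∈ V x t, ∀ q ∈ Subgroup.zpowers x, u * p ≠ v * (t * q) := by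
    intro u hu p hp v hv q hq e
    obtain ⟨M, hM, hT, hv⟩ := hv
    have hqp : q * p⁻¹ ∈ Subgroup.zpowers x := Subgroup.mul_mem _ hq (Subgroup.inv_mem _ hp)
    set s := t * (q * p⁻¹) with hs
    have hsi := z_inverter h ht hqp
    rw [← hs] at hsi
    have hTs : Tin s M := hM.tin_all h ht hsi hT
    have e1 : u = s * (s⁻¹ * v * s⁻¹⁻¹) := by
      have : u = v * s := by rw [hs, ← mul_assoc, ← mul_assoc, eq_mul_inv_iff_mul_eq, e]; group
      rw [this]; group
    rw [e1] at hu
    exact tin_not_U h hsi hM hTs (hTs.inv v hv) hu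
  have inj1 : ∀ u ∈ U x, ∀ p ∈ Subgroup.zpowers x, ∀ v ∈ U x, ∀ q ∈ Subgroup.zpowers x, u * p = v * q → u = v ∧ p = q := by
    intro u hu p hp v hv q hq e
    have e1 : u = v * (q * p⁻¹) := by rw [← mul_assoc, eq_mul_inv_iff_mul_eq, e]
    have := U_mul h hv (Subgroup.mul_mem _ hq (Subgroup.inv_mem _ hp)) (e1 ▸ hu)
    rw [this, mul_one] at e1
    exact ⟨e1, (mul_inv_eq_one.mp this).symm⟩
  have hf : Function.Bijective f := by
    constructor
    · rintro (⟨⟨u, hu⟩, ⟨p, hp⟩⟩ | ⟨⟨u, hu⟩, ⟨p, hp⟩⟩) (⟨⟨v, hv⟩, ⟨q, hq⟩⟩ | ⟨⟨v, hv⟩, ⟨q, hq⟩⟩) e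
      · have e : u * p = v * q := congrArg Subtype.val e
        obtain ⟨rfl, rfl⟩ := inj1 u hu p hp v hv q hq e
        rfl
      · have e : u * p = v * (t * q) := congrArg Subtype.val e
        exact absurd e (cross u hu p hp v hv q hq)
      · have e : u * (t * p) = v * q := congrArg Subtype.val e
        exact absurd e.symm (cross v hv q hq u hu p hp)
      · have e : u * (t * p) = v * (t * q) := congrArg Subtype.val e
        have sw : ∀ p ∈ Subgroup.zpowers x, t * p = p⁻¹ * t := fun p hp => by
          have := z_swap h ht (Subgroup.inv_mem _ hp); rw [inv_inv] at this; exact this.symm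
        rw [sw p hp, sw q hq, ← mul_assoc, ← mul_assoc] at e
        obtain ⟨rfl, e2⟩ := inj1 u (V_sub h hu) p⁻¹ (Subgroup.inv_mem _ hp) v (V_sub h hv) q⁻¹ (Subgroup.inv_mem _ hq) (mul_right_cancel e)
        obtain rfl := inv_injective e2
        rfl
    · rintro ⟨y, hy⟩
      rcases (sol_iff h ht y).mp hy with ⟨u, hu, p, hp, rfl⟩ | ⟨u, hu, p, hp, rfl⟩
      · exact ⟨Sum.inl (⟨u, hu⟩, ⟨p, hp⟩), rfl⟩
      · exact ⟨Sum.inr (⟨u, hu⟩, ⟨p, hp⟩), rfl⟩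
  rw [← Nat.card_congr (Equiv.ofBijective f hf), Nat.card_sum, Nat.card_prod, Nat.card_prod, h.card_z]
  ring

lemma final [Finite G] (hT : TR G) {x : G} (h : SC x) :
    Nat.card {y : G | Group.IsSolvable (Subgroup.closure {x, y})} = 24 ∨
    Nat.card {y : G | Group.IsSolvable (Subgroup.closure {x, y})} = 78 := by
  classical
  have ih := main_IH.{u} (Nat.card G)
  obtain ⟨a, e, D, hc⟩ := fin2 hT h ih
  obtain ⟨t, ht⟩ := exists_inv hT h
  rw [sol_card h ht]
  have cU := D.cU
  have cG := D.card
  rcases hc with ⟨rfl, rfl⟩ | ⟨⟨rfl, rfl⟩, hc⟩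
  · left
    have hb : bnd 4 1 = 6 := by decide
    have hV : V x t = {1} := by
      ext u
      rw [Set.mem_singleton_iff]
      constructor
      · rintro ⟨M, hM, hTM, hu⟩
        by_contra hu1
        have hMb : M ≠ ⊥ := by rintro rfl; exact hu1 (Subgroup.mem_bot.mp hu)
        obtain ⟨f1, f2, f3⟩ := hM.facts h D hMb
        have := six_dvd h hM le_top (Subgroup.mem_top x) (Subgroup.mem_top t) ht hTM
        rw [Subgroup.card_top, cG] at this
        have h4 : Nat.card M = 4 := by omega
        rw [h4] at this
        norm_num at this
      · rintro rfl
        exact ⟨⊥, xi_bot x, fun m hm => by rw [Subgroup.mem_bot] at *; simp [hm], Subgroup.one_mem _⟩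
    rw [hV]
    have : Nat.card ({1} : Set G) = 1 := by simp
    rw [this]
    omega
  · right
    have hb : bnd 7 1 = 11 := by decide
    obtain ⟨M, m1, m2, m3⟩ := hc t ht
    haveI := Fintype.ofFinite G
    have c1 := card_fs M
    have c2 := card_fs (cj t M)
    rw [card_cj, m3] at c2
    rw [m3] at c1
    have n1 := m1.cj h ht
    have cap : ∀ N : Subgroup G, Nat.card N = 7 → ∀ u ∈ N, u ≠ 1 → u ∉ V x t := by
      rintro N hN u hu hu1 ⟨K, hK, hTK, huK⟩
      have hKb : K ≠ ⊥ := by rintro rfl; exact hu1 (Subgroup.mem_bot.mp huK)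
      obtain ⟨f1, f2, f3⟩ := hK.facts h D hKb
      have sq := card_sq h ht hK hTK
      have k4 : Nat.card K = 4 := by
        generalize Nat.card (K ⊓ Subgroup.centralizer {t} : Subgroup G) = c at sq
        have : c ≤ 3 := by nlinarith
        interval_cases c <;> omega
      have d := (Subgroup.disjoint_of_coprime_natCard (H := N) (K := K) (by rw [hN, k4]; decide)).eq_bot
      have : u ∈ N ⊓ K := ⟨hu, huK⟩
      rw [d] at this
      exact hu1 (Subgroup.mem_bot.mp this)
    have hdisj : Disjoint (fs M) (fs (cj t M)) := by
      rw [Finset.disjoint_left]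
      intro u hu hu'
      rw [mem_fs] at hu hu'
      have hd := Subgroup.card_dvd_of_le (inf_le_left : M ⊓ cj t M ≤ M)
      rw [m3, Nat.dvd_prime (by norm_num)] at hd
      rcases hd with hd | hd
      · have : u ∈ M ⊓ cj t M := ⟨hu.1, hu'.1⟩
        rw [Subgroup.card_eq_one.mp hd] at this
        exact hu.2 (Subgroup.mem_bot.mp this)
      · have e1 := Subgroup.eq_of_le_of_card_ge (inf_le_left : M ⊓ cj t M ≤ M) (by rw [hd, m3])
        have e2 := Subgroup.eq_of_le_of_card_ge (inf_le_right : M ⊓ cj t M ≤ cj t M) (by rw [hd, card_cj, m3])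
        exact m2 (tin_of_cj (e2.symm.trans e1))
    have hUset : Finset.univ.filter (fun g => g ∈ U x) = Finset.univ.filter (fun g => g ∈ V x t) ∪ (fs M ∪ fs (cj t M)) := by
      ext u
      simp only [Finset.mem_union, Finset.mem_filter, Finset.mem_univ, true_and, mem_fs]
      constructor
      · intro hu
        by_cases hu1 : u = 1
        · left; rw [hu1]
          exact ⟨⊥, xi_bot x, fun m hm => by rw [Subgroup.mem_bot] at *; simp [hm], Subgroup.one_mem _⟩
        obtain ⟨N, hN, hle⟩ := exists_MX (U_xi h hu)
        have huN : u ∈ N := hle (Subgroup.subset_closure (by simp))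
        by_cases hTN : Tin t N
        · exact Or.inl ⟨N, hN.1, hTN, huN⟩
        right
        obtain ⟨f1, f2, f3⟩ := hN.1.facts h D (hN.ne_bot h D)
        have hd := Subgroup.card_subgroup_dvd_card N
        have hh := hN.hall h ih ht hTN
        rw [cG] at hd hh
        rw [hb] at f2
        have n7 : Nat.card N = 7 := by
          generalize Nat.card N = n at *
          interval_cases n
          all_goals first | rfl | (exfalso; revert f3; decide) | (exfalso; revert hd; decide) | (exfalso; revert hh; decide)
        rcases MX.share h ih ht m1 m2 hN hTN (by rw [m3, n7]; decide) with rfl | rfl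
        · exact Or.inl ⟨huN, hu1⟩
        · exact Or.inr ⟨huN, hu1⟩
      · rintro (hu | hu | hu)
        · exact V_sub h hu
        · exact m1.1.mem_U h hu.1
        · exact n1.1.mem_U h hu.1
    have hdisj2 : Disjoint (Finset.univ.filter (fun g => g ∈ V x t)) (fs M ∪ fs (cj t M)) := by
      rw [Finset.disjoint_left]
      intro u hu hu'
      have hu := (Finset.mem_filter.mp hu).2
      rcases Finset.mem_union.mp hu' with hu' | hu'
      · exact cap M m3 u (mem_fs.mp hu').1 (mem_fs.mp hu').2 hu
      · exact cap _ (card_cj.trans m3) u (mem_fs.mp hu').1 (mem_fs.mp hu').2 hu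
    have hcard := congrArg Finset.card hUset
    rw [Finset.card_union_of_disjoint hdisj2, Finset.card_union_of_disjoint hdisj] at hcard
    have cc : ∀ W : Set G, Nat.card W = (Finset.univ.filter (fun g => g ∈ W)).card := by
      intro W
      rw [Nat.card_eq_fintype_card]
      exact (Fintype.card_of_subtype _ (by intro g; simp))
    rw [← cc, ← cc] at hcard
    omega

end FT

theorem stmt13 {G : Type*} [Group G] [Finite G]
    (hrad : ∀ N : Subgroup G, N.Normal → IsSolvable N → N = ⊥)
    (x : G) (hx : orderOf x = 3)
    (hself : Subgroup.centralizer {x} = Subgroup.zpowers x) :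
    Nat.card (Sol x) = 24 ∨ Nat.card (Sol x) = 78 := by
  have h : FT.SC x := by
    refine ⟨hx, fun y hy => ?_⟩
    have hy : y ∈ Subgroup.zpowers x := by
      rw [← hself, Subgroup.mem_centralizer_singleton_iff]; exact hy
    have h3 : x ^ 3 = 1 := by rw [← hx]; exact pow_orderOf_eq_one x
    obtain ⟨k, rfl⟩ := Subgroup.mem_zpowers_iff.mp hy
    have hk := zpow_mod_orderOf x k
    rw [hx] at hk
    have : k % ((3 : ℕ) : ℤ) = 0 ∨ k % ((3 : ℕ) : ℤ) = 1 ∨ k % ((3 : ℕ) : ℤ) = 2 := by omega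
    rcases this with e | e | e
    · left; rw [← hk, e]; simp
    · right; left; rw [← hk, e]; simp
    · right; right
      rw [← hk, e, eq_inv_iff_mul_eq_one]
      have e2 : x ^ (2 : ℤ) * x = x ^ 3 := by
        rw [pow_succ x 2]; norm_cast
      rw [e2, h3]
  exact FT.final (fun N hN hs => hrad N hN hs) h
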